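/- arXiv:1506.01817 — 2 statements merged into one kernel-verified Lean document; each statement's English description precedes it below -/
import Mathlib

section
/- Let k be a number field of degree d with ring of integers 𝔬. Let I ⊂ 𝔬[X₁,…,X_n] be an ideal such that the closed subscheme V(I) of 𝔸^n_𝔬 has codimension at least two, i.e. the Krull dimension of 𝔬[X₁,…,X_n]/I is at most n − 1. Let Ω_∞ ⊂ k_∞^n be a bounded subset with μ_∞(∂Ω_∞) = 0 and μ_∞(Ω_∞) > 0. For each nonzero prime ideal 𝔭 set Ω_𝔭 = {x ∈ 𝔬_𝔭^n : there exists f ∈ I with f(x) ≢ 0 (mod 𝔭𝔬_𝔭)}, i.e. the set of x whose reduction modulo 𝔭 does not lie in the F_𝔭-points of V(I). Then lim_{M→∞} limsup_{B→∞} B^{-dn}·#{x ∈ 𝔬^n : x ∈ BΩ_∞ and there exists a prime 𝔭 with N𝔭 > M and x ∉ Ω_𝔭} = 0. -/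
open MeasureTheory Filter Topology Pointwise NumberField IsDedekindDomain

noncomputable instance {K : Type*} [Field K] [NumberField K]
    (v : HeightOneSpectrum (𝓞 K)) :
    MeasurableSpace (v.adicCompletionIntegers K) := borel _

noncomputable instance (priority := 5000) {K : Type*} [Field K] [NumberField K]
    (v : HeightOneSpectrum (𝓞 K)) : Algebra (𝓞 K) (v.adicCompletionIntegers K) :=
  IsDedekindDomain.HeightOneSpectrum.instAlgebraSubtypeAdicCompletionMemValuationSubringAdicCompletionIntegers (𝓞 K) K v

/-- The ideal `I` of `𝔬[X]` generates an ideal of `k[X]` whose elements have no common factor. -/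
def CopIdeal (k : Type*) [Field k] [NumberField k] {n : ℕ}
    (I : Ideal (MvPolynomial (Fin n) (𝓞 k))) : Prop :=
  ∀ h : MvPolynomial (Fin n) k,
    (∀ f ∈ I, h ∣ MvPolynomial.map (algebraMap (𝓞 k) k) f) → IsUnit h

theorem jacobson_int : IsJacobsonRing ℤ := by
  rw [isJacobsonRing_iff_prime_eq]
  intro P hP
  by_cases h : P = ⊥
  · subst h
    rw [eq_bot_iff]
    intro c hc
    rw [Ideal.mem_jacobson_iff] at hc
    obtain ⟨z, hz⟩ := hc c
    rw [Ideal.mem_bot] at hz ⊢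
    have h1 : z * (c * c + 1) = 1 := by linarith
    have h2 : IsUnit (c * c + 1) := IsUnit.of_mul_eq_one_right _ h1
    rcases Int.isUnit_iff.mp h2 with h3 | h3
    · have : c * c = 0 := by linarith
      simpa using this
    · nlinarith [mul_self_nonneg c]
  · have := hP.isMaximal h
    exact Ideal.jacobson_eq_self_of_isMaximal

theorem jacobson_ringOfIntegers (k : Type*) [Field k] [NumberField k] : IsJacobsonRing (𝓞 k) := by
  have := jacobson_int
  exact isJacobsonRing_of_finiteType (A := ℤ)

theorem height_poly {R : Type*} [CommRing R] [IsNoetherianRing R] (P : Ideal (Polynomial R))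
    [P.IsMaximal] : P.height = (P.comap Polynomial.C).height + 1 :=
  Polynomial.height_eq_height_add_one (P.under R) P

theorem height_maximal (k : Type*) [Field k] [NumberField k] (n : ℕ)
    (m : Ideal (MvPolynomial (Fin n) (𝓞 k))) (hm : m.IsMaximal) :
    ((n + 1 : ℕ) : ℕ∞) ≤ m.height := by
  have := jacobson_ringOfIntegers k
  induction n with
  | zero =>
    let e := (MvPolynomial.isEmptyAlgEquiv (𝓞 k) (Fin 0)).toRingEquiv.symm
    rw [← RingEquiv.height_comap e]
    have : (Ideal.comap e m).IsMaximal := Ideal.comap_isMaximal_of_equiv e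
    simp only [zero_add, Nat.cast_one]
    rw [Order.one_le_iff_ne_zero, Ne, Ideal.height_eq_zero_iff_eq_bot]
    exact Ring.ne_bot_of_isMaximal_of_not_isField this (RingOfIntegers.not_isField k)
  | succ n ih =>
    let e := (MvPolynomial.finSuccEquiv (𝓞 k) n).toRingEquiv.symm
    rw [← RingEquiv.height_comap e]
    have hM : (Ideal.comap e m).IsMaximal := Ideal.comap_isMaximal_of_equiv e
    set P := Ideal.comap e m
    rw [height_poly P]
    have := ih _ (Polynomial.isMaximal_comap_C_of_isJacobsonRing P)
    push_cast at this ⊢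
    gcongr

theorem clear_denom {k : Type*} [Field k] [NumberField k] {n : ℕ} (q : MvPolynomial (Fin n) k) :
    ∃ a : 𝓞 k, a ≠ 0 ∧ ∃ q₀ : MvPolynomial (Fin n) (𝓞 k),
      MvPolynomial.map (algebraMap (𝓞 k) k) q₀ =
        MvPolynomial.C (algebraMap (𝓞 k) k a) * q := by
  induction q using MvPolynomial.induction_on with
  | C c =>
    obtain ⟨⟨b, hb⟩, x, hx⟩ := IsLocalization.exists_integer_multiple (nonZeroDivisors (𝓞 k)) c
    refine ⟨b, nonZeroDivisors.ne_zero hb, MvPolynomial.C x, ?_⟩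
    rw [MvPolynomial.map_C, hx, ← MvPolynomial.C_mul]
    simp [Algebra.smul_def]
  | add p q hp hq =>
    obtain ⟨a, ha, p₀, hp₀⟩ := hp
    obtain ⟨b, hb, q₀, hq₀⟩ := hq
    refine ⟨a * b, mul_ne_zero ha hb, MvPolynomial.C b * p₀ + MvPolynomial.C a * q₀, ?_⟩
    simp only [map_add, map_mul, hp₀, hq₀, MvPolynomial.map_C]
    ring
  | mul_X p i hp =>
    obtain ⟨a, ha, p₀, hp₀⟩ := hp
    refine ⟨a, ha, p₀ * MvPolynomial.X i, ?_⟩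
    simp only [map_mul, hp₀, MvPolynomial.map_X]
    ring

theorem cop_of_dim {k : Type*} [Field k] [NumberField k] {n : ℕ}
    (I : Ideal (MvPolynomial (Fin n) (𝓞 k)))
    (hcodim : ringKrullDim (MvPolynomial (Fin n) (𝓞 k) ⧸ I) + 1 ≤ (n : WithBot ℕ∞)) :
    CopIdeal k I := by
  classical
  have := jacobson_ringOfIntegers k
  intro h hh
  by_contra hu
  have hinj : Function.Injective (MvPolynomial.map (σ := Fin n) (algebraMap (𝓞 k) k)) :=
    MvPolynomial.map_injective _ (FaithfulSMul.algebraMap_injective (𝓞 k) k)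
  have hunit : ∀ a : 𝓞 k, a ≠ 0 → IsUnit (MvPolynomial.C (σ := Fin n) (algebraMap (𝓞 k) k a)) := by
    intro a ha
    exact (IsUnit.mk0 _ (by simpa using ha)).map MvPolynomial.C
  obtain ⟨a, ha, h₀, hh₀⟩ := clear_denom h
  -- common denominator
  have key : ∀ f ∈ I, ∃ c : 𝓞 k, c ≠ 0 ∧ MvPolynomial.C c * f ∈ Ideal.span {h₀} := by
    intro f hf
    obtain ⟨q, hq⟩ := hh f hf
    obtain ⟨b, hb, q₀, hq₀⟩ := clear_denom q
    refine ⟨a * b, mul_ne_zero ha hb, ?_⟩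
    rw [Ideal.mem_span_singleton]
    refine ⟨q₀, hinj ?_⟩
    simp only [map_mul, MvPolynomial.map_C, hq, hh₀, hq₀]
    ring
  obtain ⟨G, hG⟩ := (isNoetherianRing_iff_ideal_fg _).mp inferInstance I
  have hGI : ∀ g ∈ G, g ∈ I := fun g hg => hG ▸ Ideal.subset_span hg
  obtain ⟨c, hc, hcG⟩ : ∃ c : 𝓞 k, c ≠ 0 ∧ ∀ g ∈ G, MvPolynomial.C c * g ∈ Ideal.span {h₀} := by
    clear hG
    induction G using Finset.induction_on with
    | empty => exact ⟨1, one_ne_zero, by simp⟩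
    | insert g G hg ih =>
      obtain ⟨c, hc, h1⟩ := ih (fun g hg => hGI g (Finset.mem_insert_of_mem hg))
      obtain ⟨c', hc', h2⟩ := key g (hGI g (Finset.mem_insert_self _ _))
      refine ⟨c * c', mul_ne_zero hc hc', ?_⟩
      intro f hf
      rw [map_mul]
      rcases Finset.mem_insert.mp hf with rfl | hf
      · rw [mul_assoc]; exact Ideal.mul_mem_left _ _ h2
      · rw [mul_comm (MvPolynomial.C c), mul_assoc]; exact Ideal.mul_mem_left _ _ (h1 f hf)
  have hcI : ∀ Q : Ideal (MvPolynomial (Fin n) (𝓞 k)), Q.IsPrime → h₀ ∈ Q →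
      MvPolynomial.C c ∉ Q → I ≤ Q := by
    intro Q hQ h1 h2
    rw [← hG, Ideal.span_le]
    intro g hg
    have h3 : MvPolynomial.C c * g ∈ Q :=
      (Ideal.span_singleton_le_iff_mem Q).mpr h1 (hcG g hg)
    exact (hQ.mem_or_mem h3).resolve_left h2
  -- a maximal ideal
  obtain ⟨m, hm, hhm, hcm⟩ : ∃ m : Ideal (MvPolynomial (Fin n) (𝓞 k)), m.IsMaximal ∧ h₀ ∈ m ∧
      MvPolynomial.C c ∉ m := by
    by_contra hcon
    push Not at hcon
    have h1 : MvPolynomial.C c ∈ (Ideal.span {h₀}).radical.jacobson := by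
      rw [Ideal.jacobson, Ideal.mem_sInf]
      rintro m ⟨hm1, hm2⟩
      exact hcon m hm2 (hm1 (Ideal.le_radical (Ideal.mem_span_singleton_self _)))
    rw [IsJacobsonRing.out inferInstance (Ideal.radical_isRadical _), Ideal.mem_radical_iff] at h1
    obtain ⟨N, hN⟩ := h1
    rw [Ideal.mem_span_singleton] at hN
    obtain ⟨q, hq⟩ := hN
    have h2 := congrArg (MvPolynomial.map (algebraMap (𝓞 k) k)) hq
    simp only [map_mul, map_pow, MvPolynomial.map_C, hh₀] at h2
    have h3 := (hunit c hc).pow N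
    rw [h2] at h3
    exact hu (isUnit_of_mul_isUnit_right (isUnit_of_mul_isUnit_left h3))
  have h1 := height_maximal k n m hm
  have h2 := Ideal.height_le_height_add_one_of_mem hhm
  have hpr : (m.map (Ideal.Quotient.mk (Ideal.span {h₀}))).IsPrime := by
    apply Ideal.map_isPrime_of_surjective Ideal.Quotient.mk_surjective
    rw [Ideal.mk_ker]
    exact (Ideal.span_singleton_le_iff_mem m).mpr hhm
  obtain ⟨l, hl, hlen⟩ := Ideal.exists_ltSeries_length_eq_height
    (m.map (Ideal.Quotient.mk (Ideal.span {h₀})))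
  have h3 : n ≤ l.length := by
    have h4 := h1.trans h2
    rw [← hlen] at h4
    have : n + 1 ≤ l.length + 1 := by exact_mod_cast h4
    omega
  have hmem : ∀ i, PrimeSpectrum.comap (Ideal.Quotient.mk (Ideal.span {h₀})) (l i) ∈
      PrimeSpectrum.zeroLocus (I : Set (MvPolynomial (Fin n) (𝓞 k))) := by
    intro i
    rw [PrimeSpectrum.mem_zeroLocus]
    apply hcI _ (PrimeSpectrum.isPrime _)
    · rw [PrimeSpectrum.comap_asIdeal, Ideal.mem_comap]
      have : Ideal.Quotient.mk (Ideal.span {h₀}) h₀ = 0 :=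
        Ideal.Quotient.eq_zero_iff_mem.mpr (Ideal.mem_span_singleton_self _)
      rw [this]; exact Ideal.zero_mem _
    · intro hc'
      apply hcm
      have h5 : l i ≤ l.last := LTSeries.monotone l (Fin.le_last i)
      rw [hl] at h5
      have h6 : (l i).asIdeal ≤ m.map (Ideal.Quotient.mk (Ideal.span {h₀})) := h5
      rw [PrimeSpectrum.comap_asIdeal, Ideal.mem_comap] at hc'
      have h7 := h6 hc'
      rw [← Ideal.mem_comap, Ideal.comap_map_of_surjective _ Ideal.Quotient.mk_surjective,
        ← RingHom.ker_eq_comap_bot, Ideal.mk_ker] at h7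
      rwa [sup_eq_left.mpr ((Ideal.span_singleton_le_iff_mem m).mpr hhm)] at h7
  let L : LTSeries (PrimeSpectrum.zeroLocus (I : Set (MvPolynomial (Fin n) (𝓞 k)))) :=
    { length := l.length
      toFun := fun i => ⟨_, hmem i⟩
      step := by
        intro i
        have h8 : l i.castSucc < l i.succ := l.step i
        change PrimeSpectrum.comap _ _ < PrimeSpectrum.comap _ _
        refine lt_of_le_of_ne ?_ ?_
        · exact Ideal.comap_mono (f := Ideal.Quotient.mk (Ideal.span {h₀})) h8.le
        · intro h9
          exact h8.ne (PrimeSpectrum.comap_injective_of_surjective _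
            Ideal.Quotient.mk_surjective h9) }
  have h10 : (L.length : WithBot ℕ∞) ≤ ringKrullDim (MvPolynomial (Fin n) (𝓞 k) ⧸ I) := by
    rw [ringKrullDim_quotient]
    exact Order.LTSeries.length_le_krullDim L
  have h11 : ((l.length + 1 : ℕ) : WithBot ℕ∞) ≤ (n : WithBot ℕ∞) := by
    refine le_trans ?_ hcodim
    push_cast
    gcongr
  have h12 : l.length + 1 ≤ n := by exact_mod_cast h11
  omega

attribute [local instance] Polynomial.algebra Polynomial.isLocalization in
theorem exists_const_mem {R : Type*} [CommRing R] [IsDomain R] [UniqueFactorizationMonoid R]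
    (𝔞 : Ideal (Polynomial R)) (h𝔞 : ∀ h : Polynomial R, (∀ f ∈ 𝔞, h ∣ f) → IsUnit h) :
    ∃ r : R, r ≠ 0 ∧ Polynomial.C r ∈ 𝔞 := by
  classical
  let F := FractionRing R
  obtain ⟨H, hH⟩ : ∃ H : Polynomial F, 𝔞.map (algebraMap (Polynomial R) (Polynomial F)) =
      Ideal.span {H} :=
    ⟨_, (Ideal.span_singleton_generator _).symm⟩
  have hmap : ∀ f, algebraMap (Polynomial R) (Polynomial F) f = f.map (algebraMap R F) :=
    fun f => rfl
  have hdiv : ∀ f ∈ 𝔞, H ∣ f.map (algebraMap R F) := by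
    intro f hf
    rw [← Ideal.mem_span_singleton, ← hH, ← hmap]
    exact Ideal.mem_map_of_mem _ hf
  have hH0 : H ≠ 0 := by
    rintro rfl
    have := h𝔞 0 (fun f hf => by
      have := hdiv f hf
      rw [zero_dvd_iff] at this ⊢
      exact (Polynomial.map_eq_zero_iff (FaithfulSMul.algebraMap_injective R F)).mp this)
    exact not_isUnit_zero this
  let : NormalizedGCDMonoid R := Nonempty.some inferInstance
  obtain ⟨b, hb, hbH⟩ := IsLocalization.integerNormalization_spec (nonZeroDivisors R) H
  set p := IsLocalization.integerNormalization (nonZeroDivisors R) H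
  have hb0 : algebraMap R F b ≠ 0 := by
    simpa using nonZeroDivisors.ne_zero hb
  have hpH : p.map (algebraMap R F) = Polynomial.C (algebraMap R F b) * H := by
    rw [hbH, ← Polynomial.smul_eq_C_mul, algebraMap_smul]
  have hpdvd : p.primPart.map (algebraMap R F) ∣ H := by
    have h1 : p.primPart.map (algebraMap R F) ∣ Polynomial.C (algebraMap R F b) * H := by
      rw [← hpH]
      exact Polynomial.map_dvd _ p.primPart_dvd
    exact (IsUnit.dvd_mul_left ((IsUnit.mk0 _ hb0).map Polynomial.C)).mp h1
  have hp0 : p ≠ 0 := by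
    intro h0
    rw [h0, Polynomial.map_zero] at hpH
    exact mul_ne_zero (by simpa using hb0) hH0 hpH.symm
  have hunit : IsUnit p.primPart := by
    apply h𝔞
    intro f hf
    exact p.isPrimitive_primPart.dvd_of_fraction_map_dvd_fraction_map (hpdvd.trans (hdiv f hf))
  have hHu : IsUnit H := by
    have h1 : IsUnit (p.map (algebraMap R F)) := by
      rw [p.eq_C_content_mul_primPart, Polynomial.map_mul, Polynomial.map_C]
      refine IsUnit.mul ((IsUnit.mk0 _ ?_).map Polynomial.C) ?_
      · have : p.content ≠ 0 := by rwa [Ne, Polynomial.content_eq_zero_iff]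
        simpa using this
      · exact hunit.map (Polynomial.mapRingHom (algebraMap R F))
    rw [hpH] at h1
    exact isUnit_of_mul_isUnit_right h1
  have htop : algebraMap (Polynomial R) (Polynomial F) 1 ∈
      𝔞.map (algebraMap (Polynomial R) (Polynomial F)) := by
    rw [hH, Ideal.span_singleton_eq_top.mpr hHu]
    trivial
  rw [IsLocalization.algebraMap_mem_map_algebraMap_iff
    ((nonZeroDivisors R).map (Polynomial.C : R →+* Polynomial R))] at htop
  obtain ⟨m, ⟨r, hr, rfl⟩, hm⟩ := htop
  exact ⟨r, nonZeroDivisors.ne_zero hr, by simpa using hm⟩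

theorem map_finSuccEquiv_symm {R S : Type*} [CommRing R] [CommRing S] (φ : R →+* S) (n : ℕ)
    (p : Polynomial (MvPolynomial (Fin n) R)) :
    MvPolynomial.map φ ((MvPolynomial.finSuccEquiv R n).symm p) =
      (MvPolynomial.finSuccEquiv S n).symm (p.map (MvPolynomial.map φ)) := by
  apply (MvPolynomial.finSuccEquiv S n).injective
  rw [AlgEquiv.apply_symm_apply]
  obtain ⟨q, rfl⟩ := (MvPolynomial.finSuccEquiv R n).surjective p
  rw [AlgEquiv.symm_apply_apply]
  induction q using MvPolynomial.induction_on with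
  | C c => simp [MvPolynomial.finSuccEquiv_apply]
  | add p q hp hq => simp [hp, hq]
  | mul_X p i hp =>
    simp only [map_mul, hp, Polynomial.map_mul, MvPolynomial.map_X]
    congr 1
    refine Fin.cases ?_ (fun j => ?_) i
    · simp [MvPolynomial.finSuccEquiv_X_zero]
    · simp [MvPolynomial.finSuccEquiv_X_succ]

attribute [local instance] MvPolynomial.algebraMvPolynomial in
theorem elim_exists {k : Type*} [Field k] [NumberField k] {n : ℕ}
    (I : Ideal (MvPolynomial (Fin (n + 1)) (𝓞 k))) (hI : CopIdeal k I) :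
    ∃ r : MvPolynomial (Fin n) (𝓞 k), r ≠ 0 ∧
      (MvPolynomial.finSuccEquiv (𝓞 k) n).symm (Polynomial.C r) ∈ I := by
  let φ := MvPolynomial.map (σ := Fin (n + 1)) (algebraMap (𝓞 k) k)
  let e := MvPolynomial.finSuccEquiv k n
  obtain ⟨r₁, hr₁, hr₁I⟩ := exists_const_mem
    (Ideal.comap (e.symm : Polynomial (MvPolynomial (Fin n) k) →+* _) (I.map φ)) (by
      intro h hh
      have : IsUnit (e.symm h) := by
        apply hI
        intro f hf
        have h1 := hh (e (φ f)) (by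
          rw [Ideal.mem_comap]
          simpa using Ideal.mem_map_of_mem φ hf)
        have h2 := map_dvd e.symm h1
        simpa using h2
      simpa using this.map e)
  rw [Ideal.mem_comap] at hr₁I
  obtain ⟨a, ha, r₀, hr₀⟩ := clear_denom r₁
  have h3 : φ ((MvPolynomial.finSuccEquiv (𝓞 k) n).symm (Polynomial.C r₀)) ∈ I.map φ := by
    change MvPolynomial.map _ _ ∈ _
    rw [map_finSuccEquiv_symm, Polynomial.map_C, hr₀, map_mul, map_mul]
    exact Ideal.mul_mem_left _ _ hr₁I
  have h4 : algebraMap (MvPolynomial (Fin (n + 1)) (𝓞 k)) (MvPolynomial (Fin (n + 1)) k)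
      ((MvPolynomial.finSuccEquiv (𝓞 k) n).symm (Polynomial.C r₀)) ∈
        I.map (algebraMap (MvPolynomial (Fin (n + 1)) (𝓞 k)) (MvPolynomial (Fin (n + 1)) k)) := h3
  rw [IsLocalization.algebraMap_mem_map_algebraMap_iff
    ((nonZeroDivisors (𝓞 k)).map (MvPolynomial.C : 𝓞 k →+* _))] at h4
  obtain ⟨m, ⟨c, hc, rfl⟩, hm⟩ := h4
  have hc0 := nonZeroDivisors.ne_zero hc
  have hr0 : r₀ ≠ 0 := by
    rintro rfl
    rw [map_zero] at hr₀
    have := mul_eq_zero.mp hr₀.symm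
    simp [ha, hr₁] at this
  refine ⟨MvPolynomial.C c * r₀, mul_ne_zero (by simpa using hc0) hr0, ?_⟩
  rw [map_mul, map_mul]
  have h5 : (MvPolynomial.finSuccEquiv (𝓞 k) n).symm (Polynomial.C (MvPolynomial.C c)) =
      MvPolynomial.C c := by
    exact RingHom.congr_fun (MvPolynomial.finSuccEquiv_comp_C_eq_C n) c
  rw [h5]
  exact hm

/-- The ideal generated by the coefficients (with respect to the first variable) of elements of
a finite set. -/
noncomputable def coeffIdeal (k : Type*) [Field k] [NumberField k] {n : ℕ}
    (G : Finset (MvPolynomial (Fin (n + 1)) (𝓞 k))) : Ideal (MvPolynomial (Fin n) (𝓞 k)) :=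
  Ideal.span {c | ∃ g ∈ G, ∃ i, c = (MvPolynomial.finSuccEquiv (𝓞 k) n g).coeff i}

theorem cop_coeffIdeal {k : Type*} [Field k] [NumberField k] {n : ℕ}
    (I : Ideal (MvPolynomial (Fin (n + 1)) (𝓞 k))) (hI : CopIdeal k I)
    (G : Finset (MvPolynomial (Fin (n + 1)) (𝓞 k))) (hG : Ideal.span (G : Set _) = I) :
    CopIdeal k (coeffIdeal k G) := by
  intro h hh
  let e := MvPolynomial.finSuccEquiv k n
  have h1 : IsUnit (e.symm (Polynomial.C h)) := by
    apply hI
    have : I ≤ Ideal.comap (MvPolynomial.map (algebraMap (𝓞 k) k))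
        (Ideal.span {e.symm (Polynomial.C h)}) := by
      rw [← hG, Ideal.span_le]
      intro g hg
      rw [SetLike.mem_coe, Ideal.mem_comap, Ideal.mem_span_singleton]
      have h2 : Polynomial.C h ∣ (MvPolynomial.finSuccEquiv (𝓞 k) n g).map
          (MvPolynomial.map (algebraMap (𝓞 k) k)) := by
        rw [Polynomial.C_dvd_iff_dvd_coeff]
        intro i
        rw [Polynomial.coeff_map]
        exact hh _ (Ideal.subset_span ⟨g, hg, i, rfl⟩)
      have h3 := map_dvd e.symm h2
      rw [← map_finSuccEquiv_symm] at h3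
      simpa using h3
    intro f hf
    have := this hf
    rwa [Ideal.mem_comap, Ideal.mem_span_singleton] at this
  have h2 := h1.map e
  rw [AlgEquiv.apply_symm_apply, Polynomial.isUnit_C] at h2
  exact h2

theorem embed_bound {k : Type*} [Field k] [NumberField k] {d : ℕ} (hd : d = Module.finrank ℚ k)
    (ι : 𝓞 k →ₗ[ℤ] (Fin d → ℝ)) (hspan : Submodule.span ℝ (Set.range ι) = ⊤)
    (L : 𝓞 k →ₗ[ℤ] ℂ) : ∃ c : ℝ, 0 ≤ c ∧ ∀ y, ‖L y‖ ≤ c * ‖ι y‖ := by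
  let b := RingOfIntegers.basis k
  have hsp : (⊤ : Submodule ℝ (Fin d → ℝ)) ≤ Submodule.span ℝ (Set.range (ι ∘ b)) := by
    rw [← hspan, Submodule.span_le]
    rintro _ ⟨y, rfl⟩
    rw [← b.sum_repr y, map_sum]
    refine Submodule.sum_mem _ fun j _ => ?_
    rw [map_zsmul]
    exact zsmul_mem (Submodule.subset_span (Set.mem_range_self j)) _
  have hcard : Fintype.card (Module.Free.ChooseBasisIndex ℤ (𝓞 k)) =
      Module.finrank ℝ (Fin d → ℝ) := by
    rw [Module.finrank_fin_fun, hd, ← Module.finrank_eq_card_chooseBasisIndex,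
      RingOfIntegers.rank]
  let β := basisOfTopLeSpanOfCardEqFinrank (ι ∘ b) hsp hcard
  let Λ : (Fin d → ℝ) →ₗ[ℝ] ℂ := β.constr ℝ (fun j => L (b j))
  have hΛ : ∀ y, Λ (ι y) = L y := by
    intro y
    have : (Λ.restrictScalars ℤ).comp ι = L := by
      apply b.ext
      intro j
      have h1 : ι (b j) = β j := by
        simp [β]
      change Λ (ι (b j)) = _
      rw [h1, Module.Basis.constr_basis]
    exact LinearMap.congr_fun this y
  let Λ' := LinearMap.toContinuousLinearMap Λ
  refine ⟨‖Λ'‖, norm_nonneg _, fun y => ?_⟩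
  rw [← hΛ]
  exact Λ'.le_opNorm (ι y)

/-- A uniform bound on all complex embeddings. -/
theorem embed_bound_all {k : Type*} [Field k] [NumberField k] {d : ℕ}
    (hd : d = Module.finrank ℚ k)
    (ι : 𝓞 k →ₗ[ℤ] (Fin d → ℝ)) (hspan : Submodule.span ℝ (Set.range ι) = ⊤) :
    ∃ c : ℝ, 1 ≤ c ∧ ∀ (σ : k →ₐ[ℚ] ℂ) (y : 𝓞 k), ‖σ (y : k)‖ ≤ c * ‖ι y‖ := by
  choose c hc h using fun σ : k →ₐ[ℚ] ℂ => embed_bound hd ι hspan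
    (((σ : k →+* ℂ).comp (algebraMap (𝓞 k) k)).toAddMonoidHom.toIntLinearMap)
  refine ⟨1 + ∑ σ, c σ, ?_, fun σ y => ?_⟩
  · have := Finset.sum_nonneg (fun σ (_ : σ ∈ Finset.univ) => hc σ)
    linarith
  · refine (h σ y).trans ?_
    gcongr
    have := Finset.single_le_sum (fun σ (_ : σ ∈ Finset.univ) => hc σ) (Finset.mem_univ σ)
    linarith

theorem norm_eq_prod {k : Type*} [Field k] [NumberField k] (y : 𝓞 k) :
    (Ideal.absNorm (Ideal.span {y}) : ℝ) = ∏ σ : k →ₐ[ℚ] ℂ, ‖σ (y : k)‖ := by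
  rw [Ideal.absNorm_span_singleton, ← norm_prod, ← Algebra.norm_eq_prod_embeddings ℚ ℂ (y : k)]
  have h1 := Algebra.coe_norm_int y
  rw [← h1, Nat.cast_natAbs]
  simp

theorem norm_le_of_embed {k : Type*} [Field k] [NumberField k] {d : ℕ}
    (hd : d = Module.finrank ℚ k) (y : 𝓞 k) (T : ℝ) (h : ∀ σ : k →ₐ[ℚ] ℂ, ‖σ (y : k)‖ ≤ T) :
    (Ideal.absNorm (Ideal.span {y}) : ℝ) ≤ T ^ d := by
  rw [norm_eq_prod]
  refine (Finset.prod_le_prod (fun _ _ => norm_nonneg _) (fun σ _ => h σ)).trans ?_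
  rw [Finset.prod_const, Finset.card_univ, AlgHom.card, hd]

theorem pack {d : ℕ} {α : Type*} (ι : α → (Fin d → ℝ)) (T : Set α) (l B : ℝ) (hl : 0 < l)
    (hB : 0 ≤ B)
    (hT : ∀ x ∈ T, ‖ι x‖ ≤ B) (hs : ∀ x ∈ T, ∀ y ∈ T, x ≠ y → l ≤ ‖ι x - ι y‖) :
    T.Finite ∧ (T.ncard : ℝ) ≤ (2 * (B / l) + 2) ^ d := by
  classical
  let φ : α → Fin d → ℤ := fun x i => ⌊ι x i / l⌋
  let U : Finset (Fin d → ℤ) := Fintype.piFinset fun _ => Finset.Icc ⌊-(B / l)⌋ ⌊B / l⌋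
  have hmap : Set.MapsTo φ T (U : Set (Fin d → ℤ)) := by
    intro x hx
    simp only [U, φ, Finset.mem_coe, Fintype.mem_piFinset, Finset.mem_Icc]
    intro i
    have h1 : |ι x i| ≤ B := (norm_le_pi_norm (ι x) i).trans (hT x hx)
    rw [abs_le] at h1
    constructor
    · apply Int.floor_le_floor
      rw [← neg_div]
      gcongr
      exact h1.1
    · apply Int.floor_le_floor
      gcongr
      exact h1.2
  have hinj : Set.InjOn φ T := by
    intro x hx y hy hxy
    by_contra hne
    have h1 := hs x hx y hy hne
    have h2 : ‖ι x - ι y‖ < l := by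
      rw [pi_norm_lt_iff hl]
      intro i
      have h3 : ⌊ι x i / l⌋ = ⌊ι y i / l⌋ := congrFun hxy i
      have h4 := Int.abs_sub_lt_one_of_floor_eq_floor h3
      rw [← sub_div, abs_div, abs_of_pos hl, div_lt_one hl] at h4
      exact h4
    linarith
  have hfin : T.Finite := Set.Finite.of_injOn hmap hinj U.finite_toSet
  refine ⟨hfin, ?_⟩
  have h5 : T.ncard ≤ U.card := by
    rw [← Set.ncard_coe_finset U]
    exact Set.ncard_le_ncard_of_injOn φ hmap hinj U.finite_toSet
  have h6 : (U.card : ℝ) ≤ (2 * (B / l) + 2) ^ d := by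
    simp only [U, Fintype.card_piFinset, Int.card_Icc, Finset.prod_const, Finset.card_univ,
      Fintype.card_fin, Nat.cast_pow]
    gcongr
    have h7 := Int.floor_le (B / l)
    have h8 := Int.lt_floor_add_one (-(B / l))
    have h9 : (0 : ℤ) ≤ ⌊B / l⌋ + 1 - ⌊-(B / l)⌋ := by
      have h10 : ⌊-(B / l)⌋ ≤ ⌊B / l⌋ := Int.floor_le_floor (by
        have : 0 ≤ B / l := by positivity
        linarith)
      omega
    have h11 : (((⌊B / l⌋ + 1 - ⌊-(B / l)⌋).toNat : ℤ) : ℝ) =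
        ((⌊B / l⌋ + 1 - ⌊-(B / l)⌋ : ℤ) : ℝ) := by rw [Int.toNat_of_nonneg h9]
    rw [Int.cast_natCast] at h11
    rw [h11]
    push_cast
    linarith
  exact (Nat.cast_le.mpr h5).trans h6

theorem class_count {k : Type*} [Field k] [NumberField k] {d : ℕ}
    (hd : d = Module.finrank ℚ k)
    (ι : 𝓞 k →ₗ[ℤ] (Fin d → ℝ)) (hspan : Submodule.span ℝ (Set.range ι) = ⊤) :
    ∃ C : ℝ, 1 ≤ C ∧ ∀ (𝔞 : Ideal (𝓞 k)), 𝔞 ≠ ⊥ → ∀ (a : 𝓞 k) (B : ℝ), 1 ≤ B →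
      {x : 𝓞 k | ‖ι x‖ ≤ B ∧ x - a ∈ 𝔞}.Finite ∧
      ({x : 𝓞 k | ‖ι x‖ ≤ B ∧ x - a ∈ 𝔞}.ncard : ℝ) ≤ C * (B ^ d / Ideal.absNorm 𝔞 + 1) := by
  obtain ⟨c, hc, hcb⟩ := embed_bound_all hd ι hspan
  have hd0 : d ≠ 0 := by rw [hd]; exact Module.finrank_pos.ne'
  refine ⟨(4 * c) ^ d, one_le_pow₀ (by linarith), fun 𝔞 h𝔞 a B hB => ?_⟩
  have hN : 1 ≤ (Ideal.absNorm 𝔞 : ℝ) := by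
    have : Ideal.absNorm 𝔞 ≠ 0 := by rwa [Ne, Ideal.absNorm_eq_zero_iff]
    exact_mod_cast Nat.one_le_iff_ne_zero.mpr this
  set N : ℝ := (Ideal.absNorm 𝔞 : ℝ)
  obtain ⟨ν, hν, hνd⟩ : ∃ ν : ℝ, 0 < ν ∧ ν ^ d = N :=
    ⟨N ^ ((d : ℝ)⁻¹), by positivity, Real.rpow_inv_natCast_pow (by linarith) hd0⟩
  have hc0 : 0 < c := by linarith
  obtain ⟨h1, h2⟩ := pack ι {x : 𝓞 k | ‖ι x‖ ≤ B ∧ x - a ∈ 𝔞} (ν / c) B (by positivity)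
    (by linarith) (fun x hx => hx.1) (by
      intro x hx y hy hxy
      have h3 : x - y ∈ 𝔞 := by
        have := 𝔞.sub_mem hx.2 hy.2
        simpa using this
      have h4 : N ≤ Ideal.absNorm (Ideal.span {x - y}) := by
        have h5 : Ideal.absNorm 𝔞 ∣ Ideal.absNorm (Ideal.span {x - y}) :=
          Ideal.absNorm_dvd_absNorm_of_le ((Ideal.span_singleton_le_iff_mem _).mpr h3)
        have h6 : Ideal.absNorm (Ideal.span {x - y}) ≠ 0 := by
          rw [Ne, Ideal.absNorm_eq_zero_iff, Ideal.span_singleton_eq_bot]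
          exact sub_ne_zero.mpr hxy
        exact Nat.cast_le.mpr (Nat.le_of_dvd (Nat.pos_of_ne_zero h6) h5)
      have h7 := norm_le_of_embed hd (x - y) _ (fun σ => hcb σ (x - y))
      have h8 : ν ^ d ≤ (c * ‖ι (x - y)‖) ^ d := by rw [hνd]; exact h4.trans h7
      have h9 : ν ≤ c * ‖ι (x - y)‖ := le_of_pow_le_pow_left₀ hd0 (by positivity) h8
      rw [map_sub] at h9
      rw [div_le_iff₀ hc0]
      linarith)
  refine ⟨h1, h2.trans ?_⟩
  have h10 : 2 * (B / (ν / c)) + 2 ≤ 4 * max (B * c / ν) 1 := by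
    have e1 : B / (ν / c) = B * c / ν := by field_simp
    rw [e1]
    have := le_max_left (B * c / ν) 1
    have := le_max_right (B * c / ν) 1
    linarith
  have h11 : (max (B * c / ν) 1) ^ d ≤ c ^ d * (B ^ d / N + 1) := by
    have hcd : 1 ≤ c ^ d := one_le_pow₀ hc
    rcases max_choice (B * c / ν) 1 with h | h <;> rw [h]
    · rw [div_pow, mul_pow, hνd]
      have : B ^ d * c ^ d / N = c ^ d * (B ^ d / N) := by ring
      rw [this, mul_add]
      linarith
    · rw [one_pow]
      have : 0 ≤ B ^ d / N := by positivity
      nlinarith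
  calc (2 * (B / (ν / c)) + 2) ^ d ≤ (4 * max (B * c / ν) 1) ^ d := by
        gcongr
    _ = 4 ^ d * (max (B * c / ν) 1) ^ d := by rw [mul_pow]
    _ ≤ 4 ^ d * (c ^ d * (B ^ d / N + 1)) := by gcongr
    _ = _ := by rw [mul_pow]; ring

theorem fiber_primes_le {k : Type*} [Field k] [NumberField k]
    (Q : Finset (HeightOneSpectrum (𝓞 k))) (p : ℕ) (hp : p.Prime)
    (hQ : ∀ v ∈ Q, (p : 𝓞 k) ∈ v.asIdeal) : Q.card ≤ Module.finrank ℚ k := by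
  classical
  -- the product of the primes divides `p`
  have h1 : ∏ v ∈ Q, v.asIdeal ∣ Ideal.span {(p : 𝓞 k)} := by
    apply Finset.prod_dvd_of_coprime
    · intro v hv w hw hvw
      apply Ideal.isCoprime_of_isMaximal
      intro h
      exact hvw (HeightOneSpectrum.ext h)
    · intro v hv
      rw [Ideal.dvd_iff_le, Ideal.span_singleton_le_iff_mem]
      exact hQ v hv
  have h2 := map_dvd Ideal.absNorm h1
  rw [map_prod] at h2
  have h3 : Ideal.absNorm (Ideal.span {(p : 𝓞 k)}) = p ^ Module.finrank ℚ k := by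
    rw [Ideal.absNorm_span_singleton]
    have : (p : 𝓞 k) = algebraMap ℤ (𝓞 k) (p : ℤ) := by simp
    rw [this, Algebra.norm_algebraMap, RingOfIntegers.rank, Int.natAbs_pow, Int.natAbs_natCast]
  rw [h3] at h2
  have h4 : ∀ v ∈ Q, p ∣ Ideal.absNorm v.asIdeal := by
    intro v hv
    have h5 : Ideal.absNorm v.asIdeal ∣ p ^ Module.finrank ℚ k := by
      rw [← h3]
      exact Ideal.absNorm_dvd_absNorm_of_le ((Ideal.span_singleton_le_iff_mem _).mpr (hQ v hv))
    obtain ⟨i, hi, h6⟩ := (Nat.dvd_prime_pow hp).mp h5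
    have h7 : i ≠ 0 := by
      rintro rfl
      rw [pow_zero, Ideal.absNorm_eq_one_iff] at h6
      exact v.isPrime.ne_top h6
    rw [h6]
    exact dvd_pow_self p h7
  have h8 : p ^ Q.card ∣ p ^ Module.finrank ℚ k := by
    refine dvd_trans ?_ h2
    rw [← Finset.prod_const]
    exact Finset.prod_dvd_prod_of_dvd _ _ h4
  exact (Nat.pow_dvd_pow_iff_le_right hp.one_lt).mp h8

theorem exists_prime_below {k : Type*} [Field k] [NumberField k] (v : HeightOneSpectrum (𝓞 k)) :
    ∃ p : ℕ, p.Prime ∧ (p : 𝓞 k) ∈ v.asIdeal ∧ p ≤ Ideal.absNorm v.asIdeal := by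
  have h0 : Ideal.absNorm v.asIdeal ≠ 0 := by
    rw [Ne, Ideal.absNorm_eq_zero_iff]; exact v.ne_bot
  have h1 : ((Ideal.absNorm v.asIdeal : ℕ) : 𝓞 k) ∈ v.asIdeal := Ideal.absNorm_mem _
  rw [← Nat.prod_primeFactorsList h0, Nat.cast_list_prod, ← Multiset.prod_coe,
    v.isPrime.multiset_prod_mem_iff_exists_mem] at h1
  obtain ⟨x, hx, hxv⟩ := h1
  rw [Multiset.mem_coe, List.mem_map] at hx
  obtain ⟨p, hp, rfl⟩ := hx
  exact ⟨p, Nat.prime_of_mem_primeFactorsList hp, hxv, Nat.le_of_mem_primeFactorsList hp⟩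

theorem summable_primes (k : Type*) [Field k] [NumberField k] :
    Summable (fun v : HeightOneSpectrum (𝓞 k) => 1 / (Ideal.absNorm v.asIdeal : ℝ) ^ 2) := by
  classical
  choose p hp hpv hple using fun v : HeightOneSpectrum (𝓞 k) => exists_prime_below v
  have hs : Summable (fun n : ℕ => 1 / (n : ℝ) ^ 2) :=
    Real.summable_one_div_nat_pow.mpr (by norm_num)
  apply summable_of_sum_le (c := (Module.finrank ℚ k : ℝ) * ∑' n : ℕ, 1 / (n : ℝ) ^ 2)
  · intro v; positivity
  · intro Q
    calc ∑ v ∈ Q, 1 / (Ideal.absNorm v.asIdeal : ℝ) ^ 2 ≤ ∑ v ∈ Q, 1 / (p v : ℝ) ^ 2 := by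
          apply Finset.sum_le_sum
          intro v _
          have := (hp v).pos
          gcongr
          exact hple v
      _ = ∑ q ∈ Q.image p, ∑ v ∈ Q with p v = q, 1 / (p v : ℝ) ^ 2 :=
          (Finset.sum_fiberwise_of_maps_to (fun v hv => Finset.mem_image_of_mem p hv) _).symm
      _ ≤ ∑ q ∈ Q.image p, (Module.finrank ℚ k : ℝ) * (1 / (q : ℝ) ^ 2) := by
          apply Finset.sum_le_sum
          intro q hq
          obtain ⟨w, hw, rfl⟩ := Finset.mem_image.mp hq
          have h1 : ∑ v ∈ Q with p v = p w, 1 / (p v : ℝ) ^ 2 =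
              ∑ v ∈ Q with p v = p w, 1 / (p w : ℝ) ^ 2 := by
            apply Finset.sum_congr rfl
            intro v hv
            rw [(Finset.mem_filter.mp hv).2]
          rw [h1, Finset.sum_const, nsmul_eq_mul]
          gcongr
          apply fiber_primes_le _ (p w) (hp w)
          intro v hv
          rw [← (Finset.mem_filter.mp hv).2]
          exact hpv v
      _ = (Module.finrank ℚ k : ℝ) * ∑ q ∈ Q.image p, 1 / (q : ℝ) ^ 2 := by
          rw [Finset.mul_sum]
      _ ≤ _ := by
          gcongr
          exact hs.sum_le_tsum _ (fun _ _ => by positivity)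

theorem prime_tail (k : Type*) [Field k] [NumberField k] (ε : ℝ) (hε : 0 < ε) :
    ∃ M : ℕ, ∀ Q : Finset (HeightOneSpectrum (𝓞 k)), (∀ v ∈ Q, M < Ideal.absNorm v.asIdeal) →
      ∑ v ∈ Q, 1 / (Ideal.absNorm v.asIdeal : ℝ) ^ 2 ≤ ε := by
  obtain ⟨s, hs⟩ := summable_iff_vanishing_norm.mp (summable_primes k) ε hε
  refine ⟨s.sup fun v => Ideal.absNorm v.asIdeal, fun Q hQ => ?_⟩
  have h1 : Disjoint Q s := by
    rw [Finset.disjoint_left]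
    intro v hv hvs
    have h2 := hQ v hv
    have h3 := Finset.le_sup (f := fun v : HeightOneSpectrum (𝓞 k) => Ideal.absNorm v.asIdeal) hvs
    exact absurd h2 (not_lt.mpr h3)
  exact ((le_abs_self _).trans (hs Q h1).le)

theorem value_bound {k : Type*} [Field k] [NumberField k] {d : ℕ}
    (hd : d = Module.finrank ℚ k)
    (ι : 𝓞 k →ₗ[ℤ] (Fin d → ℝ)) (hspan : Submodule.span ℝ (Set.range ι) = ⊤)
    {n : ℕ} (r : MvPolynomial (Fin n) (𝓞 k)) :
    ∃ (C : ℝ) (E : ℕ), 0 ≤ C ∧ ∀ (B : ℝ), 1 ≤ B → ∀ x : Fin n → 𝓞 k, (∀ i, ‖ι (x i)‖ ≤ B) →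
      (Ideal.absNorm (Ideal.span {MvPolynomial.eval x r}) : ℝ) ≤ C * B ^ E := by
  obtain ⟨c, hc, hcb⟩ := embed_bound_all hd ι hspan
  have key : ∃ (C : ℝ) (E : ℕ), 0 ≤ C ∧ ∀ (B : ℝ), 1 ≤ B → ∀ x : Fin n → 𝓞 k,
      (∀ i, ‖ι (x i)‖ ≤ B) → ∀ σ : k →ₐ[ℚ] ℂ,
      ‖σ ((MvPolynomial.eval x r : 𝓞 k) : k)‖ ≤ C * B ^ E := by
    induction r using MvPolynomial.induction_on with
    | C a =>
      refine ⟨c * ‖ι a‖, 0, by positivity, fun B _ x _ σ => ?_⟩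
      simpa using hcb σ a
    | add p q hp hq =>
      obtain ⟨C1, E1, hC1, h1⟩ := hp
      obtain ⟨C2, E2, hC2, h2⟩ := hq
      refine ⟨C1 + C2, E1 + E2, by positivity, fun B hB x hx σ => ?_⟩
      have h3 : B ^ E1 ≤ B ^ (E1 + E2) := pow_le_pow_right₀ hB (by omega)
      have h4 : B ^ E2 ≤ B ^ (E1 + E2) := pow_le_pow_right₀ hB (by omega)
      have h5 : σ ((MvPolynomial.eval x (p + q) : 𝓞 k) : k) =
          σ ((MvPolynomial.eval x p : 𝓞 k) : k) + σ ((MvPolynomial.eval x q : 𝓞 k) : k) := by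
        rw [MvPolynomial.eval_add, ← map_add σ]
        rfl
      rw [h5, add_mul]
      refine (norm_add_le _ _).trans (add_le_add ?_ ?_)
      · exact (h1 B hB x hx σ).trans (by gcongr)
      · exact (h2 B hB x hx σ).trans (by gcongr)
    | mul_X p i hp =>
      obtain ⟨C1, E1, hC1, h1⟩ := hp
      refine ⟨C1 * c, E1 + 1, by positivity, fun B hB x hx σ => ?_⟩
      have h5 : σ ((MvPolynomial.eval x (p * MvPolynomial.X i) : 𝓞 k) : k) =
          σ ((MvPolynomial.eval x p : 𝓞 k) : k) * σ (x i : k) := by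
        rw [MvPolynomial.eval_mul, MvPolynomial.eval_X, ← map_mul σ]
        rfl
      rw [h5, norm_mul]
      have h2 : ‖σ (x i : k)‖ ≤ c * B := (hcb σ (x i)).trans (by gcongr; exact hx i)
      calc _ ≤ (C1 * B ^ E1) * (c * B) := by
            gcongr
            exact h1 B hB x hx σ
        _ = _ := by ring
  obtain ⟨C, E, hC, h⟩ := key
  refine ⟨C ^ d, E * d, by positivity, fun B hB x hx => ?_⟩
  rw [pow_mul, ← mul_pow]
  exact norm_le_of_embed hd _ _ (h B hB x hx)

theorem big_primes {k : Type*} [Field k] [NumberField k] {d : ℕ}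
    (hd : d = Module.finrank ℚ k)
    (ι : 𝓞 k →ₗ[ℤ] (Fin d → ℝ)) (hspan : Submodule.span ℝ (Set.range ι) = ⊤)
    {n : ℕ} (r : MvPolynomial (Fin n) (𝓞 k)) :
    ∃ (m : ℕ) (B₀ : ℝ), ∀ B, B₀ ≤ B → ∀ x : Fin n → 𝓞 k, (∀ i, ‖ι (x i)‖ ≤ B) →
      MvPolynomial.eval x r ≠ 0 → ∀ Q : Finset (HeightOneSpectrum (𝓞 k)),
      (∀ v ∈ Q, MvPolynomial.eval x r ∈ v.asIdeal ∧ B ^ d < Ideal.absNorm v.asIdeal) →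
      Q.card ≤ m := by
  classical
  obtain ⟨C, E, hC, h⟩ := value_bound hd ι hspan r
  have hd0 : 1 ≤ d := by rw [hd]; exact Module.finrank_pos
  refine ⟨E, C + 1, fun B hB x hx hr Q hQ => ?_⟩
  have hB1 : 1 ≤ B := by linarith
  by_contra hcon
  push Not at hcon
  have h1 : ∏ v ∈ Q, v.asIdeal ∣ Ideal.span {MvPolynomial.eval x r} := by
    apply Finset.prod_dvd_of_coprime
    · intro v hv w hw hvw
      apply Ideal.isCoprime_of_isMaximal
      intro h
      exact hvw (HeightOneSpectrum.ext h)
    · intro v hv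
      rw [Ideal.dvd_iff_le, Ideal.span_singleton_le_iff_mem]
      exact (hQ v hv).1
  have h2 := map_dvd Ideal.absNorm h1
  have h6 : Ideal.absNorm (Ideal.span {MvPolynomial.eval x r}) ≠ 0 := by
    rwa [Ne, Ideal.absNorm_eq_zero_iff, Ideal.span_singleton_eq_bot]
  have h3 := Nat.le_of_dvd (Nat.pos_of_ne_zero h6) h2
  rw [map_prod] at h3
  have h4 : ((∏ v ∈ Q, Ideal.absNorm v.asIdeal : ℕ) : ℝ) ≤ C * B ^ E :=
    (Nat.cast_le.mpr h3).trans (h B hB1 x hx)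
  rw [Nat.cast_prod] at h4
  have h5 : B ^ (E + 1) ≤ ∏ v ∈ Q, (Ideal.absNorm v.asIdeal : ℝ) := by
    calc B ^ (E + 1) ≤ B ^ Q.card := pow_le_pow_right₀ hB1 hcon
      _ = ∏ v ∈ Q, B := by rw [Finset.prod_const]
      _ ≤ _ := by
        apply Finset.prod_le_prod
        · intro v _; linarith
        · intro v hv
          exact (le_self_pow₀ hB1 (by omega)).trans (hQ v hv).2.le
  have h7 : B ^ E * B ≤ B ^ E * C := by rw [← pow_succ]; linarith
  have h8 := le_of_mul_le_mul_left h7 (by positivity)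
  linarith

theorem t_count {k : Type*} [Field k] [NumberField k] (v : HeightOneSpectrum (𝓞 k))
    (P : Polynomial (𝓞 k)) (hP : ∃ i, P.coeff i ∉ v.asIdeal) (S : Finset (𝓞 k)) (K : ℝ)
    (hK : ∀ a, ({x : 𝓞 k | x ∈ S ∧ x - a ∈ v.asIdeal}.ncard : ℝ) ≤ K) :
    ({t : 𝓞 k | t ∈ S ∧ P.eval t ∈ v.asIdeal}.ncard : ℝ) ≤ P.natDegree * K := by
  classical
  have hK0 : 0 ≤ K := le_trans (by positivity) (hK 0)
  let φ := Ideal.Quotient.mk v.asIdeal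
  have hprime := v.isPrime
  have hne : P.map φ ≠ 0 := by
    obtain ⟨i, hi⟩ := hP
    intro h
    apply hi
    have : (P.map φ).coeff i = 0 := by rw [h, Polynomial.coeff_zero]
    rwa [Polynomial.coeff_map, Ideal.Quotient.eq_zero_iff_mem] at this
  have h1 : {t : 𝓞 k | t ∈ S ∧ P.eval t ∈ v.asIdeal} = ↑(S.filter fun t => P.eval t ∈ v.asIdeal) := by
    ext; simp
  rw [h1, Set.ncard_coe_finset]
  have hmap : ∀ t ∈ S.filter (fun t => P.eval t ∈ v.asIdeal), φ t ∈ (P.map φ).roots.toFinset := by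
    intro t ht
    rw [Multiset.mem_toFinset, Polynomial.mem_roots hne, Polynomial.IsRoot, Polynomial.eval_map,
      Polynomial.eval₂_hom, Ideal.Quotient.eq_zero_iff_mem]
    exact (Finset.mem_filter.mp ht).2
  rw [Finset.card_eq_sum_card_fiberwise hmap, Nat.cast_sum]
  calc _ ≤ ∑ ρ ∈ (P.map φ).roots.toFinset, K := by
        apply Finset.sum_le_sum
        intro ρ _
        obtain ⟨a, rfl⟩ := Ideal.Quotient.mk_surjective ρ
        refine le_trans ?_ (hK a)
        rw [← Set.ncard_coe_finset, Nat.cast_le]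
        apply Set.ncard_le_ncard
        · intro x hx
          simp only [Finset.coe_filter, Finset.mem_filter, Set.mem_ofPred_eq] at hx ⊢
          exact ⟨hx.1.1, Ideal.Quotient.eq.mp hx.2⟩
        · exact S.finite_toSet.subset fun x hx => hx.1
    _ ≤ _ := by
        rw [Finset.sum_const, nsmul_eq_mul]
        gcongr
        exact (Multiset.toFinset_card_le _).trans
          ((Polynomial.card_roots' _).trans Polynomial.natDegree_map_le)

theorem zeros_mod {k : Type*} [Field k] [NumberField k] (v : HeightOneSpectrum (𝓞 k)) {n : ℕ}
    (r : MvPolynomial (Fin n) (𝓞 k)) (hr : ∃ i, r.coeff i ∉ v.asIdeal) (S : Finset (𝓞 k)) (K : ℝ)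
    (hK : ∀ a, ({x : 𝓞 k | x ∈ S ∧ x - a ∈ v.asIdeal}.ncard : ℝ) ≤ K) :
    ({x : Fin n → 𝓞 k | (∀ i, x i ∈ S) ∧ MvPolynomial.eval x r ∈ v.asIdeal}.ncard : ℝ) ≤
      r.totalDegree / (Ideal.absNorm v.asIdeal : ℝ) * (Ideal.absNorm v.asIdeal * K) ^ n := by
  classical
  have hK0 : 0 ≤ K := le_trans (by positivity) (hK 0)
  let φ := Ideal.Quotient.mk v.asIdeal
  have hprime := v.isPrime
  have hfin : Finite (𝓞 k ⧸ v.asIdeal) := Ideal.finiteQuotientOfFreeOfNeBot _ v.ne_bot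
  have := Fintype.ofFinite (𝓞 k ⧸ v.asIdeal)
  have hcard : Fintype.card (𝓞 k ⧸ v.asIdeal) = Ideal.absNorm v.asIdeal := by
    rw [Ideal.absNorm_apply, Submodule.cardQuot_apply, Nat.card_eq_fintype_card]
  have hN0 : (0 : ℝ) < Ideal.absNorm v.asIdeal := by
    rw [← hcard]; exact_mod_cast Fintype.card_pos
  have hne : MvPolynomial.map φ r ≠ 0 := by
    obtain ⟨i, hi⟩ := hr
    intro h
    apply hi
    have : (MvPolynomial.map φ r).coeff i = 0 := by rw [h, MvPolynomial.coeff_zero]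
    rwa [MvPolynomial.coeff_map, Ideal.Quotient.eq_zero_iff_mem] at this
  have hsz := MvPolynomial.schwartz_zippel_totalDegree hne Finset.univ
  rw [Finset.card_univ, hcard] at hsz
  set Z := Finset.filter (fun f => MvPolynomial.eval f (MvPolynomial.map φ r) = 0)
    (Fintype.piFinset fun _ : Fin n => (Finset.univ : Finset (𝓞 k ⧸ v.asIdeal)))
  have hsz' : (Z.card : ℝ) / (Ideal.absNorm v.asIdeal : ℝ) ^ n ≤
      r.totalDegree / (Ideal.absNorm v.asIdeal : ℝ) := by
    have h2 : ((Z.card / (Ideal.absNorm v.asIdeal) ^ n : ℚ≥0) : ℝ) ≤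
      (((MvPolynomial.map φ r).totalDegree / (Ideal.absNorm v.asIdeal) : ℚ≥0) : ℝ) := by
      exact_mod_cast hsz
    push_cast at h2
    refine h2.trans ?_
    gcongr
    exact Finset.sup_mono (MvPolynomial.support_map_subset _ _)
  rw [div_le_iff₀ (by positivity)] at hsz'
  let W := Finset.filter (fun x => MvPolynomial.eval x r ∈ v.asIdeal)
    (Fintype.piFinset fun _ : Fin n => S)
  have h1 : {x : Fin n → 𝓞 k | (∀ i, x i ∈ S) ∧ MvPolynomial.eval x r ∈ v.asIdeal} = ↑W := by
    ext; simp [W]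
  rw [h1, Set.ncard_coe_finset]
  have hmap : ∀ x ∈ W, (fun i => φ (x i)) ∈ Z := by
    intro x hx
    simp only [Z, Finset.mem_filter, Fintype.mem_piFinset, Finset.mem_univ, implies_true, true_and]
    rw [MvPolynomial.eval_map]
    have h2 := (Finset.mem_filter.mp hx).2
    rw [← Ideal.Quotient.eq_zero_iff_mem] at h2
    rw [← h2]
    exact (MvPolynomial.eval₂_comp_left φ (RingHom.id _) x r).symm
  rw [Finset.card_eq_sum_card_fiberwise hmap, Nat.cast_sum]
  calc _ ≤ ∑ ρ ∈ Z, K ^ n := by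
        apply Finset.sum_le_sum
        intro ρ _
        choose a ha using fun i => Ideal.Quotient.mk_surjective (ρ i)
        have h3 : (W.filter fun x => (fun i => φ (x i)) = ρ) ⊆
            Fintype.piFinset fun i => S.filter fun x => x - a i ∈ v.asIdeal := by
          intro x hx
          simp only [W, Finset.mem_filter, Fintype.mem_piFinset] at hx ⊢
          intro i
          refine ⟨hx.1.1 i, Ideal.Quotient.eq.mp ?_⟩
          rw [ha i]
          exact congrFun hx.2 i
        refine (Nat.cast_le.mpr (Finset.card_le_card h3)).trans ?_
        rw [Fintype.card_piFinset, Nat.cast_prod]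
        calc _ ≤ ∏ i : Fin n, K := by
              apply Finset.prod_le_prod
              · intros; positivity
              · intro i _
                refine le_trans (le_of_eq ?_) (hK (a i))
                rw [← Set.ncard_coe_finset, Finset.coe_filter]
          _ = K ^ n := by simp
    _ = Z.card * K ^ n := by rw [Finset.sum_const, nsmul_eq_mul]
    _ ≤ (r.totalDegree / (Ideal.absNorm v.asIdeal : ℝ) * (Ideal.absNorm v.asIdeal : ℝ) ^ n) * K ^ n
        := by gcongr
    _ = _ := by rw [mul_pow]; ring

theorem zeros_count {k : Type*} [Field k] [NumberField k] {n : ℕ}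
    (r : MvPolynomial (Fin n) (𝓞 k)) (hr : r ≠ 0) (S : Finset (𝓞 k)) :
    {x : Fin n → 𝓞 k | (∀ i, x i ∈ S) ∧ MvPolynomial.eval x r = 0}.ncard * S.card ≤
      r.totalDegree * S.card ^ n := by
  classical
  rcases S.eq_empty_or_nonempty with rfl | hS
  · simp
  have hS0 : (0 : ℚ≥0) < S.card := by exact_mod_cast hS.card_pos
  have hsz := MvPolynomial.schwartz_zippel_totalDegree hr S
  have h1 : {x : Fin n → 𝓞 k | (∀ i, x i ∈ S) ∧ MvPolynomial.eval x r = 0} =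
      ↑((Fintype.piFinset fun _ : Fin n => S).filter fun x => MvPolynomial.eval x r = 0) := by
    ext; simp
  rw [h1, Set.ncard_coe_finset]
  rw [div_le_div_iff₀ (by positivity) hS0] at hsz
  exact_mod_cast hsz

theorem fiber_count {α : Type*} {n : ℕ} (S : Finset α) (W : Set (Fin (n + 1) → α))
    (Z : Set (Fin n → α)) (L : ℝ) (hW : ∀ x ∈ W, (∀ i, x i ∈ S) ∧ Fin.tail x ∈ Z)
    (hZ : ∀ x ∈ Z, ∀ i, x i ∈ S)
    (hL : ∀ x' ∈ Z, ({t : α | t ∈ S ∧ Fin.cons t x' ∈ W}.ncard : ℝ) ≤ L) :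
    (W.ncard : ℝ) ≤ Z.ncard * L := by
  classical
  have hWf : W.Finite := (Fintype.piFinset fun _ : Fin (n + 1) => S).finite_toSet.subset
    fun x hx => by simpa using (hW x hx).1
  have hZf : Z.Finite := (Fintype.piFinset fun _ : Fin n => S).finite_toSet.subset
    fun x hx => by simpa using hZ x hx
  lift W to Finset (Fin (n + 1) → α) using hWf
  lift Z to Finset (Fin n → α) using hZf
  rw [Set.ncard_coe_finset, Set.ncard_coe_finset]
  have hmap : ∀ x ∈ W, Fin.tail x ∈ Z := fun x hx => (hW x hx).2
  rw [Finset.card_eq_sum_card_fiberwise hmap, Nat.cast_sum, ← nsmul_eq_mul, ← Finset.sum_const]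
  apply Finset.sum_le_sum
  intro x' hx'
  refine le_trans ?_ (hL x' hx')
  rw [← Set.ncard_coe_finset, Nat.cast_le]
  refine Set.ncard_le_ncard_of_injOn (fun x => x 0) ?_ ?_ (S.finite_toSet.subset fun x hx => hx.1)
  · intro x hx
    simp only [Finset.coe_filter, Set.mem_ofPred_eq] at hx
    refine ⟨(hW x hx.1).1 0, ?_⟩
    rw [← hx.2, Fin.cons_self_tail]
    exact hx.1
  · intro x hx y hy hxy
    simp only [Finset.coe_filter, Set.mem_ofPred_eq] at hx hy
    rw [← Fin.cons_self_tail x, ← Fin.cons_self_tail y, hx.2, hy.2]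
    simp only at hxy
    rw [hxy]

/-- The prime `v` is good for `x'` if some coefficient of some generator survives modulo `v`. -/
def GoodAt {k : Type*} [Field k] [NumberField k] {n : ℕ}
    (G : Finset (MvPolynomial (Fin (n + 1)) (𝓞 k))) (v : HeightOneSpectrum (𝓞 k))
    (x' : Fin n → 𝓞 k) : Prop :=
  ∃ g ∈ G, ∃ i, MvPolynomial.eval x' ((MvPolynomial.finSuccEquiv (𝓞 k) n g).coeff i) ∉ v.asIdeal

theorem fiber_t {k : Type*} [Field k] [NumberField k] {n : ℕ}
    (G : Finset (MvPolynomial (Fin (n + 1)) (𝓞 k))) (D : ℕ)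
    (hD : ∀ g ∈ G, (MvPolynomial.finSuccEquiv (𝓞 k) n g).natDegree ≤ D)
    (v : HeightOneSpectrum (𝓞 k)) (x' : Fin n → 𝓞 k) (hg : GoodAt G v x')
    (S : Finset (𝓞 k)) (K : ℝ)
    (hK : ∀ a, ({x : 𝓞 k | x ∈ S ∧ x - a ∈ v.asIdeal}.ncard : ℝ) ≤ K) :
    ({t : 𝓞 k | t ∈ S ∧ ∀ g ∈ G,
      MvPolynomial.eval (Fin.cons t x' : Fin (n + 1) → 𝓞 k) g ∈ v.asIdeal}.ncard : ℝ) ≤ D * K := by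
  have hK0 : 0 ≤ K := le_trans (by positivity) (hK 0)
  obtain ⟨g, hgG, i, hi⟩ := hg
  have h1 := t_count v ((MvPolynomial.finSuccEquiv (𝓞 k) n g).map (MvPolynomial.eval x'))
    ⟨i, by rwa [Polynomial.coeff_map]⟩ S K hK
  refine le_trans ?_ (h1.trans ?_)
  · rw [Nat.cast_le]
    apply Set.ncard_le_ncard
    · rintro t ⟨ht, h⟩
      refine ⟨ht, ?_⟩
      rw [← MvPolynomial.eval_eq_eval_mv_eval']
      exact h g hgG
    · exact S.finite_toSet.subset fun x hx => hx.1
  · gcongr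
    exact Polynomial.natDegree_map_le.trans (hD g hgG)

theorem set_finite_of_card {α : Type*} (s : Set α) (m : ℕ)
    (h : ∀ Q : Finset α, (∀ v ∈ Q, v ∈ s) → Q.card ≤ m) : s.Finite := by
  by_contra hs
  obtain ⟨Q, hQ, hc⟩ := Set.Infinite.exists_subset_card_eq hs (m + 1)
  have := h Q (fun v hv => hQ hv)
  omega

theorem finite_primes_le (k : Type*) [Field k] [NumberField k] (X : ℝ) :
    {v : HeightOneSpectrum (𝓞 k) | (Ideal.absNorm v.asIdeal : ℝ) ≤ X}.Finite := by
  have h := Ideal.finite_setOfPred_absNorm_le (S := 𝓞 k) ⌊X⌋₊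
  refine Set.Finite.of_finite_image (f := fun v : HeightOneSpectrum (𝓞 k) => v.asIdeal)
    (h.subset ?_) ?_
  · rintro _ ⟨v, hv, rfl⟩
    exact Nat.le_floor hv
  · intro v _ w _ hvw
    exact HeightOneSpectrum.ext hvw

theorem ncard_box {α : Type*} (S : Finset α) (n : ℕ) :
    {x : Fin n → α | ∀ i, x i ∈ S}.ncard = S.card ^ n := by
  classical
  have : {x : Fin n → α | ∀ i, x i ∈ S} = ↑(Fintype.piFinset fun _ : Fin n => S) := by
    ext; simp
  rw [this, Set.ncard_coe_finset, Fintype.card_piFinset]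
  simp

theorem box_fin {α : Type*} (S : Finset α) (n : ℕ) :
    {x : Fin n → α | ∀ i, x i ∈ S}.Finite := by
  classical
  exact (Fintype.piFinset fun _ : Fin n => S).finite_toSet.subset fun x hx => by simpa using hx

theorem partC {k : Type*} [Field k] [NumberField k] {n : ℕ}
    (G : Finset (MvPolynomial (Fin (n + 1)) (𝓞 k))) (D : ℕ)
    (hD : ∀ g ∈ G, (MvPolynomial.finSuccEquiv (𝓞 k) n g).natDegree ≤ D)
    (r : MvPolynomial (Fin n) (𝓞 k)) (S : Finset (𝓞 k)) (X C : ℝ) (hX : 1 ≤ X) (hC : 1 ≤ C)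
    (hS : ∀ (v : HeightOneSpectrum (𝓞 k)) a, ({x : 𝓞 k | x ∈ S ∧ x - a ∈ v.asIdeal}.ncard : ℝ) ≤
      C * (X / Ideal.absNorm v.asIdeal + 1))
    (hSc : (S.card : ℝ) ≤ 2 * C * X) (m : ℕ)
    (hm : ∀ x : Fin n → 𝓞 k, (∀ i, x i ∈ S) →
      MvPolynomial.eval x r ≠ 0 → ∀ Q : Finset (HeightOneSpectrum (𝓞 k)),
      (∀ v ∈ Q, MvPolynomial.eval x r ∈ v.asIdeal ∧ X < Ideal.absNorm v.asIdeal) →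
      Q.card ≤ m) :
    ({x : Fin (n + 1) → 𝓞 k | (∀ i, x i ∈ S) ∧ MvPolynomial.eval (Fin.tail x) r ≠ 0 ∧
      ∃ v : HeightOneSpectrum (𝓞 k), X < Ideal.absNorm v.asIdeal ∧
        MvPolynomial.eval (Fin.tail x) r ∈ v.asIdeal ∧ GoodAt G v (Fin.tail x) ∧
        ∀ g ∈ G, MvPolynomial.eval x g ∈ v.asIdeal}.ncard : ℝ) ≤
      (2 * C * X) ^ n * (m * (D * (2 * C))) := by
  classical
  have h1 := fiber_count S {x : Fin (n + 1) → 𝓞 k | (∀ i, x i ∈ S) ∧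
      MvPolynomial.eval (Fin.tail x) r ≠ 0 ∧
      ∃ v : HeightOneSpectrum (𝓞 k), X < Ideal.absNorm v.asIdeal ∧
        MvPolynomial.eval (Fin.tail x) r ∈ v.asIdeal ∧ GoodAt G v (Fin.tail x) ∧
        ∀ g ∈ G, MvPolynomial.eval x g ∈ v.asIdeal}
    {x | ∀ i, x i ∈ S} (m * (D * (2 * C))) (fun x hx => ⟨hx.1, fun i => hx.1 _⟩)
    (fun x hx => hx) ?_
  · refine h1.trans ?_
    rw [ncard_box, Nat.cast_pow]
    gcongr
  intro x' hx'
  by_cases hr : MvPolynomial.eval x' r = 0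
  · have : {t : 𝓞 k | t ∈ S ∧ (Fin.cons t x' : Fin (n + 1) → 𝓞 k) ∈
      {x : Fin (n + 1) → 𝓞 k | (∀ i, x i ∈ S) ∧
      MvPolynomial.eval (Fin.tail x) r ≠ 0 ∧
      ∃ v : HeightOneSpectrum (𝓞 k), X < Ideal.absNorm v.asIdeal ∧
        MvPolynomial.eval (Fin.tail x) r ∈ v.asIdeal ∧ GoodAt G v (Fin.tail x) ∧
        ∀ g ∈ G, MvPolynomial.eval x g ∈ v.asIdeal}} = ∅ := by
      rw [Set.eq_empty_iff_forall_notMem]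
      rintro t ⟨_, _, h, _⟩
      rw [Fin.tail_cons] at h
      exact h hr
    rw [this, Set.ncard_empty]
    push_cast
    positivity
  · let Qs : Set (HeightOneSpectrum (𝓞 k)) := {v | (MvPolynomial.eval x' r ∈ v.asIdeal ∧
      X < Ideal.absNorm v.asIdeal) ∧ GoodAt G v x'}
    have hQf : Qs.Finite := set_finite_of_card Qs m fun Q hQ =>
      hm x' hx' hr Q fun v hv => (hQ v hv).1
    have hQm : hQf.toFinset.card ≤ m := hm x' hx' hr _ fun v hv => by
      rw [Set.Finite.mem_toFinset] at hv
      exact hv.1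
    have hsub : {t : 𝓞 k | t ∈ S ∧ (Fin.cons t x' : Fin (n + 1) → 𝓞 k) ∈
      {x : Fin (n + 1) → 𝓞 k | (∀ i, x i ∈ S) ∧
      MvPolynomial.eval (Fin.tail x) r ≠ 0 ∧
      ∃ v : HeightOneSpectrum (𝓞 k), X < Ideal.absNorm v.asIdeal ∧
        MvPolynomial.eval (Fin.tail x) r ∈ v.asIdeal ∧ GoodAt G v (Fin.tail x) ∧
        ∀ g ∈ G, MvPolynomial.eval x g ∈ v.asIdeal}} ⊆
        ⋃ v ∈ hQf.toFinset, {t : 𝓞 k | t ∈ S ∧ ∀ g ∈ G,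
          MvPolynomial.eval (Fin.cons t x' : Fin (n + 1) → 𝓞 k) g ∈ v.asIdeal} := by
      rintro t ⟨ht, _, _, v, hv1, hv2, hv3, hv4⟩
      rw [Fin.tail_cons] at hv2 hv3
      simp only [Set.mem_iUnion]
      exact ⟨v, (Set.Finite.mem_toFinset _).mpr ⟨⟨hv2, hv1⟩, hv3⟩, ht, hv4⟩
    have hfin : (⋃ v ∈ hQf.toFinset, {t : 𝓞 k | t ∈ S ∧ ∀ g ∈ G,
          MvPolynomial.eval (Fin.cons t x' : Fin (n + 1) → 𝓞 k) g ∈ v.asIdeal}).Finite := by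
      apply S.finite_toSet.subset
      intro t ht
      simp only [Set.mem_iUnion] at ht
      obtain ⟨v, _, ht, _⟩ := ht
      exact ht
    have h2 := (Set.ncard_le_ncard hsub hfin).trans (Finset.set_ncard_biUnion_le _ _)
    refine (Nat.cast_le.mpr h2).trans ?_
    rw [Nat.cast_sum]
    calc _ ≤ ∑ v ∈ hQf.toFinset, (D * (2 * C) : ℝ) := by
          apply Finset.sum_le_sum
          intro v hv
          rw [Set.Finite.mem_toFinset] at hv
          refine (fiber_t G D hD v x' hv.2 S _ (hS v)).trans ?_
          have h3 : X / Ideal.absNorm v.asIdeal ≤ 1 := by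
            rw [div_le_one (by linarith [hv.1.2])]
            exact hv.1.2.le
          have : C * (X / Ideal.absNorm v.asIdeal + 1) ≤ C * (1 + 1) := by gcongr
          refine mul_le_mul_of_nonneg_left ?_ (by positivity)
          linarith
      _ ≤ _ := by
          rw [Finset.sum_const, nsmul_eq_mul]
          gcongr

theorem partD {k : Type*} [Field k] [NumberField k] {n : ℕ}
    (G : Finset (MvPolynomial (Fin (n + 1)) (𝓞 k))) (D : ℕ)
    (hD : ∀ g ∈ G, (MvPolynomial.finSuccEquiv (𝓞 k) n g).natDegree ≤ D)
    (r : MvPolynomial (Fin n) (𝓞 k)) (S : Finset (𝓞 k)) (X C : ℝ) (hC : 1 ≤ C)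
    (hS : ∀ (v : HeightOneSpectrum (𝓞 k)) a, ({x : 𝓞 k | x ∈ S ∧ x - a ∈ v.asIdeal}.ncard : ℝ) ≤
      C * (X / Ideal.absNorm v.asIdeal + 1))
    (v : HeightOneSpectrum (𝓞 k)) (hv : (Ideal.absNorm v.asIdeal : ℝ) ≤ X)
    (hr : ∃ i, r.coeff i ∉ v.asIdeal) :
    ({x : Fin (n + 1) → 𝓞 k | (∀ i, x i ∈ S) ∧
        MvPolynomial.eval (Fin.tail x) r ∈ v.asIdeal ∧ GoodAt G v (Fin.tail x) ∧
        ∀ g ∈ G, MvPolynomial.eval x g ∈ v.asIdeal}.ncard : ℝ) ≤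
      r.totalDegree * D * (2 * C * X) ^ (n + 1) * (1 / (Ideal.absNorm v.asIdeal : ℝ) ^ 2) := by
  set N : ℝ := ((Ideal.absNorm v.asIdeal : ℕ) : ℝ) with hN
  have hN1 : 0 < N := by
    have : Ideal.absNorm v.asIdeal ≠ 0 := by rw [Ne, Ideal.absNorm_eq_zero_iff]; exact v.ne_bot
    rw [hN]
    exact_mod_cast Nat.pos_of_ne_zero this
  have hK : ∀ a, ({x : 𝓞 k | x ∈ S ∧ x - a ∈ v.asIdeal}.ncard : ℝ) ≤ 2 * C * X / N := by
    intro a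
    refine (hS v a).trans ?_
    have h1 : 1 ≤ X / N := by rwa [one_le_div hN1]
    calc C * (X / N + 1) ≤ C * (X / N + X / N) := by gcongr
      _ = _ := by ring
  have hX : 0 < X := by linarith
  have h1 := fiber_count S {x : Fin (n + 1) → 𝓞 k | (∀ i, x i ∈ S) ∧
        MvPolynomial.eval (Fin.tail x) r ∈ v.asIdeal ∧ GoodAt G v (Fin.tail x) ∧
        ∀ g ∈ G, MvPolynomial.eval x g ∈ v.asIdeal}
    {x | (∀ i, x i ∈ S) ∧ MvPolynomial.eval x r ∈ v.asIdeal} (D * (2 * C * X / N))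
    (fun x hx => ⟨hx.1, fun i => hx.1 _, hx.2.1⟩) (fun x hx => hx.1) ?_
  · refine h1.trans ?_
    have h2 := zeros_mod v r hr S _ hK
    calc _ ≤ (r.totalDegree / N * (N * (2 * C * X / N)) ^ n) * (D * (2 * C * X / N)) := by
          gcongr
      _ = _ := by
          rw [mul_div_cancel₀ _ hN1.ne']
          field_simp
          ring
  · intro x' hx'
    by_cases hg : GoodAt G v x'
    · refine le_trans ?_ (fiber_t G D hD v x' hg S _ hK)
      rw [Nat.cast_le]
      apply Set.ncard_le_ncard
      · rintro t ⟨ht, h⟩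
        exact ⟨ht, h.2.2.2⟩
      · exact S.finite_toSet.subset fun x hx => hx.1
    · have : {t : 𝓞 k | t ∈ S ∧ (Fin.cons t x' : Fin (n + 1) → 𝓞 k) ∈
        {x : Fin (n + 1) → 𝓞 k | (∀ i, x i ∈ S) ∧
        MvPolynomial.eval (Fin.tail x) r ∈ v.asIdeal ∧ GoodAt G v (Fin.tail x) ∧
        ∀ g ∈ G, MvPolynomial.eval x g ∈ v.asIdeal}} = ∅ := by
        rw [Set.eq_empty_iff_forall_notMem]
        rintro t ⟨_, _, _, h, _⟩
        rw [Fin.tail_cons] at h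
        exact hg h
      rw [this, Set.ncard_empty]
      push_cast
      positivity

theorem coeff_notMem {k : Type*} [Field k] [NumberField k] (c : 𝓞 k) (hc : c ≠ 0)
    (v : HeightOneSpectrum (𝓞 k)) (hv : Ideal.absNorm (Ideal.span {c}) < Ideal.absNorm v.asIdeal) :
    c ∉ v.asIdeal := by
  intro h
  have h1 : Ideal.absNorm v.asIdeal ∣ Ideal.absNorm (Ideal.span {c}) :=
    Ideal.absNorm_dvd_absNorm_of_le ((Ideal.span_singleton_le_iff_mem _).mpr h)
  have h2 : Ideal.absNorm (Ideal.span {c}) ≠ 0 := by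
    rwa [Ne, Ideal.absNorm_eq_zero_iff, Ideal.span_singleton_eq_bot]
  exact absurd (Nat.le_of_dvd (Nat.pos_of_ne_zero h2) h1) (not_le.mpr hv)

theorem step_count {k : Type*} [Field k] [NumberField k] {n : ℕ}
    (I : Ideal (MvPolynomial (Fin (n + 1)) (𝓞 k)))
    (G : Finset (MvPolynomial (Fin (n + 1)) (𝓞 k))) (hG : Ideal.span (G : Set _) = I) (D : ℕ)
    (hD : ∀ g ∈ G, (MvPolynomial.finSuccEquiv (𝓞 k) n g).natDegree ≤ D)
    (r : MvPolynomial (Fin n) (𝓞 k)) (hr0 : r ≠ 0)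
    (hrI : (MvPolynomial.finSuccEquiv (𝓞 k) n).symm (Polynomial.C r) ∈ I)
    (S : Finset (𝓞 k)) (X C : ℝ) (hX : 1 ≤ X) (hC : 1 ≤ C)
    (hS : ∀ (v : HeightOneSpectrum (𝓞 k)) a, ({x : 𝓞 k | x ∈ S ∧ x - a ∈ v.asIdeal}.ncard : ℝ) ≤
      C * (X / Ideal.absNorm v.asIdeal + 1))
    (hSc : (S.card : ℝ) ≤ 2 * C * X) (m : ℕ)
    (hm : ∀ x : Fin n → 𝓞 k, (∀ i, x i ∈ S) →
      MvPolynomial.eval x r ≠ 0 → ∀ Q : Finset (HeightOneSpectrum (𝓞 k)),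
      (∀ v ∈ Q, MvPolynomial.eval x r ∈ v.asIdeal ∧ X < Ideal.absNorm v.asIdeal) →
      Q.card ≤ m)
    (M : ℕ) (hM : ∀ v : HeightOneSpectrum (𝓞 k), M < Ideal.absNorm v.asIdeal →
      ∃ i, r.coeff i ∉ v.asIdeal) (δ : ℝ)
    (hδ : ∀ Q : Finset (HeightOneSpectrum (𝓞 k)), (∀ v ∈ Q, M < Ideal.absNorm v.asIdeal) →
      ∑ v ∈ Q, 1 / (Ideal.absNorm v.asIdeal : ℝ) ^ 2 ≤ δ) (ε : ℝ)
    (hJ : ({x : Fin n → 𝓞 k | (∀ i, x i ∈ S) ∧ ∃ v : HeightOneSpectrum (𝓞 k),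
      M < Ideal.absNorm v.asIdeal ∧ ∀ f ∈ coeffIdeal k G,
        MvPolynomial.eval x f ∈ v.asIdeal}.ncard : ℝ) ≤ ε * X ^ n) :
    ({x : Fin (n + 1) → 𝓞 k | (∀ i, x i ∈ S) ∧ ∃ v : HeightOneSpectrum (𝓞 k),
      M < Ideal.absNorm v.asIdeal ∧ ∀ f ∈ I, MvPolynomial.eval x f ∈ v.asIdeal}.ncard : ℝ) ≤
      ε * X ^ n * (2 * C * X) + r.totalDegree * (2 * C * X) ^ n +
      (2 * C * X) ^ n * (m * (D * (2 * C))) +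
      r.totalDegree * D * (2 * C * X) ^ (n + 1) * δ := by
  classical
  let BadJ : Set (Fin n → 𝓞 k) := {x : Fin n → 𝓞 k | (∀ i, x i ∈ S) ∧
    ∃ v : HeightOneSpectrum (𝓞 k), M < Ideal.absNorm v.asIdeal ∧ ∀ f ∈ coeffIdeal k G,
        MvPolynomial.eval x f ∈ v.asIdeal}
  let A1 : Set (Fin (n + 1) → 𝓞 k) := {x | (∀ i, x i ∈ S) ∧ Fin.tail x ∈ BadJ}
  let A2 : Set (Fin (n + 1) → 𝓞 k) := {x | (∀ i, x i ∈ S) ∧ MvPolynomial.eval (Fin.tail x) r = 0}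
  let A3 : Set (Fin (n + 1) → 𝓞 k) := {x | (∀ i, x i ∈ S) ∧
      MvPolynomial.eval (Fin.tail x) r ≠ 0 ∧
      ∃ v : HeightOneSpectrum (𝓞 k), X < Ideal.absNorm v.asIdeal ∧
        MvPolynomial.eval (Fin.tail x) r ∈ v.asIdeal ∧ GoodAt G v (Fin.tail x) ∧
        ∀ g ∈ G, MvPolynomial.eval x g ∈ v.asIdeal}
  let A4 : HeightOneSpectrum (𝓞 k) → Set (Fin (n + 1) → 𝓞 k) := fun v => {x | (∀ i, x i ∈ S) ∧
        MvPolynomial.eval (Fin.tail x) r ∈ v.asIdeal ∧ GoodAt G v (Fin.tail x) ∧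
        ∀ g ∈ G, MvPolynomial.eval x g ∈ v.asIdeal}
  let Q : Finset (HeightOneSpectrum (𝓞 k)) :=
    (finite_primes_le k X).toFinset.filter fun v => M < Ideal.absNorm v.asIdeal
  have hS0 : ∀ T : Set (Fin n → 𝓞 k), ∀ x' ∈ T, ∀ W : Set (Fin (n + 1) → 𝓞 k),
      ({t : 𝓞 k | t ∈ S ∧ (Fin.cons t x' : Fin (n + 1) → 𝓞 k) ∈ W}.ncard : ℝ) ≤ S.card := by
    intro T x' _ W
    rw [← Set.ncard_coe_finset, Nat.cast_le]
    exact Set.ncard_le_ncard (fun t ht => ht.1) S.finite_toSet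
  have b1 : (A1.ncard : ℝ) ≤ ε * X ^ n * (2 * C * X) := by
    refine (fiber_count S A1 BadJ S.card (fun x hx => hx) (fun x hx => hx.1)
      (fun x' hx' => hS0 _ x' hx' _)).trans ?_
    have : 0 ≤ ε * X ^ n := le_trans (by positivity) hJ
    gcongr
  have b2 : (A2.ncard : ℝ) ≤ r.totalDegree * (2 * C * X) ^ n := by
    refine (fiber_count S A2 {x | (∀ i, x i ∈ S) ∧ MvPolynomial.eval x r = 0} S.card
      (fun x hx => ⟨hx.1, fun i => hx.1 _, hx.2⟩) (fun x hx => hx.1)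
      (fun x' hx' => hS0 _ x' hx' _)).trans ?_
    have h1 := zeros_count r hr0 S
    calc _ ≤ (r.totalDegree * S.card ^ n : ℝ) := by exact_mod_cast h1
      _ ≤ _ := by gcongr
  have b3 : (A3.ncard : ℝ) ≤ (2 * C * X) ^ n * (m * (D * (2 * C))) :=
    partC G D hD r S X C hX hC hS hSc m hm
  have b4 : ((⋃ v ∈ Q, A4 v).ncard : ℝ) ≤
      r.totalDegree * D * (2 * C * X) ^ (n + 1) * δ := by
    refine (Nat.cast_le.mpr (Finset.set_ncard_biUnion_le _ _)).trans ?_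
    rw [Nat.cast_sum]
    calc _ ≤ ∑ v ∈ Q, r.totalDegree * D * (2 * C * X) ^ (n + 1) *
          (1 / (Ideal.absNorm v.asIdeal : ℝ) ^ 2) := by
          apply Finset.sum_le_sum
          intro v hv
          rw [Finset.mem_filter, Set.Finite.mem_toFinset] at hv
          exact partD G D hD r S X C hC hS v hv.1 (hM v hv.2)
      _ ≤ _ := by
          rw [← Finset.mul_sum]
          gcongr
          exact hδ Q fun v hv => (Finset.mem_filter.mp hv).2
  have hsub : {x : Fin (n + 1) → 𝓞 k | (∀ i, x i ∈ S) ∧ ∃ v : HeightOneSpectrum (𝓞 k),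
      M < Ideal.absNorm v.asIdeal ∧ ∀ f ∈ I, MvPolynomial.eval x f ∈ v.asIdeal} ⊆
      A1 ∪ A2 ∪ A3 ∪ ⋃ v ∈ Q, A4 v := by
    rintro x ⟨hx, v, hv, hf⟩
    have hGI : ∀ g ∈ G, MvPolynomial.eval x g ∈ v.asIdeal := by
      intro g hg
      apply hf
      rw [← hG]
      exact Ideal.subset_span hg
    have hr : MvPolynomial.eval (Fin.tail x) r ∈ v.asIdeal := by
      have h1 := hf _ hrI
      rw [← Fin.cons_self_tail x, MvPolynomial.eval_eq_eval_mv_eval', AlgEquiv.apply_symm_apply,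
        Polynomial.map_C, Polynomial.eval_C] at h1
      exact h1
    by_cases hg : GoodAt G v (Fin.tail x)
    · by_cases h0 : MvPolynomial.eval (Fin.tail x) r = 0
      · exact Or.inl (Or.inl (Or.inr ⟨hx, h0⟩))
      · by_cases hvX : (Ideal.absNorm v.asIdeal : ℝ) ≤ X
        · right
          simp only [Set.mem_iUnion]
          refine ⟨v, ?_, hx, hr, hg, hGI⟩
          rw [Finset.mem_filter, Set.Finite.mem_toFinset]
          exact ⟨hvX, hv⟩
        · exact Or.inl (Or.inr ⟨hx, h0, v, not_le.mp hvX, hr, hg, hGI⟩)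
    · left; left; left
      refine ⟨hx, fun i => hx _, v, hv, ?_⟩
      have : coeffIdeal k G ≤ Ideal.comap (MvPolynomial.eval (Fin.tail x)) v.asIdeal := by
        rw [coeffIdeal, Ideal.span_le]
        rintro _ ⟨g, hgG, i, rfl⟩
        rw [SetLike.mem_coe, Ideal.mem_comap]
        by_contra hcon
        exact hg ⟨g, hgG, i, hcon⟩
      exact fun f hf => this hf
  have hfin : (A1 ∪ A2 ∪ A3 ∪ ⋃ v ∈ Q, A4 v).Finite := by
    apply (box_fin S (n + 1)).subset
    rintro x (((hx | hx) | hx) | hx)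
    · exact hx.1
    · exact hx.1
    · exact hx.1
    · simp only [Set.mem_iUnion] at hx
      obtain ⟨v, _, hx⟩ := hx
      exact hx.1
  have h1 := Set.ncard_le_ncard hsub hfin
  have h2 : (A1 ∪ A2 ∪ A3 ∪ ⋃ v ∈ Q, A4 v).ncard ≤
      A1.ncard + A2.ncard + A3.ncard + (⋃ v ∈ Q, A4 v).ncard := by
    refine (Set.ncard_union_le _ _).trans ?_
    gcongr
    refine (Set.ncard_union_le _ _).trans ?_
    gcongr
    exact Set.ncard_union_le _ _
  have h3 := Nat.cast_le (α := ℝ).mpr (h1.trans h2)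
  push_cast at h3
  refine h3.trans ?_
  gcongr

theorem main_ind {k : Type*} [Field k] [NumberField k] {d : ℕ}
    (hd : d = Module.finrank ℚ k)
    (ι : 𝓞 k →ₗ[ℤ] (Fin d → ℝ)) (hspan : Submodule.span ℝ (Set.range ι) = ⊤) (n : ℕ) :
    ∀ I : Ideal (MvPolynomial (Fin n) (𝓞 k)), CopIdeal k I → ∀ ε : ℝ, 0 < ε →
      ∃ (M : ℕ) (B₀ : ℝ), ∀ B, B₀ ≤ B →
        ({x : Fin n → 𝓞 k | (∀ i, ‖ι (x i)‖ ≤ B) ∧ ∃ v : HeightOneSpectrum (𝓞 k),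
          M < Ideal.absNorm v.asIdeal ∧ ∀ f ∈ I, MvPolynomial.eval x f ∈ v.asIdeal}.ncard : ℝ) ≤
        ε * (B ^ d) ^ n := by
  classical
  obtain ⟨C, hC, hcl⟩ := class_count hd ι hspan
  have hd0 : 1 ≤ d := by rw [hd]; exact Module.finrank_pos
  induction n with
  | zero =>
    intro I hI ε hε
    have h1 : ∃ f ∈ I, f ≠ 0 := by
      by_contra hcon
      push Not at hcon
      have := hI 0 (fun f hf => by rw [hcon f hf, map_zero])
      exact not_isUnit_zero this
    obtain ⟨f, hf, hf0⟩ := h1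
    have h2 : MvPolynomial.eval (fun i : Fin 0 => (0 : 𝓞 k)) f ≠ 0 := by
      intro h
      apply hf0
      rw [MvPolynomial.eq_C_of_isEmpty f] at h ⊢
      rw [MvPolynomial.eval_C] at h
      rw [h, map_zero]
    refine ⟨Ideal.absNorm (Ideal.span {MvPolynomial.eval (fun i : Fin 0 => (0 : 𝓞 k)) f}), 1,
      fun B hB => ?_⟩
    have h3 : {x : Fin 0 → 𝓞 k | (∀ i, ‖ι (x i)‖ ≤ B) ∧ ∃ v : HeightOneSpectrum (𝓞 k),
          Ideal.absNorm (Ideal.span {MvPolynomial.eval (fun i : Fin 0 => (0 : 𝓞 k)) f}) <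
            Ideal.absNorm v.asIdeal ∧ ∀ f ∈ I, MvPolynomial.eval x f ∈ v.asIdeal} = ∅ := by
      rw [Set.eq_empty_iff_forall_notMem]
      rintro x ⟨_, v, hv, h⟩
      have h4 := h f hf
      rw [Subsingleton.elim x (fun i : Fin 0 => (0 : 𝓞 k))] at h4
      exact coeff_notMem _ h2 v hv h4
    rw [h3, Set.ncard_empty]
    simp [hε.le]
  | succ n ih =>
    intro I hI ε hε
    obtain ⟨G, hG⟩ := (IsNoetherian.noetherian I : I.FG)
    obtain ⟨r, hr0, hrI⟩ := elim_exists I hI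
    obtain ⟨c, hc⟩ := MvPolynomial.ne_zero_iff.mp hr0
    obtain ⟨m, B₁, hm⟩ := big_primes hd ι hspan r
    let D := G.sup fun g => (MvPolynomial.finSuccEquiv (𝓞 k) n g).natDegree
    have hD : ∀ g ∈ G, (MvPolynomial.finSuccEquiv (𝓞 k) n g).natDegree ≤ D := fun g hg =>
      Finset.le_sup (f := fun g => (MvPolynomial.finSuccEquiv (𝓞 k) n g).natDegree) hg
    let T : ℝ := r.totalDegree * D * (2 * C) ^ (n + 1)
    have hT : 0 ≤ T := by positivity
    let δ : ℝ := ε / (4 * (T + 1))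
    have hδ : 0 < δ := by positivity
    obtain ⟨M₁, B₂, hJ⟩ := ih _ (cop_coeffIdeal I hI G hG) (ε / (8 * C)) (by positivity)
    obtain ⟨M₂, htail⟩ := prime_tail k δ hδ
    let U : ℝ := r.totalDegree * (2 * C) ^ n + (2 * C) ^ n * (m * (D * (2 * C)))
    have hU : 0 ≤ U := by positivity
    let M := max M₁ (max M₂ (Ideal.absNorm (Ideal.span {r.coeff c})))
    refine ⟨M, max 1 (max B₁ (max B₂ (2 * U / ε))), fun B hB => ?_⟩
    simp only [max_le_iff] at hB
    obtain ⟨hB1, hB2, hB3, hB4⟩ := hB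
    set X := B ^ d with hXdef
    have hBX : B ≤ X := le_self_pow₀ hB1 (by omega)
    have hX : 1 ≤ X := hB1.trans hBX
    have hSf : {a : 𝓞 k | ‖ι a‖ ≤ B}.Finite := by
      have := (hcl ⊤ top_ne_bot 0 B hB1).1
      simpa using this
    have hSc : (hSf.toFinset.card : ℝ) ≤ 2 * C * X := by
      have h1 := (hcl ⊤ top_ne_bot 0 B hB1).2
      rw [← Set.ncard_eq_toFinset_card _ hSf]
      simp only [Submodule.mem_top, and_true, Ideal.absNorm_top, Nat.cast_one, div_one] at h1
      refine h1.trans ?_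
      nlinarith
    have hmem : ∀ a, a ∈ hSf.toFinset ↔ ‖ι a‖ ≤ B := fun a => by simp
    have hS : ∀ (v : HeightOneSpectrum (𝓞 k)) a,
        ({x : 𝓞 k | x ∈ hSf.toFinset ∧ x - a ∈ v.asIdeal}.ncard : ℝ) ≤
        C * (X / Ideal.absNorm v.asIdeal + 1) := by
      intro v a
      simp only [hmem]
      exact (hcl v.asIdeal v.ne_bot a B hB1).2
    have hJ' : ({x : Fin n → 𝓞 k | (∀ i, x i ∈ hSf.toFinset) ∧ ∃ v : HeightOneSpectrum (𝓞 k),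
        M < Ideal.absNorm v.asIdeal ∧ ∀ f ∈ coeffIdeal k G,
        MvPolynomial.eval x f ∈ v.asIdeal}.ncard : ℝ) ≤ ε / (8 * C) * X ^ n := by
      refine le_trans ?_ (hJ B hB3)
      rw [Nat.cast_le]
      apply Set.ncard_le_ncard
      · rintro x ⟨hx, v, hv, h⟩
        exact ⟨fun i => (hmem _).mp (hx i), v, lt_of_le_of_lt (le_max_left _ _) hv, h⟩
      · apply (box_fin hSf.toFinset n).subset
        rintro x ⟨hx, _⟩ i
        exact (hmem _).mpr (hx i)
    have key := step_count I G hG D hD r hr0 hrI hSf.toFinset X C hX hC hS hSc m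
      (fun x hx => hm B hB2 x (fun i => (hmem _).mp (hx i))) M
      (fun v hv => ⟨c, coeff_notMem _ hc v (lt_of_le_of_lt
        ((le_max_right _ _).trans (le_max_right _ _)) hv)⟩) δ
      (fun Q hQ => htail Q fun v hv => lt_of_le_of_lt
        ((le_max_left _ _).trans (le_max_right _ _)) (hQ v hv)) _ hJ'
    simp only [hmem] at key
    refine key.trans ?_
    have e1 : ε / (8 * C) * X ^ n * (2 * C * X) = ε / 4 * X ^ (n + 1) := by
      field_simp
      ring
    have e2 : (r.totalDegree * (2 * C * X) ^ n + (2 * C * X) ^ n * (m * (D * (2 * C))) : ℝ) ≤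
        ε / 2 * X ^ (n + 1) := by
      have : (r.totalDegree * (2 * C * X) ^ n + (2 * C * X) ^ n * (m * (D * (2 * C))) : ℝ) =
          U * X ^ n := by simp only [U, mul_pow]; ring
      rw [this, pow_succ]
      have h1 : U ≤ ε / 2 * X := by
        have := hB4.trans hBX
        rw [div_le_iff₀ hε] at this
        linarith
      calc U * X ^ n ≤ (ε / 2 * X) * X ^ n := by gcongr
        _ = _ := by ring
    have e3 : r.totalDegree * D * (2 * C * X) ^ (n + 1) * δ ≤ ε / 4 * X ^ (n + 1) := by
      have h1 : r.totalDegree * D * (2 * C * X) ^ (n + 1) * δ = (T * δ) * X ^ (n + 1) := by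
        simp only [T, mul_pow]; ring
      rw [h1]
      gcongr
      simp only [δ]
      rw [mul_div_assoc', div_le_div_iff₀ (by positivity) (by norm_num)]
      nlinarith
    rw [e1]
    linarith

theorem mem_of_map {k : Type*} [Field k] [NumberField k] (v : HeightOneSpectrum (𝓞 k)) (x : 𝓞 k)
    (h : algebraMap (𝓞 k) (v.adicCompletionIntegers k) x ∈
      Ideal.map (algebraMap (𝓞 k) (v.adicCompletionIntegers k)) v.asIdeal) : x ∈ v.asIdeal := by
  have hval : ∀ y : 𝓞 k, algebraMap (𝓞 k) (v.adicCompletionIntegers k) y ∈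
      IsLocalRing.maximalIdeal (v.adicCompletionIntegers k) ↔ y ∈ v.asIdeal := by
    intro y
    rw [IsLocalRing.mem_maximalIdeal, mem_nonunits_iff,
      HeightOneSpectrum.adicCompletionIntegers.isUnit_iff_valued_eq_one,
      HeightOneSpectrum.algebraMap_adicCompletionIntegers_apply,
      HeightOneSpectrum.valuedAdicCompletion_eq_valuation']
    rw [← HeightOneSpectrum.valuation_lt_one_iff_mem (K := k) v]
    exact (lt_iff_le_and_ne.trans (and_iff_right (HeightOneSpectrum.valuation_le_one v y))).symm
  rw [← hval]
  refine (Ideal.map_le_iff_le_comap.mpr ?_) h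
  intro y hy
  exact (hval y).mpr hy

theorem lim_aux (u : ℕ → ℝ → ℝ) (h0 : ∀ M, ∀ B ≥ (1 : ℝ), 0 ≤ u M B)
    (h : ∀ ε > 0, ∃ (M₀ : ℕ) (B₀ : ℝ), ∀ M ≥ M₀, ∀ B ≥ B₀, u M B ≤ ε) :
    Tendsto (fun M : ℕ => limsup (u M) atTop) atTop (𝓝 0) := by
  rw [Metric.tendsto_atTop]
  intro ε hε
  obtain ⟨M₀, B₀, hb⟩ := h (ε / 2) (by positivity)
  refine ⟨M₀, fun M hM => ?_⟩
  have hlow : ∀ᶠ B in atTop, 0 ≤ u M B := by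
    filter_upwards [eventually_ge_atTop (1 : ℝ)] with B hB using h0 M B hB
  have hup : ∀ᶠ B in atTop, u M B ≤ ε / 2 := by
    filter_upwards [eventually_ge_atTop B₀] with B hB using hb M hM B hB
  have hbd : IsBoundedUnder (· ≤ ·) atTop (u M) := isBoundedUnder_of_eventually_le hup
  have hbd' : IsBoundedUnder (· ≥ ·) atTop (u M) := isBoundedUnder_of_eventually_ge hlow
  have h1 : limsup (u M) atTop ≤ ε / 2 := limsup_le_of_le hbd'.isCoboundedUnder_le hup
  have h2 : 0 ≤ limsup (u M) atTop := le_limsup_of_frequently_le hlow.frequently hbd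
  rw [Real.dist_eq, sub_zero, abs_of_nonneg h2]
  linarith

/-- Ekedahl's sieve condition for closed subsets of codimension at least two of affine space
over the ring of integers of a number field: if `I ⊂ 𝔬[X₁,…,X_n]` is an ideal with
`dim 𝔬[X]/I ≤ n − 1` (i.e. `V(I) ⊂ 𝔸ⁿ_𝔬` has codimension at least two), and
`Ω_𝔭 = {x ∈ 𝔬_𝔭ⁿ : ∃ f ∈ I, f(x) ∉ 𝔭𝔬_𝔭}`, then for any bounded `Ω_∞ ⊂ k_∞ⁿ` of positive
measure and null boundary,
`lim_{M→∞} limsup_{B→∞} B^{-dn}·#{x ∈ 𝔬ⁿ ∩ BΩ_∞ : ∃ 𝔭, N𝔭 > M, x ∉ Ω_𝔭} = 0`.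
Here `k_∞ = 𝔬 ⊗ ℝ` is realized as `ℝ^d` with `𝔬` embedded by `ι` as a full lattice of
covolume `|Δ_k|^{1/2}`. -/
theorem ekedahl_codim_two_affine (k : Type*) [Field k] [NumberField k]
    (n : ℕ) (d : ℕ) (hd : d = Module.finrank ℚ k)
    (ι : 𝓞 k →ₗ[ℤ] (Fin d → ℝ)) (hinj : Function.Injective ι)
    (hspan : Submodule.span ℝ (Set.range ι) = ⊤)
    (μinf : Measure (Fin d → ℝ)) [μinf.IsAddHaarMeasure]
    (hcovol : ZLattice.covolume (LinearMap.range ι) μinf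
      = Real.sqrt |(NumberField.discr k : ℝ)|)
    (I : Ideal (MvPolynomial (Fin n) (𝓞 k)))
    (hcodim : ringKrullDim (MvPolynomial (Fin n) (𝓞 k) ⧸ I) + 1 ≤ (n : WithBot ℕ∞))
    (Ωinf : Set (Fin n → Fin d → ℝ)) (hbdd : Bornology.IsBounded Ωinf)
    (hfront : Measure.pi (fun _ : Fin n => μinf) (frontier Ωinf) = 0)
    (hpos : 0 < Measure.pi (fun _ : Fin n => μinf) Ωinf)
    (Ωp : ∀ v : HeightOneSpectrum (𝓞 k), Set (Fin n → v.adicCompletionIntegers k))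
    (hΩp : ∀ v, Ωp v = {y : Fin n → v.adicCompletionIntegers k | ∃ f ∈ I,
      MvPolynomial.aeval y f ∉
        Ideal.map (algebraMap (𝓞 k) (v.adicCompletionIntegers k)) v.asIdeal}) :
    Tendsto (fun M : ℕ => limsup (fun B : ℝ =>
        (Nat.card {x : Fin n → 𝓞 k | (fun i => ι (x i)) ∈ B • Ωinf ∧
          ∃ v : HeightOneSpectrum (𝓞 k), M < Ideal.absNorm v.asIdeal ∧
            (fun i => algebraMap (𝓞 k) (v.adicCompletionIntegers k) (x i)) ∉ Ωp v} : ℝ)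
          / B ^ (d * n)) atTop) atTop (𝓝 0) := by
  have hcop := cop_of_dim I hcodim
  obtain ⟨C, hC, hcl⟩ := class_count hd ι hspan
  obtain ⟨R, hR1, hR⟩ : ∃ R : ℝ, 1 ≤ R ∧ ∀ ω ∈ Ωinf, ‖ω‖ ≤ R := by
    obtain ⟨R, hR⟩ := hbdd.exists_norm_le
    exact ⟨max 1 R, le_max_left _ _, fun ω hω => (hR ω hω).trans (le_max_right _ _)⟩
  apply lim_aux
  · intro M B hB
    positivity
  intro ε hε
  obtain ⟨M₀, B₀, hmain⟩ := main_ind hd ι hspan n I hcop (ε / (R ^ d) ^ n) (by positivity)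
  refine ⟨M₀, max 1 B₀, fun M hM B hB => ?_⟩
  have hB1 : 1 ≤ B := (le_max_left _ _).trans hB
  have hB2 : B₀ ≤ B := (le_max_right _ _).trans hB
  have hRB : B ≤ R * B := le_mul_of_one_le_left (by linarith) hR1
  rw [div_le_iff₀ (by positivity)]
  have hm := hmain (R * B) (hB2.trans hRB)
  have e1 : ε / (R ^ d) ^ n * ((R * B) ^ d) ^ n = ε * B ^ (d * n) := by
    rw [mul_pow, mul_pow, pow_mul B]
    field_simp
  rw [e1] at hm
  refine le_trans ?_ hm
  rw [Nat.cast_le]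
  change Set.ncard _ ≤ _
  apply Set.ncard_le_ncard
  · rintro x ⟨hx, v, hv, hxv⟩
    refine ⟨?_, v, lt_of_le_of_lt hM hv, ?_⟩
    · obtain ⟨ω, hω, h1⟩ := hx
      intro i
      have h2 : ι (x i) = B • ω i := (congrFun h1 i).symm
      rw [h2, norm_smul, Real.norm_of_nonneg (by linarith), mul_comm]
      gcongr
      exact (norm_le_pi_norm ω i).trans (hR ω hω)
    · intro f hf
      apply mem_of_map
      rw [hΩp] at hxv
      by_contra hcon
      apply hxv
      refine ⟨f, hf, ?_⟩
      have h3 := MvPolynomial.aeval_algebraMap_apply (v.adicCompletionIntegers k) x f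
      rw [show MvPolynomial.aeval x f = MvPolynomial.eval x f from by rw [MvPolynomial.aeval_eq_eval]] at h3
      rw [show (fun i => algebraMap (𝓞 k) (v.adicCompletionIntegers k) (x i)) =
        algebraMap (𝓞 k) (v.adicCompletionIntegers k) ∘ x from rfl, h3]
      exact hcon
  · have hSf : {a : 𝓞 k | ‖ι a‖ ≤ R * B}.Finite := by
      have := (hcl ⊤ top_ne_bot 0 (R * B) (hB1.trans hRB)).1
      simpa using this
    apply (box_fin hSf.toFinset n).subset
    rintro x ⟨hx, _⟩ i
    rw [Set.Finite.mem_toFinset]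
    exact hx i
end

section
/- Let k be a number field of degree d with ring of integers 𝔬, and let I ⊂ 𝔬[X₀,…,X_n] be a homogeneous ideal such that the closed subscheme V₊(I) of ℙ^n_𝔬 has codimension at least two (equivalently, the Krull dimension of 𝔬[X₀,…,X_n]/I is at most n). For each nonzero prime ideal 𝔭 let Ω_𝔭^aff ⊂ k_𝔭^{n+1} ∖ {0} be the set of vectors y such that, writing y = c·z with c ∈ k_𝔭^× and z ∈ 𝔬_𝔭^{n+1} having at least one coordinate a unit, there exists a homogeneous f ∈ I with f(z) ≢ 0 (mod 𝔭𝔬_𝔭). Then for every bounded subset Ψ ⊂ k_∞^{n+1} of positive measure with μ_∞(∂Ψ) = 0 one has lim_{M→∞} limsup_{B→∞} B^{-d(n+1)}·#{x ∈ 𝔬^{n+1} : x ∈ BΨ and there exists a prime 𝔭 with N𝔭 > M and x ∉ Ω_𝔭^aff} = 0. -/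
open MeasureTheory Filter Topology Pointwise NumberField IsDedekindDomain

namespace Eke
open Module

variable {K : Type*} [Field K] [NumberField K]

/-- size of an algebraic integer -/
noncomputable def hs (x : 𝓞 K) : ℝ := house (x : K)

lemma hs_nonneg (x : 𝓞 K) : 0 ≤ hs x := house_nonneg _
lemma hs_add (x y : 𝓞 K) : hs (x + y) ≤ hs x + hs y := by
  simpa [hs] using house_add_le (x : K) (y : K)
lemma hs_mul (x y : 𝓞 K) : hs (x * y) ≤ hs x * hs y := by
  simpa [hs] using house_mul_le (x : K) (y : K)
lemma hs_neg (x : 𝓞 K) : hs (-x) = hs x := by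
  simp [hs, house]
lemma hs_sub (x y : 𝓞 K) : hs (x - y) ≤ hs x + hs y := by
  rw [sub_eq_add_neg, ← hs_neg y]; exact hs_add _ _
lemma hs_pow (x : 𝓞 K) (m : ℕ) : hs (x ^ m) ≤ hs x ^ m := by
  simpa [hs] using house_pow_le (x : K) m
lemma hs_int_mul (a : ℤ) (x : 𝓞 K) : hs ((a : 𝓞 K) * x) ≤ |(a : ℝ)| * hs x := by
  have := house_mul_le ((a : ℤ) : K) (x : K)
  rw [house_intCast] at this
  simpa [hs] using this
lemma hs_sum {ι : Type*} (s : Finset ι) (f : ι → 𝓞 K) : hs (∑ i ∈ s, f i) ≤ ∑ i ∈ s, hs (f i) := by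
  simpa [hs] using house_sum_le_sum_house s (fun i => (f i : K))
lemma hs_zero : hs (0 : 𝓞 K) = 0 := by simp [hs, house]
lemma hs_one : hs (1 : 𝓞 K) = 1 := by
  have := house_intCast (K := K) 1
  simpa [hs] using this

lemma norm_le_hs (x : 𝓞 K) : |((Algebra.norm ℤ x : ℤ) : ℝ)| ≤ hs x ^ finrank ℚ K := by
  have σ : K →+* ℂ := Classical.arbitrary _
  have h := norm_norm_le_norm_mul_house_pow (x : K) σ
  have h2 := norm_embedding_le_house (x : K) σ
  have hd : 0 < finrank ℚ K := finrank_pos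
  have h3 : ‖Algebra.norm ℚ (x : K)‖ = |((Algebra.norm ℤ x : ℤ) : ℝ)| := by
    rw [← Algebra.coe_norm_int]
    rw [← Rat.norm_cast_real, Real.norm_eq_abs]
    simp
  rw [← h3]
  refine h.trans ?_
  calc _ ≤ house (x : K) * house (x : K) ^ (finrank ℚ K - 1) :=
        mul_le_mul_of_nonneg_right h2 (pow_nonneg (house_nonneg _) _)
    _ = house (x : K) ^ finrank ℚ K := by
        rw [← pow_succ']; congr 1; omega

lemma absNorm_le_norm {I : Ideal (𝓞 K)} {x : 𝓞 K} (hx : x ∈ I) (h0 : x ≠ 0) :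
    (Ideal.absNorm I : ℝ) ≤ |((Algebra.norm ℤ x : ℤ) : ℝ)| := by
  have h := Ideal.absNorm_dvd_norm_of_mem hx
  have h2 : (Algebra.norm ℤ x : ℤ) ≠ 0 := by
    simpa [Algebra.norm_eq_zero_iff] using h0
  have := Int.le_of_dvd (abs_pos.mpr h2) ((dvd_abs _ _).mpr h)
  exact_mod_cast this

lemma absNorm_le_hs {I : Ideal (𝓞 K)} {x : 𝓞 K} (hx : x ∈ I) (h0 : x ≠ 0) :
    (Ideal.absNorm I : ℝ) ≤ hs x ^ finrank ℚ K :=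
  (absNorm_le_norm hx h0).trans (norm_le_hs x)

/-- integral basis indexed by Fin d -/
noncomputable def bas (K : Type*) [Field K] [NumberField K] :
    Basis (Fin (finrank ℚ K)) ℤ (𝓞 K) :=
  (RingOfIntegers.basis K).reindex (Fintype.equivFinOfCardEq (by
    rw [← finrank_eq_card_chooseBasisIndex, RingOfIntegers.rank]))

lemma repr_le : ∃ C : ℝ, 0 < C ∧ ∀ (x : 𝓞 K) j, |((bas K).repr x j : ℝ)| ≤ C * hs x := by
  classical
  obtain ⟨c, hc⟩ : ∃ c : ℝ, ∀ (α : 𝓞 K) (i : K →+* ℂ), ‖(((integralBasis K).reindex (equivReindex K).symm).repr α i : ℂ)‖ ≤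
      c * house (algebraMap (𝓞 K) K α) := ⟨_, house.basis_repr_norm_le_const_mul_house K⟩
  refine ⟨max c 1, by positivity, fun x j => ?_⟩
  set e := (Fintype.equivFinOfCardEq (by
    rw [← finrank_eq_card_chooseBasisIndex, RingOfIntegers.rank]) :
      Free.ChooseBasisIndex ℤ (𝓞 K) ≃ Fin (finrank ℚ K)) with he
  have h := hc x ((equivReindex K).symm (e.symm j))
  have h2 : |((bas K).repr x j : ℝ)| ≤ c * hs x := by
    simpa [Basis.repr_reindex, Finsupp.mapDomain_equiv_apply,
        integralBasis_repr_apply, bas, hs, ← he] using h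
  exact h2.trans (mul_le_mul_of_nonneg_right (le_max_left _ _) (hs_nonneg _))

lemma hs_le_repr : ∃ C : ℝ, 0 < C ∧ ∀ (x : 𝓞 K) (t : ℝ), (∀ j, |((bas K).repr x j : ℝ)| ≤ t) →
    hs x ≤ C * t := by
  refine ⟨1 + ∑ j, hs (bas K j), add_pos_of_pos_of_nonneg one_pos
    (Finset.sum_nonneg fun _ _ => hs_nonneg _), fun x t ht => ?_⟩
  have hd : 0 < finrank ℚ K := finrank_pos
  have ht0 : 0 ≤ t := (abs_nonneg _).trans (ht ⟨0, hd⟩)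
  have h1 : x = ∑ j, ((bas K).repr x j : 𝓞 K) * bas K j := by
    conv_lhs => rw [← (bas K).sum_repr x]
    simp
  have h2 : hs x ≤ ∑ j, t * hs (bas K j) := by
    conv_lhs => rw [h1]
    refine (hs_sum _ _).trans (Finset.sum_le_sum fun j _ => ?_)
    exact (hs_int_mul _ _).trans (mul_le_mul_of_nonneg_right (ht j) (hs_nonneg _))
  rw [← Finset.mul_sum] at h2
  nlinarith

/-- Lemma 1: class count -/
lemma class_count : ∃ C : ℝ, 0 < C ∧ ∀ (B : ℝ), 0 ≤ B → ∀ I : Ideal (𝓞 K), I ≠ ⊥ → ∀ r : 𝓞 K,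
    {a : 𝓞 K | hs a ≤ B ∧ a - r ∈ I}.Finite ∧
    (Set.ncard {a : 𝓞 K | hs a ≤ B ∧ a - r ∈ I} : ℝ) ≤
      C * (B ^ finrank ℚ K / Ideal.absNorm I + 1) := by
  classical
  obtain ⟨C1, hC1, h1⟩ := repr_le (K := K)
  obtain ⟨C2, hC2, h2⟩ := hs_le_repr (K := K)
  set d := finrank ℚ K with hd
  have hd0 : 0 < d := finrank_pos
  refine ⟨2 ^ (d - 1) * ((4 * C1 * C2) ^ d + 3 ^ d), by positivity, fun B hB I hI r => ?_⟩
  have hN : 0 < (Ideal.absNorm I : ℝ) := by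
    have : Ideal.absNorm I ≠ 0 := by rwa [Ne, Ideal.absNorm_eq_zero_iff]
    positivity
  set N : ℝ := (Ideal.absNorm I : ℝ)
  set ρ : ℝ := N ^ (1 / (d : ℝ)) with hρ
  have hρ0 : 0 < ρ := by positivity
  have hρd : ρ ^ d = N := by
    rw [hρ, one_div]; exact Real.rpow_inv_natCast_pow hN.le hd0.ne'
  set s : ℝ := ρ / (2 * C2) with hs'
  have hs0 : 0 < s := by positivity
  set T : ℤ := ⌊C1 * B / s⌋ + 1 with hT
  set box : Finset (Fin d → ℤ) := Fintype.piFinset fun _ => Finset.Icc (-T) T with hbox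
  let φ : 𝓞 K → (Fin d → ℤ) := fun a j => ⌊((bas K).repr a j : ℝ) / s⌋
  have hmaps : Set.MapsTo φ {a : 𝓞 K | hs a ≤ B ∧ a - r ∈ I} (box : Set (Fin d → ℤ)) := by
    rintro a ⟨ha, -⟩
    simp only [hbox, Finset.mem_coe, Fintype.mem_piFinset, Finset.mem_Icc]
    intro j
    have h := abs_le.mp ((h1 a j).trans (mul_le_mul_of_nonneg_left ha hC1.le))
    have hup : ((bas K).repr a j : ℝ) / s ≤ C1 * B / s := by gcongr; exact h.2
    have hlo : -(C1 * B / s) ≤ ((bas K).repr a j : ℝ) / s := by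
      rw [← neg_div]; gcongr; exact h.1
    constructor
    · rw [Int.le_floor]
      have := (Int.lt_floor_add_one (C1 * B / s)).le
      push_cast [hT]
      linarith
    · have := Int.floor_le_floor hup
      simp only [φ]; omega
  have hinj : Set.InjOn φ {a : 𝓞 K | hs a ≤ B ∧ a - r ∈ I} := by
    rintro a ⟨-, ha⟩ b ⟨-, hb⟩ hab
    by_contra hne
    have hmem : a - b ∈ I := by
      have := I.sub_mem ha hb
      simpa using this
    have hsz : hs (a - b) ≤ C2 * s := by
      apply h2
      intro j
      have := congrFun hab j
      simp only [φ] at this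
      have := (Int.abs_sub_lt_one_of_floor_eq_floor this).le
      rw [← sub_div, abs_div, abs_of_pos hs0, div_le_one hs0] at this
      simpa using this
    have h3 := absNorm_le_hs hmem (sub_ne_zero.mpr hne)
    have h4 : hs (a - b) ^ d < ρ ^ d := by
      apply pow_lt_pow_left₀ _ (hs_nonneg _) hd0.ne'
      refine hsz.trans_lt ?_
      rw [hs']
      have : C2 * (ρ / (2 * C2)) = ρ / 2 := by field_simp
      rw [this]; linarith
    rw [hρd] at h4
    exact absurd h3 (not_le.mpr h4)
  have hfin : {a : 𝓞 K | hs a ≤ B ∧ a - r ∈ I}.Finite :=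
    Set.Finite.of_finite_image (box.finite_toSet.subset hmaps.image_subset) hinj
  refine ⟨hfin, ?_⟩
  have hcard : Set.ncard {a : 𝓞 K | hs a ≤ B ∧ a - r ∈ I} ≤ box.card := by
    rw [← Set.ncard_coe_finset]
    exact Set.ncard_le_ncard_of_injOn φ hmaps hinj box.finite_toSet
  have hT0 : 0 ≤ C1 * B / s := by positivity
  have hTpos : 0 ≤ T := by
    have := Int.floor_nonneg.mpr hT0
    omega
  have hTle : (T : ℝ) ≤ C1 * B / s + 1 := by
    rw [hT]; push_cast
    have := Int.floor_le (C1 * B / s)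
    linarith
  have hbc : (box.card : ℝ) = (2 * T + 1) ^ d := by
    rw [hbox, Fintype.card_piFinset]
    simp only [Int.card_Icc, Finset.prod_const, Finset.card_univ, Fintype.card_fin]
    push_cast
    congr 1
    have : ((T + 1 - -T).toNat : ℤ) = T + 1 - -T := Int.toNat_of_nonneg (by omega)
    have h' : (((T + 1 - -T).toNat : ℤ) : ℝ) = ((T + 1 - -T : ℤ) : ℝ) := by rw [this]
    push_cast at h'
    rw [h']; ring
  calc (Set.ncard {a : 𝓞 K | hs a ≤ B ∧ a - r ∈ I} : ℝ) ≤ box.card := by exact_mod_cast hcard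
    _ = (2 * T + 1) ^ d := hbc
    _ ≤ (2 * (C1 * B / s) + 3) ^ d := by
        have : (0:ℝ) ≤ T := by exact_mod_cast hTpos
        apply pow_le_pow_left₀ (by positivity); linarith
    _ ≤ 2 ^ (d - 1) * ((2 * (C1 * B / s)) ^ d + 3 ^ d) := add_pow_le (by positivity) (by positivity) d
    _ = 2 ^ (d - 1) * ((4 * C1 * C2) ^ d * (B ^ d / N) + 3 ^ d) := by
        congr 2
        rw [← hρd, ← div_pow, ← mul_pow, hs']
        congr 1
        field_simp
        ring
    _ ≤ _ := by
        rw [mul_assoc (2 ^ (d - 1) : ℝ)]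
        apply mul_le_mul_of_nonneg_left _ (by positivity)
        have : 0 ≤ B ^ d / N := by positivity
        have h3 : (0:ℝ) < 3 ^ d := by positivity
        have h4 : 0 < (4 * C1 * C2) ^ d := by positivity
        nlinarith [mul_nonneg h3.le this]

end Eke

namespace Eke
open Module

variable {K : Type*} [Field K] [NumberField K]

lemma hs_eval {n : ℕ} (F : MvPolynomial (Fin n) (𝓞 K)) : ∃ (C : ℝ) (D : ℕ), 0 < C ∧
    ∀ (B : ℝ), 1 ≤ B → ∀ y : Fin n → 𝓞 K, (∀ i, hs (y i) ≤ B) →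
      hs (MvPolynomial.eval y F) ≤ C * B ^ D := by
  induction F using MvPolynomial.induction_on with
  | C a =>
    refine ⟨hs a + 1, 0, by linarith [hs_nonneg a], fun B hB y hy => ?_⟩
    simp
  | add p q hp hq =>
    obtain ⟨C1, D1, hC1, h1⟩ := hp
    obtain ⟨C2, D2, hC2, h2⟩ := hq
    refine ⟨C1 + C2, max D1 D2, by positivity, fun B hB y hy => ?_⟩
    rw [map_add, add_mul]
    refine (hs_add _ _).trans (add_le_add ((h1 B hB y hy).trans ?_) ((h2 B hB y hy).trans ?_))
    · exact mul_le_mul_of_nonneg_left (pow_le_pow_right₀ hB (le_max_left _ _)) (by positivity)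
    · exact mul_le_mul_of_nonneg_left (pow_le_pow_right₀ hB (le_max_right _ _)) (by positivity)
  | mul_X p i hp =>
    obtain ⟨C1, D1, hC1, h1⟩ := hp
    refine ⟨C1, D1 + 1, hC1, fun B hB y hy => ?_⟩
    rw [map_mul, MvPolynomial.eval_X, pow_succ, ← mul_assoc]
    refine (hs_mul _ _).trans (mul_le_mul (h1 B hB y hy) (hy i) (hs_nonneg _) (by positivity))

lemma primes_count {a : 𝓞 K} (ha : a ≠ 0) {C B : ℝ} {D : ℕ} (hB : 1 < B) (hCB : C ≤ B)
    (h : hs a ≤ C * B ^ D) :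
    {v : HeightOneSpectrum (𝓞 K) | a ∈ v.asIdeal ∧ B ^ finrank ℚ K < Ideal.absNorm v.asIdeal}.Finite ∧
    {v : HeightOneSpectrum (𝓞 K) | a ∈ v.asIdeal ∧ B ^ finrank ℚ K < Ideal.absNorm v.asIdeal}.ncard
      ≤ D + 1 := by
  classical
  set d := finrank ℚ K with hd
  have hd0 : 0 < d := finrank_pos
  have hfin : {v : HeightOneSpectrum (𝓞 K) | a ∈ v.asIdeal ∧
      B ^ d < Ideal.absNorm v.asIdeal}.Finite := by
    refine (Ideal.finite_factors (I := Ideal.span {a}) (by simpa using ha)).subset ?_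
    rintro v ⟨hv, -⟩
    simpa [Ideal.dvd_span_singleton] using hv
  refine ⟨hfin, ?_⟩
  set T := hfin.toFinset with hT
  rw [Set.ncard_eq_toFinset_card _ hfin]
  have hdvd : ∏ v ∈ T, v.asIdeal ∣ Ideal.span {a} := by
    have : ∏ v ∈ T, v.asIdeal = ∏ I ∈ T.image HeightOneSpectrum.asIdeal, I := by
      rw [Finset.prod_image]
      intro x _ y _ hxy
      exact HeightOneSpectrum.ext hxy
    rw [this]
    apply Finset.prod_primes_dvd
    · intro I hI
      obtain ⟨v, hv, rfl⟩ := Finset.mem_image.mp hI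
      exact v.prime
    · intro I hI
      obtain ⟨v, hv, rfl⟩ := Finset.mem_image.mp hI
      rw [hT, Set.Finite.mem_toFinset] at hv
      simpa [Ideal.dvd_span_singleton] using hv.1
  rw [Ideal.dvd_span_singleton] at hdvd
  have h1 := absNorm_le_hs hdvd ha
  rw [map_prod] at h1
  push_cast at h1
  have h2 : (B ^ d) ^ T.card ≤ ∏ v ∈ T, (Ideal.absNorm v.asIdeal : ℝ) := by
    rw [← Finset.prod_const]
    apply Finset.prod_le_prod
    · intros; positivity
    · intro v hv
      rw [hT, Set.Finite.mem_toFinset] at hv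
      exact hv.2.le
  have h3 : hs a ≤ B ^ (D + 1) := by
    rw [pow_succ']
    exact h.trans (mul_le_mul_of_nonneg_right hCB (by positivity))
  have h4 : hs a ^ d ≤ (B ^ d) ^ (D + 1) := by
    rw [← pow_mul, mul_comm, pow_mul]
    exact pow_le_pow_left₀ (hs_nonneg _) h3 d
  have h5 := h2.trans (h1.trans h4)
  exact (pow_le_pow_iff_right₀ (one_lt_pow₀ hB hd0.ne')).mp h5

lemma summable_primes :
    Summable (fun v : HeightOneSpectrum (𝓞 K) => 1 / (Ideal.absNorm v.asIdeal : ℝ) ^ 2) := by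
  classical
  have hO : (fun n : ℕ ↦ ∑ k ∈ Finset.Icc 1 n, (Nat.card {I : Ideal (𝓞 K) // Ideal.absNorm I = k} : ℝ))
      =O[atTop] fun n ↦ (n : ℝ) ^ (1 : ℝ) := by
    have h := ((Ideal.tendsto_norm_le_div_atTop₀ K).comp tendsto_natCast_atTop_atTop)
    have h2 := h.isBigO_one ℝ
    have h3 := h2.mul (Asymptotics.isBigO_refl (fun n : ℕ => (n : ℝ)) atTop)
    refine (h3.congr' ?_ ?_)
    · filter_upwards [eventually_gt_atTop 0] with n hn
      have hn' : (n : ℝ) ≠ 0 := by positivity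
      simp only [Function.comp_apply]
      rw [div_mul_cancel₀ _ hn']
      simp only [Nat.cast_le, ← Nat.cast_sum]
      congr
      rw [← add_left_inj 1, ← Ideal.card_norm_le_eq_card_norm_le_add_one,
        show Finset.Icc 1 n = Finset.Ioc 0 n from Finset.Icc_succ_left_eq_Ioc _ _,
        show 1 = Nat.card {I : Ideal (𝓞 K) // Ideal.absNorm I = 0} by simp [Ideal.absNorm_eq_zero_iff],
        Finset.sum_Ioc_add_eq_sum_Icc (n.zero_le),
        ← Finset.card_preimage_eq_sum_card_image_eq (fun k _ ↦ Ideal.finite_setOfPred_absNorm_eq k)]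
      simp [Set.coe_eq_subtype]
    · filter_upwards with n
      simp
  have hL := LSeriesSummable_of_sum_norm_bigO_and_nonneg (s := 2) hO (fun _ => Nat.cast_nonneg _)
    zero_le_one (by norm_num)
  have hL2 : Summable (fun m : ℕ => (Nat.card {I : Ideal (𝓞 K) // Ideal.absNorm I = m} : ℝ) * (1 / (m : ℝ) ^ 2)) := by
    have := hL.norm
    refine this.congr_cofinite ?_ 
    filter_upwards [(Set.finite_singleton 0).compl_mem_cofinite] with m hm
    have hm0 : m ≠ 0 := by simpa using hm
    rw [LSeries.norm_term_eq]
    simp [hm0, div_eq_mul_inv]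
  have hI : Summable (fun I : Ideal (𝓞 K) => 1 / (Ideal.absNorm I : ℝ) ^ 2) := by
    rw [← (Equiv.sigmaFiberEquiv (fun I : Ideal (𝓞 K) => Ideal.absNorm I)).summable_iff]
    rw [summable_sigma_of_nonneg (fun _ => by simp only [Function.comp_apply]; positivity)]
    have hf : ∀ m, Finite {I : Ideal (𝓞 K) // Ideal.absNorm I = m} := fun m => Ideal.finite_setOfPred_absNorm_eq m
    constructor
    · intro m
      exact Summable.of_finite
    · refine hL2.congr fun m => ?_
      have : ∀ x : {I : Ideal (𝓞 K) // Ideal.absNorm I = m}, (1 / (Ideal.absNorm x.1 : ℝ) ^ 2) = 1 / (m : ℝ) ^ 2 := fun x => by rw [x.2]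
      simp only [Function.comp_apply, Equiv.sigmaFiberEquiv_apply, this, tsum_const]
      simp [nsmul_eq_mul]
  exact hI.comp_injective (i := HeightOneSpectrum.asIdeal) (fun x y h => HeightOneSpectrum.ext h)

lemma tail_small (ε : ℝ) (hε : 0 < ε) : ∃ M : ℕ, ∀ t : Finset (HeightOneSpectrum (𝓞 K)),
    (∀ v ∈ t, M < Ideal.absNorm v.asIdeal) → ∑ v ∈ t, 1 / (Ideal.absNorm v.asIdeal : ℝ) ^ 2 ≤ ε := by
  classical
  obtain ⟨s, hs⟩ := (summable_iff_vanishing_norm.mp (summable_primes (K := K))) ε hε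
  refine ⟨∑ v ∈ s, Ideal.absNorm v.asIdeal, fun t ht => ?_⟩
  refine (le_abs_self _).trans (hs t ?_).le
  rw [Finset.disjoint_left]
  intro v hv hvs
  have := ht v hv
  have h2 := Finset.single_le_sum (f := fun v : HeightOneSpectrum (𝓞 K) => Ideal.absNorm v.asIdeal) (fun _ _ => Nat.zero_le _) hvs
  omega

end Eke

namespace Eke
open Module

section abstract_count

variable {R : Type*} [CommRing R] [IsDomain R] [DecidableEq R]

open Classical in
lemma root_count (P : Ideal R) [P.IsPrime] (S : Finset R) (L : ℕ)
    (hL : ∀ r : R, (S.filter (fun a => a - r ∈ P)).card ≤ L) (q : Polynomial R) (e : ℕ)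
    (hq : q.natDegree ≤ e) (hqe : q.coeff e ∉ P) :
    (S.filter (fun a => q.eval a ∈ P)).card ≤ L * e := by
  classical
  set π := Ideal.Quotient.mk P
  set qb := q.map π with hqb
  have hqb0 : qb ≠ 0 := by
    intro h
    have := congrArg (fun p => p.coeff e) h
    simp only [hqb, Polynomial.coeff_map, Polynomial.coeff_zero] at this
    exact hqe (Ideal.Quotient.eq_zero_iff_mem.mp this)
  have hcard : qb.roots.toFinset.card ≤ e :=
    (Multiset.toFinset_card_le _).trans ((Polynomial.card_roots' _).trans
      (Polynomial.natDegree_map_le.trans hq))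
  refine (Finset.card_le_mul_card_image_of_maps_to (f := π) (t := qb.roots.toFinset) ?_ L ?_).trans
    (Nat.mul_le_mul_left _ hcard)
  · intro a ha
    rw [Finset.mem_filter] at ha
    rw [Multiset.mem_toFinset, Polynomial.mem_roots hqb0, Polynomial.IsRoot.def, hqb,
      Polynomial.eval_map, Polynomial.eval₂_at_apply]
    exact Ideal.Quotient.eq_zero_iff_mem.mpr ha.2
  · intro b _
    obtain ⟨r, rfl⟩ := Ideal.Quotient.mk_surjective b
    refine (Finset.card_le_card ?_).trans (hL r)
    intro a ha
    simp only [Finset.mem_filter] at ha ⊢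
    exact ⟨ha.1.1, Ideal.Quotient.eq.mp ha.2⟩

lemma sz_nat {A : Type*} [CommRing A] [IsDomain A] [DecidableEq A] {n : ℕ}
    {p : MvPolynomial (Fin n) A} (hp : p ≠ 0) (S : Finset A) :
    ((Fintype.piFinset fun _ : Fin n => S).filter (fun y => MvPolynomial.eval y p = 0)).card * S.card
      ≤ p.totalDegree * S.card ^ n := by
  rcases Nat.eq_zero_or_pos S.card with h | h
  · simp [h]
  · have := MvPolynomial.schwartz_zippel_totalDegree hp S
    have h' : (0 : ℚ≥0) < S.card := by exact_mod_cast h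
    rw [div_le_div_iff₀ (by positivity) h'] at this
    exact_mod_cast this

open Classical in
lemma zero_count (P : Ideal R) [P.IsPrime] [Finite (R ⧸ P)] (S : Finset R) (L : ℕ)
    (hL : ∀ r : R, (S.filter (fun a => a - r ∈ P)).card ≤ L) {n : ℕ} (F : MvPolynomial (Fin n) R)
    (m : Fin n →₀ ℕ) (hF : F.coeff m ∉ P) :
    ((Fintype.piFinset fun _ : Fin n => S).filter (fun y => MvPolynomial.eval y F ∈ P)).card *
      Nat.card (R ⧸ P) ≤ F.totalDegree * Nat.card (R ⧸ P) ^ n * L ^ n := by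
  classical
  have := Fintype.ofFinite (R ⧸ P)
  set π := Ideal.Quotient.mk P
  set Fb := MvPolynomial.map π F with hFb
  have hFb0 : Fb ≠ 0 := by
    intro h
    have := congrArg (fun p => p.coeff m) h
    simp only [hFb, MvPolynomial.coeff_map, MvPolynomial.coeff_zero] at this
    exact hF (Ideal.Quotient.eq_zero_iff_mem.mp this)
  have hsz := sz_nat hFb0 Finset.univ
  have hdeg : Fb.totalDegree ≤ F.totalDegree := 
    Finset.sup_mono (MvPolynomial.support_map_subset _ _)
  set Z := ((Fintype.piFinset fun _ : Fin n => (Finset.univ : Finset (R ⧸ P))).filter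
    (fun y => MvPolynomial.eval y Fb = 0)) with hZ
  have h1 : ((Fintype.piFinset fun _ : Fin n => S).filter (fun y => MvPolynomial.eval y F ∈ P)).card
      ≤ L ^ n * Z.card := by
    refine (Finset.card_le_mul_card_image_of_maps_to (f := fun y => fun i => π (y i)) (t := Z) ?_ (L ^ n) ?_)
    · intro y hy
      rw [Finset.mem_filter] at hy
      simp only [hZ, Finset.mem_filter, Fintype.mem_piFinset, Finset.mem_univ, implies_true, true_and]
      have : MvPolynomial.eval (fun i => π (y i)) Fb = π (MvPolynomial.eval y F) := by
        rw [hFb, MvPolynomial.eval_map, MvPolynomial.eval₂_comp]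
        rfl
      rw [this]
      exact Ideal.Quotient.eq_zero_iff_mem.mpr hy.2
    · intro b _
      choose r hr using fun i => Ideal.Quotient.mk_surjective (b i)
      have hsub : (((Fintype.piFinset fun _ : Fin n => S).filter
          (fun y => MvPolynomial.eval y F ∈ P)).filter (fun y => (fun i => π (y i)) = b)) ⊆
          Fintype.piFinset fun i : Fin n => S.filter (fun a => a - r i ∈ P) := by
        intro y hy
        simp only [Finset.mem_filter, Fintype.mem_piFinset] at hy ⊢
        intro i
        refine ⟨hy.1.1 i, ?_⟩
        have := congrFun hy.2 i
        rw [← hr i] at this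
        exact Ideal.Quotient.eq.mp this
      refine (Finset.card_le_card hsub).trans ?_
      rw [Fintype.card_piFinset]
      refine (Finset.prod_le_pow_card _ _ L (fun i _ => hL (r i))).trans ?_
      simp
  rw [Finset.card_univ, ← Nat.card_eq_fintype_card] at hsz
  calc _ ≤ L ^ n * Z.card * Nat.card (R ⧸ P) := Nat.mul_le_mul_right _ h1
    _ = L ^ n * (Z.card * Nat.card (R ⧸ P)) := by ring
    _ ≤ L ^ n * (Fb.totalDegree * Nat.card (R ⧸ P) ^ n) := Nat.mul_le_mul_left _ hsz
    _ ≤ L ^ n * (F.totalDegree * Nat.card (R ⧸ P) ^ n) := by gcongr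
    _ = _ := by ring

lemma natDegree_coeff_eval {n : ℕ} (G : Polynomial (MvPolynomial (Fin n) R)) (e : ℕ)
    (he : G.natDegree ≤ e) (c : R) (hGc : G.coeff e = MvPolynomial.C c) (y : Fin n → R) :
    (G.map (MvPolynomial.eval y)).natDegree ≤ e ∧ (G.map (MvPolynomial.eval y)).coeff e = c := by
  constructor
  · exact Polynomial.natDegree_map_le.trans he
  · rw [Polynomial.coeff_map, hGc, MvPolynomial.eval_C]

open Classical in
lemma pair_count (P : Ideal R) [P.IsPrime] [Finite (R ⧸ P)] (S : Finset R) (L : ℕ)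
    (hL : ∀ r : R, (S.filter (fun a => a - r ∈ P)).card ≤ L) {n : ℕ} (F : MvPolynomial (Fin n) R)
    (m : Fin n →₀ ℕ) (hF : F.coeff m ∉ P)
    (G : Polynomial (MvPolynomial (Fin n) R)) (e : ℕ)
    (he : G.natDegree ≤ e) (c : R) (hc : c ∉ P) (hGc : G.coeff e = MvPolynomial.C c) :
    ((S ×ˢ (Fintype.piFinset fun _ : Fin n => S)).filter (fun y => MvPolynomial.eval y.2 F ∈ P ∧
      (G.map (MvPolynomial.eval y.2)).eval y.1 ∈ P)).card *
      Nat.card (R ⧸ P) ≤ F.totalDegree * e * Nat.card (R ⧸ P) ^ n * L ^ (n + 1) := by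
  have h0 := zero_count P S L hL F m hF
  set Y := (Fintype.piFinset fun _ : Fin n => S).filter (fun y => MvPolynomial.eval y F ∈ P)
  have h1 : ((S ×ˢ (Fintype.piFinset fun _ : Fin n => S)).filter
      (fun y => MvPolynomial.eval y.2 F ∈ P ∧
      (G.map (MvPolynomial.eval y.2)).eval y.1 ∈ P)).card ≤ (L * e) * Y.card := by
    refine (Finset.card_le_mul_card_image_of_maps_to (f := Prod.snd) (t := Y) ?_ _ ?_)
    · rintro ⟨a, y⟩ hy
      simp only [Finset.mem_filter, Finset.mem_product, Y] at hy ⊢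
      exact ⟨hy.1.2, hy.2.1⟩
    · intro y _
      obtain ⟨h2, h3⟩ := natDegree_coeff_eval G e he c hGc y
      refine (Finset.card_le_card_of_injOn (t := S.filter (fun a => (G.map (MvPolynomial.eval y)).eval a ∈ P))
        Prod.fst ?_ ?_).trans (root_count P S L hL _ e h2 (by rwa [h3]))
      · rintro ⟨a, y'⟩ h
        simp only [Finset.coe_filter, Finset.mem_filter, Finset.mem_product, Set.mem_ofPred_eq] at h ⊢
        obtain ⟨⟨⟨h4, h5⟩, h6, h7⟩, rfl⟩ := h
        exact ⟨h4, h7⟩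
      · rintro ⟨a, y'⟩ h ⟨b, y''⟩ h' hab
        simp only [Finset.coe_filter, Finset.mem_filter, Set.mem_ofPred_eq] at h h'
        simp only at hab
        rw [hab, h.2, h'.2]
  calc _ ≤ (L * e) * Y.card * Nat.card (R ⧸ P) := Nat.mul_le_mul_right _ h1
    _ = (L * e) * (Y.card * Nat.card (R ⧸ P)) := by ring
    _ ≤ (L * e) * (F.totalDegree * Nat.card (R ⧸ P) ^ n * L ^ n) := Nat.mul_le_mul_left _ h0
    _ = _ := by ring

open Classical in
/-- the large prime part, abstractly: `V` a family of primes. -/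
lemma large_count {ι : Type*} (P : ι → Ideal R) [∀ i, (P i).IsPrime] (V : Set ι) (S : Finset R) (L : ℕ)
    (hL : ∀ i ∈ V, ∀ r : R, (S.filter (fun a => a - r ∈ P i)).card ≤ L) {n : ℕ}
    (F : MvPolynomial (Fin n) R) (hF : F ≠ 0)
    (G : Polynomial (MvPolynomial (Fin n) R)) (e : ℕ)
    (he : G.natDegree ≤ e) (c : R) (hc : ∀ i ∈ V, c ∉ P i) (hGc : G.coeff e = MvPolynomial.C c)
    (E : ℕ) (hE : ∀ y ∈ Fintype.piFinset fun _ : Fin n => S, MvPolynomial.eval y F ≠ 0 →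
      {i | i ∈ V ∧ MvPolynomial.eval y F ∈ P i}.Finite ∧
      {i | i ∈ V ∧ MvPolynomial.eval y F ∈ P i}.ncard ≤ E) :
    ((S ×ˢ (Fintype.piFinset fun _ : Fin n => S)).filter (fun y => ∃ i ∈ V, MvPolynomial.eval y.2 F ∈ P i ∧
      (G.map (MvPolynomial.eval y.2)).eval y.1 ∈ P i)).card
      ≤ (F.totalDegree + E * (L * e)) * S.card ^ n := by
  set A := (Fintype.piFinset fun _ : Fin n => S) with hA
  set Z := A.filter (fun y => MvPolynomial.eval y F = 0) with hZ
  have hsz : Z.card * S.card ≤ F.totalDegree * S.card ^ n := sz_nat hF S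
  set W := ((S ×ˢ A).filter (fun y => MvPolynomial.eval y.2 F ≠ 0 ∧
      ∃ i ∈ V, MvPolynomial.eval y.2 F ∈ P i ∧
      (G.map (MvPolynomial.eval y.2)).eval y.1 ∈ P i)) with hW
  have hsub : ((S ×ˢ A).filter (fun y => ∃ i ∈ V, MvPolynomial.eval y.2 F ∈ P i ∧
      (G.map (MvPolynomial.eval y.2)).eval y.1 ∈ P i)) ⊆ (S ×ˢ Z) ∪ W := by
    rintro ⟨a, y⟩ h
    simp only [Finset.mem_filter, Finset.mem_product, Finset.mem_union, hW, hZ] at h ⊢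
    by_cases h0 : MvPolynomial.eval y F = 0
    · exact Or.inl ⟨h.1.1, h.1.2, h0⟩
    · exact Or.inr ⟨h.1, h0, h.2⟩
  have hWc : W.card ≤ (E * (L * e)) * A.card := by
    refine (Finset.card_le_mul_card_image_of_maps_to (f := Prod.snd) (t := A) ?_ _ ?_)
    · rintro ⟨a, y⟩ hy
      simp only [hW, Finset.mem_filter, Finset.mem_product] at hy ⊢
      exact hy.1.2
    · intro y hyA
      by_cases h0 : MvPolynomial.eval y F = 0
      · rw [Finset.card_eq_zero.mpr]
        · exact Nat.zero_le _
        · rw [Finset.filter_eq_empty_iff]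
          rintro ⟨a, y'⟩ h h'
          simp only [hW, Finset.mem_filter] at h h'
          rw [h'] at h
          exact h.2.1 h0
      obtain ⟨hfin, hcard⟩ := hE y hyA h0
      obtain ⟨h2, h3⟩ := natDegree_coeff_eval G e he c hGc y
      set T := hfin.toFinset with hT
      have hTc : T.card ≤ E := by rwa [hT, ← Set.ncard_eq_toFinset_card _ hfin]
      have : (W.filter (fun x => x.2 = y)).card ≤ (T.biUnion (fun i => S.filter
          (fun a => (G.map (MvPolynomial.eval y)).eval a ∈ P i))).card := by
        apply Finset.card_le_card_of_injOn Prod.fst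
        · rintro ⟨a, y'⟩ h
          simp only [hW, Finset.coe_filter, Finset.mem_filter, Finset.mem_product, Set.mem_ofPred_eq] at h
          obtain ⟨⟨⟨h4, h5⟩, h6, i, hi, h7, h8⟩, rfl⟩ := h
          simp only [Finset.coe_biUnion, Set.mem_iUnion, Finset.coe_filter, Set.mem_ofPred_eq]
          exact ⟨i, by simpa [hT] using ⟨hi, h7⟩, h4, h8⟩
        · rintro ⟨a, y'⟩ h ⟨b, y''⟩ h' hab
          simp only [Finset.coe_filter, Set.mem_ofPred_eq] at h h'
          simp only at hab
          rw [hab, h.2, h'.2]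
      refine this.trans ((Finset.card_biUnion_le_card_mul _ _ (L * e) ?_).trans
        (Nat.mul_le_mul_right _ hTc))
      intro i hi
      have hiV : i ∈ V := by
        have := hfin.mem_toFinset.mp hi
        exact this.1
      exact root_count (P i) S L (hL i hiV) _ e h2 (by rw [h3]; exact hc i hiV)
  have hAc : A.card = S.card ^ n := by rw [hA, Fintype.card_piFinset]; simp
  calc _ ≤ ((S ×ˢ Z) ∪ W).card := Finset.card_le_card hsub
    _ ≤ (S ×ˢ Z).card + W.card := Finset.card_union_le _ _
    _ ≤ F.totalDegree * S.card ^ n + (E * (L * e)) * S.card ^ n := by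
        rw [Finset.card_product, mul_comm S.card]
        rw [hAc] at hWc
        exact add_le_add hsz hWc
    _ = _ := by ring

end abstract_count

end Eke

namespace Eke
open Module

variable {K : Type*} [Field K] [NumberField K]

lemma natCard_quot (v : HeightOneSpectrum (𝓞 K)) :
    Nat.card (𝓞 K ⧸ v.asIdeal) = Ideal.absNorm v.asIdeal := by
  rw [Ideal.absNorm_apply, Submodule.cardQuot_apply]

lemma absNorm_pos (v : HeightOneSpectrum (𝓞 K)) : 0 < Ideal.absNorm v.asIdeal := by
  have : Ideal.absNorm v.asIdeal ≠ 0 := by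
    rw [Ne, Ideal.absNorm_eq_zero_iff]; exact v.ne_bot
  omega

lemma not_mem_large (c : 𝓞 K) (hc : c ≠ 0) : ∃ M : ℕ, ∀ v : HeightOneSpectrum (𝓞 K),
    M < Ideal.absNorm v.asIdeal → c ∉ v.asIdeal := by
  refine ⟨⌈|((Algebra.norm ℤ c : ℤ) : ℝ)|⌉₊, fun v hv hcv => ?_⟩
  have h := absNorm_le_norm hcv hc
  have h2 := h.trans (Nat.le_ceil _)
  exact absurd (Nat.cast_le.mp h2) (not_le.mpr hv)

set_option maxHeartbeats 2000000 in
theorem core {n : ℕ} (F : MvPolynomial (Fin n) (𝓞 K)) (hF : F ≠ 0)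
    (G : Polynomial (MvPolynomial (Fin n) (𝓞 K))) (e : ℕ) (he : G.natDegree ≤ e)
    (c : 𝓞 K) (hc : c ≠ 0) (hGc : G.coeff e = MvPolynomial.C c) (ε : ℝ) (hε : 0 < ε) :
    ∃ (M : ℕ) (B0 : ℝ), ∀ B, B0 ≤ B →
      {y : 𝓞 K × (Fin n → 𝓞 K) | hs y.1 ≤ B ∧ (∀ i, hs (y.2 i) ≤ B) ∧
        ∃ v : HeightOneSpectrum (𝓞 K), M < Ideal.absNorm v.asIdeal ∧
          MvPolynomial.eval y.2 F ∈ v.asIdeal ∧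
          (G.map (MvPolynomial.eval y.2)).eval y.1 ∈ v.asIdeal}.Finite ∧
      ({y : 𝓞 K × (Fin n → 𝓞 K) | hs y.1 ≤ B ∧ (∀ i, hs (y.2 i) ≤ B) ∧
        ∃ v : HeightOneSpectrum (𝓞 K), M < Ideal.absNorm v.asIdeal ∧
          MvPolynomial.eval y.2 F ∈ v.asIdeal ∧
          (G.map (MvPolynomial.eval y.2)).eval y.1 ∈ v.asIdeal}.ncard : ℝ)
        ≤ ε * B ^ (finrank ℚ K * (n + 1)) := by
  classical
  set d := finrank ℚ K with hd
  have hd0 : 0 < d := finrank_pos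
  obtain ⟨C, hC, hcl⟩ := class_count (K := K)
  obtain ⟨CF, D, hCF, hCFv⟩ := hs_eval F
  obtain ⟨m, hm⟩ := MvPolynomial.ne_zero_iff.mp hF
  obtain ⟨M1, hM1⟩ := not_mem_large c hc
  obtain ⟨M2, hM2⟩ := not_mem_large _ hm
  set K2 : ℝ := F.totalDegree * e * (2 * C) ^ (n + 1) with hK2
  have hK20 : 0 ≤ K2 := by positivity
  obtain ⟨M3, hM3⟩ := tail_small (K := K) (ε / (2 * (K2 + 1))) (by positivity)
  set LL : ℕ := ⌊2 * C⌋₊ with hLL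
  set K1 : ℝ := (F.totalDegree + (D + 1 : ℕ) * (LL * e)) * (2 * C) ^ n with hK1
  have hK10 : 0 ≤ K1 := by positivity
  set M := max M1 (max M2 M3) with hM
  refine ⟨M, max (max 2 CF) (2 * K1 / ε), fun B hB => ?_⟩
  have hB2 : 2 ≤ B := ((le_max_left _ _).trans (le_max_left _ _)).trans hB
  have hBCF : CF ≤ B := ((le_max_right _ _).trans (le_max_left _ _)).trans hB
  have hBK : 2 * K1 / ε ≤ B := (le_max_right _ _).trans hB
  have hB0 : 0 ≤ B := by linarith
  have hBd1 : 1 ≤ B ^ d := one_le_pow₀ (by linarith)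
  have hBdB : B ≤ B ^ d := le_self_pow₀ (by linarith) hd0.ne'
  have hSfin : {a : 𝓞 K | hs a ≤ B}.Finite := by
    have := (hcl B hB0 ⊤ (by simp) 0).1
    simpa using this
  set S : Finset (𝓞 K) := hSfin.toFinset with hS
  have hSmem : ∀ a, a ∈ S ↔ hs a ≤ B := fun a => by simp [hS]
  have hSc : (S.card : ℝ) ≤ 2 * C * B ^ d := by
    have := (hcl B hB0 ⊤ (by simp) 0).2
    simp only [Submodule.mem_top, and_true, Ideal.absNorm_top, Nat.cast_one, div_one] at this
    rw [Set.ncard_eq_toFinset_card _ hSfin] at this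
    refine this.trans ?_
    nlinarith
  have hfilter : ∀ (v : HeightOneSpectrum (𝓞 K)) (r : 𝓞 K),
      ((S.filter (fun a => a - r ∈ v.asIdeal)).card : ℝ) ≤
        C * (B ^ d / Ideal.absNorm v.asIdeal + 1) := by
    intro v r
    have := (hcl B hB0 v.asIdeal v.ne_bot r).2
    refine le_trans (le_of_eq ?_) this
    rw [← Set.ncard_coe_finset]
    congr 2
    ext a
    simp [hSmem]
  set A := (Fintype.piFinset fun _ : Fin n => S) with hA
  set V : Set (HeightOneSpectrum (𝓞 K)) := {v | B ^ d < Ideal.absNorm v.asIdeal ∧ M < Ideal.absNorm v.asIdeal} with hV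
  set large := ((S ×ˢ A).filter (fun y => ∃ i ∈ V, MvPolynomial.eval y.2 F ∈ i.asIdeal ∧
      (G.map (MvPolynomial.eval y.2)).eval y.1 ∈ i.asIdeal)) with hlarge
  have hUfin : {v : HeightOneSpectrum (𝓞 K) | (Ideal.absNorm v.asIdeal : ℝ) ≤ B ^ d ∧
      M < Ideal.absNorm v.asIdeal}.Finite := by
    have h1 := Ideal.finite_setOfPred_absNorm_le (S := 𝓞 K) ⌊B ^ d⌋₊
    refine Set.Finite.subset (h1.preimage (f := HeightOneSpectrum.asIdeal)
      (fun x _ y _ h => HeightOneSpectrum.ext h)) ?_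
    rintro v ⟨hv, -⟩
    exact Nat.le_floor hv
  set U := hUfin.toFinset with hU
  set sm : HeightOneSpectrum (𝓞 K) → Finset (𝓞 K × (Fin n → 𝓞 K)) := fun v =>
    ((S ×ˢ A).filter (fun y => MvPolynomial.eval y.2 F ∈ v.asIdeal ∧
      (G.map (MvPolynomial.eval y.2)).eval y.1 ∈ v.asIdeal)) with hsm
  have hsub : {y : 𝓞 K × (Fin n → 𝓞 K) | hs y.1 ≤ B ∧ (∀ i, hs (y.2 i) ≤ B) ∧
        ∃ v : HeightOneSpectrum (𝓞 K), M < Ideal.absNorm v.asIdeal ∧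
          MvPolynomial.eval y.2 F ∈ v.asIdeal ∧
          (G.map (MvPolynomial.eval y.2)).eval y.1 ∈ v.asIdeal} ⊆ (large ∪ U.biUnion sm : Finset _) := by
    rintro ⟨a, y⟩ ⟨h1, h2, v, hv, h3, h4⟩
    have hmem : (a, y) ∈ S ×ˢ A := by
      simp only [Finset.mem_product, hSmem, hA, Fintype.mem_piFinset]
      exact ⟨h1, h2⟩
    rw [Finset.mem_coe, Finset.mem_union]
    by_cases hvB : B ^ d < Ideal.absNorm v.asIdeal
    · left
      exact Finset.mem_filter.mpr ⟨hmem, v, ⟨hvB, hv⟩, h3, h4⟩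
    · right
      rw [Finset.mem_biUnion]
      exact ⟨v, hUfin.mem_toFinset.mpr ⟨not_lt.mp hvB, hv⟩, Finset.mem_filter.mpr ⟨hmem, h3, h4⟩⟩
  refine ⟨(Finset.finite_toSet _).subset hsub, ?_⟩
  have hcard := Set.ncard_le_ncard hsub (Finset.finite_toSet _)
  rw [Set.ncard_coe_finset] at hcard
  have hlc : (large.card : ℝ) ≤ ε / 2 * B ^ (d * (n + 1)) := by
    have h := large_count (fun v : HeightOneSpectrum (𝓞 K) => v.asIdeal) V S LL ?_ F hF G e he c ?_ hGc (D + 1) ?_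
    · have h' : (large.card : ℝ) ≤ (F.totalDegree + (D + 1 : ℕ) * (LL * e)) * S.card ^ n := by
        exact_mod_cast h
      calc (large.card : ℝ) ≤ _ := h'
        _ ≤ (F.totalDegree + (D + 1 : ℕ) * (LL * e)) * (2 * C * B ^ d) ^ n := by gcongr
        _ = K1 * B ^ (d * n) := by rw [hK1, mul_pow, pow_mul]; ring
        _ ≤ (ε / 2 * B ^ d) * B ^ (d * n) := by
            gcongr
            rw [div_le_iff₀ hε] at hBK
            nlinarith
        _ = ε / 2 * B ^ (d * (n + 1)) := by ring
    · intro v hv r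
      have h1 := hfilter v r
      have hv1 : B ^ d < Ideal.absNorm v.asIdeal := hv.1
      apply Nat.le_floor
      refine h1.trans ?_
      have : B ^ d / Ideal.absNorm v.asIdeal ≤ 1 := by
        rw [div_le_one (by linarith)]; exact hv1.le
      nlinarith
    · intro v hv
      exact hM1 v ((le_max_left _ _).trans_lt hv.2)
    · intro y hy hy0
      have hyB : ∀ i, hs (y i) ≤ B := fun i => (hSmem _).mp (Fintype.mem_piFinset.mp hy i)
      have hpc := primes_count hy0 (by linarith) hBCF (hCFv B (by linarith) y hyB)
      have hss : {i | i ∈ V ∧ MvPolynomial.eval y F ∈ i.asIdeal} ⊆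
        {v : HeightOneSpectrum (𝓞 K) | MvPolynomial.eval y F ∈ v.asIdeal ∧
          B ^ finrank ℚ K < Ideal.absNorm v.asIdeal} := by
        rintro v ⟨hv, hv2⟩
        exact ⟨hv2, hv.1⟩
      exact ⟨hpc.1.subset hss, (Set.ncard_le_ncard hss hpc.1).trans hpc.2⟩
  have hsc : ∀ v ∈ U, ((sm v).card : ℝ) ≤ K2 * B ^ (d * (n + 1)) * (1 / (Ideal.absNorm v.asIdeal : ℝ) ^ 2) := by
    intro v hv
    obtain ⟨hvB, hvM⟩ := hUfin.mem_toFinset.mp hv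
    have hNpos : (0 : ℝ) < Ideal.absNorm v.asIdeal := by exact_mod_cast absNorm_pos v
    set N : ℝ := (Ideal.absNorm v.asIdeal : ℝ) with hN
    have hfinq : Finite (𝓞 K ⧸ v.asIdeal) := Ideal.finiteQuotientOfFreeOfNeBot _ v.ne_bot
    set L : ℕ := ⌊C * (B ^ d / N + 1)⌋₊ with hL
    have h := pair_count v.asIdeal S L (fun r => Nat.le_floor (hfilter v r)) F m
      (hM2 v (((le_max_left _ _).trans (le_max_right _ _)).trans_lt hvM)) G e he c
      (hM1 v ((le_max_left _ _).trans_lt hvM)) hGc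
    rw [natCard_quot] at h
    have h' : ((sm v).card : ℝ) * N ≤ F.totalDegree * e * N ^ n * L ^ (n + 1) := by
      rw [hN]; exact_mod_cast h
    have hLle : (L : ℝ) ≤ 2 * C * B ^ d / N := by
      refine (Nat.floor_le (by positivity)).trans ?_
      have : 1 ≤ B ^ d / N := by rw [one_le_div hNpos]; exact hvB
      have h3 : 2 * C * B ^ d / N = 2 * C * (B ^ d / N) := by ring
      rw [h3]; nlinarith
    have h4 : ((sm v).card : ℝ) * N ≤ F.totalDegree * e * N ^ n * (2 * C * B ^ d / N) ^ (n + 1) :=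
      h'.trans (by gcongr)
    have h5 : F.totalDegree * e * N ^ n * (2 * C * B ^ d / N) ^ (n + 1) =
        (K2 * B ^ (d * (n + 1)) * (1 / N ^ 2)) * N := by
      rw [hK2, div_pow, mul_pow, ← pow_mul]
      field_simp
      ring
    rw [h5] at h4
    exact le_of_mul_le_mul_right h4 hNpos
  have hsmall : ((U.biUnion sm).card : ℝ) ≤ ε / 2 * B ^ (d * (n + 1)) := by
    have h1 : ((U.biUnion sm).card : ℝ) ≤ ∑ v ∈ U, ((sm v).card : ℝ) := by
      exact_mod_cast Finset.card_biUnion_le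
    have h2 := hM3 U (fun v hv => by
      obtain ⟨hvB, hvM⟩ := hUfin.mem_toFinset.mp hv
      exact ((le_max_right _ _).trans (le_max_right _ _)).trans_lt hvM)
    calc _ ≤ _ := h1
      _ ≤ ∑ v ∈ U, K2 * B ^ (d * (n + 1)) * (1 / (Ideal.absNorm v.asIdeal : ℝ) ^ 2) := Finset.sum_le_sum hsc
      _ = K2 * B ^ (d * (n + 1)) * ∑ v ∈ U, (1 / (Ideal.absNorm v.asIdeal : ℝ) ^ 2) := by rw [Finset.mul_sum]
      _ ≤ K2 * B ^ (d * (n + 1)) * (ε / (2 * (K2 + 1))) := by gcongr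
      _ = (K2 / (K2 + 1)) * (ε / 2 * B ^ (d * (n + 1))) := by field_simp
      _ ≤ 1 * (ε / 2 * B ^ (d * (n + 1))) := by
          gcongr
          rw [div_le_one (by positivity)]; linarith
      _ = _ := one_mul _
  calc _ ≤ ((large ∪ U.biUnion sm).card : ℝ) := by exact_mod_cast hcard
    _ ≤ (large.card : ℝ) + (U.biUnion sm).card := by exact_mod_cast Finset.card_union_le _ _
    _ ≤ ε * B ^ (d * (n + 1)) := by linarith

end Eke

namespace Eke
open Module

lemma dim_le_of_integral {A B : Type*} [CommRing A] [CommRing B] (f : A →+* B)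
    (hf : Function.Injective f) (hintegral : f.IsIntegral) : ringKrullDim A ≤ ringKrullDim B := by
  letI := f.toAlgebra
  haveI : Algebra.IsIntegral A B := ⟨hintegral⟩
  unfold ringKrullDim Order.krullDim
  refine iSup_le fun l => ?_
  obtain ⟨Q, -, hQ, hQc⟩ := Ideal.exists_ideal_over_prime_of_isIntegral
    (S := B) l.head.asIdeal ⊥ (by
      intro x hx
      rw [Ideal.mem_comap] at hx
      have : f x = 0 := hx
      rw [(map_eq_zero_iff f hf).1 this]
      exact Ideal.zero_mem _)
  haveI : Q.LiesOver (RelSeries.head l).asIdeal := ⟨hQc.symm⟩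
  obtain ⟨L, hL, -⟩ := Ideal.exists_ltSeries_of_hasGoingUp l Q
  rw [← hL]
  exact le_iSup (fun p : LTSeries (PrimeSpectrum B) => (p.length : WithBot ℕ∞)) L

lemma eval2_finSucc {R T : Type*} [CommRing R] [CommRing T] [Algebra R T] {n : ℕ}
    (t0 : T) (t : Fin n → T) (p : MvPolynomial (Fin (n+1)) R) :
    Polynomial.eval₂ (MvPolynomial.aeval (R := R) t).toRingHom t0 (MvPolynomial.finSuccEquiv R n p)
      = MvPolynomial.aeval (Fin.cons t0 t : Fin (n+1) → T) p := by
  induction p using MvPolynomial.induction_on with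
  | C r =>
    rw [← MvPolynomial.algebraMap_eq, AlgEquiv.commutes]
    rw [MvPolynomial.algebraMap_eq, IsScalarTower.algebraMap_apply R (MvPolynomial (Fin n) R)]
    simp
  | add p q hp hq => simp only [map_add, Polynomial.eval₂_add, hp, hq]
  | mul_X p i hp =>
    simp only [map_mul, Polynomial.eval₂_mul, hp, MvPolynomial.aeval_X]
    congr 1
    refine Fin.cases ?_ (fun j => ?_) i
    · rw [MvPolynomial.finSuccEquiv_X_zero]; simp
    · rw [MvPolynomial.finSuccEquiv_X_succ]; simp

lemma map_inj_comap {R S : Type*} [CommRing R] [CommRing S] [Algebra R S] (M : Submonoid R)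
    [IsLocalization M S] (n : ℕ) :
    Function.Injective (PrimeSpectrum.comap
      (MvPolynomial.map (algebraMap R S) : MvPolynomial (Fin n) R →+* MvPolynomial (Fin n) S)) := by
  let _ : Algebra (MvPolynomial (Fin n) R) (MvPolynomial (Fin n) S) := MvPolynomial.algebraMvPolynomial
  exact PrimeSpectrum.localization_comap_injective (MvPolynomial (Fin n) S)
        (M.map (MvPolynomial.C (σ := Fin n)))

lemma mem_map_map {R S : Type*} [CommRing R] [CommRing S] [Algebra R S] (M : Submonoid R)
    [IsLocalization M S] {n : ℕ} (I : Ideal (MvPolynomial (Fin n) R)) (q : MvPolynomial (Fin n) R)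
    (h : MvPolynomial.map (algebraMap R S) q ∈ I.map (MvPolynomial.map (algebraMap R S))) :
    ∃ r ∈ M, MvPolynomial.C r * q ∈ I := by
  let _ : Algebra (MvPolynomial (Fin n) R) (MvPolynomial (Fin n) S) := MvPolynomial.algebraMvPolynomial
  have h1 := (IsLocalization.algebraMap_mem_map_algebraMap_iff
      (M.map (MvPolynomial.C (σ := Fin n))) (MvPolynomial (Fin n) S) I q).1 h
  obtain ⟨m, hm, hmI⟩ := h1
  obtain ⟨r, hr, rfl⟩ := hm
  exact ⟨r, hr, hmI⟩

lemma map_surj {R S : Type*} [CommRing R] [CommRing S] [Algebra R S] (M : Submonoid R)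
    [IsLocalization M S] {n : ℕ} (p : MvPolynomial (Fin n) S) :
    ∃ r ∈ M, ∃ q : MvPolynomial (Fin n) R,
      p * MvPolynomial.C (algebraMap R S r) = MvPolynomial.map (algebraMap R S) q := by
  let _ : Algebra (MvPolynomial (Fin n) R) (MvPolynomial (Fin n) S) := MvPolynomial.algebraMvPolynomial
  obtain ⟨⟨q, s⟩, hq⟩ := IsLocalization.surj (M.map (MvPolynomial.C (σ := Fin n))) p
  obtain ⟨s, r, hr, rfl⟩ := s
  refine ⟨r, hr, q, ?_⟩
  rw [← MvPolynomial.map_C]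
  exact hq

lemma elim0 {R : Type*} [CommRing R] [IsDomain R] {n : ℕ}
    (S : Type*) [CommRing S] [Algebra R S] [IsNoetherianRing S]
    (M : Submonoid R) [IsLocalization M S] (hM : (0 : R) ∉ M) (hS : ringKrullDim S = 1)
    (I : Ideal (MvPolynomial (Fin (n + 1)) R))
    (hcodim : ringKrullDim (MvPolynomial (Fin (n + 1)) R ⧸ I) ≤ (n : WithBot ℕ∞))
    (a : Fin n → R) (G : Polynomial (MvPolynomial (Fin n) R)) (e : ℕ) (he : G.natDegree ≤ e)
    (c : R) (hc : c ∈ M) (hGc : G.coeff e = MvPolynomial.C c)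
    (ψ : MvPolynomial (Fin n) R →ₐ[R] MvPolynomial (Fin (n+1)) R)
    (hψ : ψ = MvPolynomial.aeval (R := R) (fun i : Fin n =>
        (MvPolynomial.X i.succ - MvPolynomial.C (a i) * MvPolynomial.X 0 :
          MvPolynomial (Fin (n+1)) R)))
    (hG : Polynomial.eval₂ ψ.toRingHom (MvPolynomial.X 0) G ∈ I) :
    ∃ F : MvPolynomial (Fin n) R, F ≠ 0 ∧ ψ F ∈ I := by
  classical
  by_contra hno
  push Not at hno
  obtain ⟨J, hJ⟩ : ∃ J : Ideal (MvPolynomial (Fin (n+1)) S),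
    J = I.map (MvPolynomial.map (algebraMap R S)) := ⟨_, rfl⟩
  obtain ⟨ψ', hψ'⟩ : ∃ ψ' : MvPolynomial (Fin n) S →ₐ[S] MvPolynomial (Fin (n+1)) S,
    ψ' = MvPolynomial.aeval (R := S) (fun i : Fin n =>
        (MvPolynomial.X i.succ - MvPolynomial.C (algebraMap R S (a i)) * MvPolynomial.X 0 :
          MvPolynomial (Fin (n+1)) S)) := ⟨_, rfl⟩
  have hcomm : ∀ p, ψ' (MvPolynomial.map (algebraMap R S) p)
      = MvPolynomial.map (algebraMap R S) (ψ p) := by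
    intro p
    induction p using MvPolynomial.induction_on with
    | C r => simp [hψ, hψ']
    | add p q hp hq => simp only [map_add, hp, hq]
    | mul_X p i hp =>
      rw [map_mul, map_mul, map_mul, map_mul, hp]
      congr 1
      simp [hψ, hψ']
  obtain ⟨φ, hφ⟩ : ∃ φ : MvPolynomial (Fin n) S →+* MvPolynomial (Fin (n+1)) S ⧸ J,
      φ = (Ideal.Quotient.mk J).comp ψ'.toRingHom := ⟨_, rfl⟩
  have hφ : ∀ p, φ p = Ideal.Quotient.mk J (ψ' p) := fun p => by rw [hφ]; rfl
  have hdimA : ringKrullDim (MvPolynomial (Fin n) S) = 1 + n := by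
    rw [MvPolynomial.ringKrullDim_of_isNoetherianRing, hS]
    simp
  have hinj : Function.Injective φ := by
    rw [injective_iff_map_eq_zero]
    intro p hp
    obtain ⟨r', hr', q, hq⟩ := map_surj M p
    have h1 : φ (MvPolynomial.map (algebraMap R S) q) = 0 := by
      rw [← hq, map_mul, hp, zero_mul]
    rw [hφ, hcomm, Ideal.Quotient.eq_zero_iff_mem, hJ] at h1
    obtain ⟨r, hr, hmI⟩ := mem_map_map M I _ h1
    have h2 : ψ (MvPolynomial.C r * q) ∈ I := by
      rw [map_mul]
      simpa [hψ] using hmI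
    have h3 : MvPolynomial.C r * q = 0 := by
      by_contra h
      exact hno _ h h2
    have hr0 : r ≠ 0 := by
      rintro rfl
      exact hM hr
    have hq0 : q = 0 := by
      rcases mul_eq_zero.1 h3 with h | h
      · exact absurd (by simpa using h) hr0
      · exact h
    rw [hq0, map_zero] at hq
    have : IsUnit (MvPolynomial.C (σ := Fin n) (algebraMap R S r')) :=
      (IsLocalization.map_units S (⟨r', hr'⟩ : M)).map MvPolynomial.C
    exact (this.mul_left_eq_zero).1 hq
  have hx0 : φ.IsIntegralElem (Ideal.Quotient.mk J (MvPolynomial.X 0)) := by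
    have hcu : IsUnit (algebraMap R S c) := IsLocalization.map_units S (⟨c, hc⟩ : M)
    obtain ⟨u, hu⟩ := hcu
    have hdeg : (Polynomial.C (MvPolynomial.C (↑u⁻¹ : S)) *
        G.map (MvPolynomial.map (algebraMap R S))).natDegree ≤ e :=
      (Polynomial.natDegree_C_mul_le _ _).trans (Polynomial.natDegree_map_le.trans he)
    have hco : (Polynomial.C (MvPolynomial.C (↑u⁻¹ : S)) *
        G.map (MvPolynomial.map (algebraMap R S))).coeff e = 1 := by
      simp only [Polynomial.coeff_C_mul, Polynomial.coeff_map, hGc]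
      rw [MvPolynomial.map_C, ← map_mul, ← hu]
      simp
    refine ⟨_, Polynomial.monic_of_natDegree_le_of_coeff_eq_one e hdeg hco, ?_⟩
    have h4 : (φ.comp (MvPolynomial.map (algebraMap R S))) =
        ((Ideal.Quotient.mk J).comp (MvPolynomial.map (algebraMap R S))).comp ψ.toRingHom := by
      refine RingHom.ext fun p => ?_
      simp only [RingHom.comp_apply, hφ, hcomm]
      rfl
    have h5 : Ideal.Quotient.mk J (MvPolynomial.X 0) = ((Ideal.Quotient.mk J).comp
      (MvPolynomial.map (algebraMap R S))) (MvPolynomial.X 0) := by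
      simp
    have h6 : Polynomial.eval₂ φ (Ideal.Quotient.mk J (MvPolynomial.X 0))
        (G.map (MvPolynomial.map (algebraMap R S))) = 0 := by
      rw [Polynomial.eval₂_map, h4, h5, ← Polynomial.hom_eval₂, RingHom.comp_apply,
        Ideal.Quotient.eq_zero_iff_mem, hJ]
      exact Ideal.mem_map_of_mem _ hG
    rw [Polynomial.eval₂_mul, h6, mul_zero]
  have hC : ∀ s : S, φ.IsIntegralElem (Ideal.Quotient.mk J (MvPolynomial.C s)) := by
    intro s
    have : Ideal.Quotient.mk J (MvPolynomial.C s) = φ (MvPolynomial.C s) := by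
      rw [hφ, hψ', MvPolynomial.aeval_C]; rfl
    rw [this]
    exact RingHom.isIntegralElem_map _
  have hintegral : φ.IsIntegral := by
    intro y
    obtain ⟨y, rfl⟩ := Ideal.Quotient.mk_surjective y
    induction y using MvPolynomial.induction_on with
    | C r => exact hC r
    | add p q hp hq =>
      rw [map_add]; exact hp.add φ hq
    | mul_X p i hp =>
      rw [map_mul]
      refine hp.mul φ ?_
      refine Fin.cases hx0 (fun j => ?_) i
      have : Ideal.Quotient.mk J (MvPolynomial.X j.succ) = φ (MvPolynomial.X j) +
          Ideal.Quotient.mk J (MvPolynomial.C (algebraMap R S (a j))) *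
            Ideal.Quotient.mk J (MvPolynomial.X 0) := by
        rw [hφ, ← map_mul, ← map_add]
        simp [hψ']
      rw [this]
      exact RingHom.IsIntegralElem.add φ (RingHom.isIntegralElem_map _)
        (RingHom.IsIntegralElem.mul φ (hC _) hx0)
  have hle1 := dim_le_of_integral φ hinj hintegral
  obtain ⟨θ, hθ'⟩ : ∃ θ : (MvPolynomial (Fin (n + 1)) R ⧸ I) →+* MvPolynomial (Fin (n+1)) S ⧸ J,
    θ.comp (Ideal.Quotient.mk I) = (Ideal.Quotient.mk J).comp (MvPolynomial.map (algebraMap R S)) :=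
    ⟨Ideal.quotientMap J (MvPolynomial.map (algebraMap R S)) (by rw [hJ]; exact Ideal.le_comap_map),
      RingHom.ext fun p => rfl⟩
  have hθ : Function.Injective (PrimeSpectrum.comap θ) := by
    have h7 : Function.Injective (PrimeSpectrum.comap (θ.comp (Ideal.Quotient.mk I))) := by
      rw [hθ', PrimeSpectrum.comap_comp]
      exact (map_inj_comap M (n+1)).comp
        (PrimeSpectrum.comap_injective_of_surjective _ Ideal.Quotient.mk_surjective)
    rw [PrimeSpectrum.comap_comp] at h7
    exact Function.Injective.of_comp h7
  have hle2 : ringKrullDim (MvPolynomial (Fin (n+1)) S ⧸ J)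
      ≤ ringKrullDim (MvPolynomial (Fin (n + 1)) R ⧸ I) := by
    refine Order.krullDim_le_of_strictMono (PrimeSpectrum.comap θ) ?_
    refine Monotone.strictMono_of_injective ?_ hθ
    intro p q hpq
    exact Ideal.comap_mono hpq
  have := hle1.trans (hle2.trans hcodim)
  rw [hdimA] at this
  have h8 : ((1 + n : ℕ) : WithBot ℕ∞) ≤ (n : ℕ) := by push_cast; exact this
  have h9 : 1 + n ≤ n := by exact_mod_cast h8
  omega

lemma elim {R : Type*} [CommRing R] [IsDedekindDomain R] {n : ℕ} (P : Ideal R) [hP : P.IsPrime]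
    (hP0 : P ≠ ⊥) (I : Ideal (MvPolynomial (Fin (n + 1)) R))
    (hcodim : ringKrullDim (MvPolynomial (Fin (n + 1)) R ⧸ I) ≤ (n : WithBot ℕ∞))
    (a : Fin n → R) (G : Polynomial (MvPolynomial (Fin n) R)) (e : ℕ) (he : G.natDegree ≤ e)
    (c : R) (hc : c ∉ P) (hGc : G.coeff e = MvPolynomial.C c)
    (ψ : MvPolynomial (Fin n) R →ₐ[R] MvPolynomial (Fin (n+1)) R)
    (hψ : ψ = MvPolynomial.aeval (R := R) (fun i : Fin n =>
        (MvPolynomial.X i.succ - MvPolynomial.C (a i) * MvPolynomial.X 0 :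
          MvPolynomial (Fin (n+1)) R)))
    (hG : Polynomial.eval₂ ψ.toRingHom (MvPolynomial.X 0) G ∈ I) :
    ∃ F : MvPolynomial (Fin n) R, F ≠ 0 ∧ ψ F ∈ I := by
  have : IsDiscreteValuationRing (Localization.AtPrime P) :=
    IsLocalization.AtPrime.isDiscreteValuationRing_of_dedekind_domain R hP0 _
  exact elim0 (Localization.AtPrime P) P.primeCompl (fun h => h (Ideal.zero_mem _))
    (IsDiscreteValuationRing.ringKrullDim_eq_one _) I hcodim a G e he c hc hGc ψ hψ hG

end Eke

namespace Eke
open Module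
variable {K : Type*} [Field K] [NumberField K]

lemma exists_prime_not_mem (c : 𝓞 K) (hc : c ≠ 0) :
    ∃ P : Ideal (𝓞 K), P.IsPrime ∧ P ≠ ⊥ ∧ c ∉ P := by
  set N := Ideal.absNorm (Ideal.span {c}) with hN
  have hN0 : N ≠ 0 := by
    rw [hN, Ne, Ideal.absNorm_eq_zero_iff]
    simpa using hc
  obtain ⟨p, hp1, hp⟩ := Nat.exists_infinite_primes (N + 1)
  have hcop : Nat.Coprime p N := by
    rw [hp.coprime_iff_not_dvd]
    intro h
    have := Nat.le_of_dvd (Nat.pos_of_ne_zero hN0) h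
    omega
  have hnu : ¬ IsUnit ((p : ℤ) : 𝓞 K) := by
    intro h
    have h1 : IsUnit (Algebra.norm ℤ ((p : ℤ) : 𝓞 K)) := h.map _
    have h2 : ((p : ℤ) : 𝓞 K) = algebraMap ℤ (𝓞 K) p := by simp
    rw [h2, Algebra.norm_algebraMap] at h1
    rw [isUnit_pow_iff (Module.finrank_pos).ne'] at h1
    have := Int.isUnit_iff.1 h1
    have := hp.two_le
    omega
  obtain ⟨P, hPm, hP⟩ := exists_max_ideal_of_mem_nonunits hnu
  refine ⟨P, hPm.isPrime, ?_, ?_⟩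
  · rintro rfl
    have : ((p : ℤ) : 𝓞 K) = 0 := by simpa using hP
    have := hp.ne_zero
    simp_all
  · intro hcP
    have hNP : ((N : ℕ) : 𝓞 K) ∈ P := by
      have := Ideal.absNorm_mem (Ideal.span {c})
      exact (Ideal.span_singleton_le_iff_mem P).2 hcP this
    have h3 := Nat.isCoprime_iff_coprime.2 hcop
    obtain ⟨u, w, huw⟩ := h3
    have : (1 : 𝓞 K) ∈ P := by
      have h4 : (1 : 𝓞 K) = (u : 𝓞 K) * ((p : ℤ) : 𝓞 K) + (w : 𝓞 K) * (N : 𝓞 K) := by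
        have := congrArg (Int.cast : ℤ → 𝓞 K) huw
        push_cast at this ⊢
        exact this.symm
      rw [h4]
      exact P.add_mem (P.mul_mem_left _ hP) (P.mul_mem_left _ hNP)
    exact hPm.ne_top ((Ideal.eq_top_iff_one _).2 this)

lemma exists_dehom {n e : ℕ} (g : MvPolynomial (Fin (n+1)) (𝓞 K)) (hg : g ≠ 0)
    (hh : g.IsHomogeneous e) :
    ∃ a : Fin n → 𝓞 K, MvPolynomial.eval (Fin.cons 1 a : Fin (n+1) → 𝓞 K) g ≠ 0 := by
  by_contra hno
  push Not at hno
  have h1 : ((MvPolynomial.finSuccEquiv (𝓞 K) n g).eval 1) = 0 := by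
    apply MvPolynomial.funext
    intro a
    have := hno a
    rw [MvPolynomial.eval_eq_eval_mv_eval'] at this
    rw [map_zero, ← this, Polynomial.eval_map, Polynomial.eval₂_at_one]
  have h2 : ∀ i, (MvPolynomial.finSuccEquiv (𝓞 K) n g).coeff i = 0 := by
    intro i
    refine MvPolynomial.ext _ _ fun m => ?_
    by_contra hne
    rw [MvPolynomial.finSuccEquiv_coeff_coeff, MvPolynomial.coeff_zero] at hne
    have hcoef := congrArg (MvPolynomial.coeff m) h1
    rw [Polynomial.eval_eq_sum_range] at hcoef
    simp only [one_pow, mul_one, MvPolynomial.coeff_sum, MvPolynomial.coeff_zero,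
      MvPolynomial.finSuccEquiv_coeff_coeff] at hcoef
    have hdeg : ∀ j, MvPolynomial.coeff (Finsupp.cons j m) g ≠ 0 → j + m.degree = e := by
      intro j hj
      have := hh hj
      have e2 : Finsupp.weight (1 : Fin (n+1) → ℕ) (Finsupp.cons j m)
          = (Finsupp.cons j m).degree := by
        rw [Finsupp.degree_eq_weight_one]; rfl
      rw [← this, e2]
      simp [Finsupp.degree_eq_sum, Fin.sum_univ_succ]
    have hi := hdeg i hne
    rw [Finset.sum_eq_single i] at hcoef
    · exact hne hcoef
    · intro j _ hji
      by_contra h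
      have := hdeg j h
      omega
    · intro hi'
      rw [Finset.mem_range, not_lt] at hi'
      rw [← MvPolynomial.finSuccEquiv_coeff_coeff,
        Polynomial.coeff_eq_zero_of_natDegree_lt (by omega), MvPolynomial.coeff_zero]
  apply hg
  have : MvPolynomial.finSuccEquiv (𝓞 K) n g = 0 := Polynomial.ext (by simpa using h2)
  simpa using this

lemma subst_inv {R : Type*} [CommRing R] {n : ℕ} (a : Fin n → R) (p : MvPolynomial (Fin (n+1)) R) :
    MvPolynomial.aeval (R := R) (Fin.cons (MvPolynomial.X 0) (fun i : Fin n =>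
        (MvPolynomial.X i.succ - MvPolynomial.C (a i) * MvPolynomial.X 0 :
          MvPolynomial (Fin (n+1)) R)) : Fin (n+1) → MvPolynomial (Fin (n+1)) R)
      (MvPolynomial.aeval (R := R) (Fin.cons (MvPolynomial.X 0)
        (fun i : Fin n => (MvPolynomial.X i.succ + MvPolynomial.C (a i) * MvPolynomial.X 0 :
          MvPolynomial (Fin (n+1)) R)) : Fin (n+1) → MvPolynomial (Fin (n+1)) R) p) = p := by
  induction p using MvPolynomial.induction_on with
  | C r => simp only [MvPolynomial.aeval_C, MvPolynomial.algebraMap_eq]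
  | add p q hp hq => simp only [map_add, hp, hq]
  | mul_X p i hp =>
    rw [map_mul, map_mul, hp]
    congr 1
    refine Fin.cases ?_ (fun j => ?_) i
    · simp only [MvPolynomial.aeval_X, Fin.cons_zero]
    · simp only [MvPolynomial.aeval_X, Fin.cons_succ, map_add, map_mul, MvPolynomial.aeval_C,
        MvPolynomial.algebraMap_eq, Fin.cons_zero]
      ring

theorem algebra_step {n : ℕ} (I : Ideal (MvPolynomial (Fin (n + 1)) (𝓞 K)))
    (hIhom : ∀ f ∈ I, ∀ m : ℕ, MvPolynomial.homogeneousComponent m f ∈ I)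
    (hcodim : ringKrullDim (MvPolynomial (Fin (n + 1)) (𝓞 K) ⧸ I) ≤ (n : WithBot ℕ∞)) :
    ∃ (a : Fin n → 𝓞 K) (F : MvPolynomial (Fin n) (𝓞 K))
      (G : Polynomial (MvPolynomial (Fin n) (𝓞 K))) (e : ℕ) (c : 𝓞 K),
      F ≠ 0 ∧ G.natDegree ≤ e ∧ c ≠ 0 ∧ G.coeff e = MvPolynomial.C c ∧
      MvPolynomial.aeval (R := 𝓞 K) (fun i : Fin n =>
        (MvPolynomial.X i.succ - MvPolynomial.C (a i) * MvPolynomial.X 0 :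
          MvPolynomial (Fin (n+1)) (𝓞 K))) F ∈ I ∧
      Polynomial.eval₂ (MvPolynomial.aeval (R := 𝓞 K) (fun i : Fin n =>
        (MvPolynomial.X i.succ - MvPolynomial.C (a i) * MvPolynomial.X 0 :
          MvPolynomial (Fin (n+1)) (𝓞 K)))).toRingHom (MvPolynomial.X 0) G ∈ I := by
  have hI : I ≠ ⊥ := by
    rintro rfl
    have h1 : ringKrullDim (MvPolynomial (Fin (n + 1)) (𝓞 K)) ≤ (n : WithBot ℕ∞) := by
      rw [← ringKrullDim_eq_of_ringEquiv (RingEquiv.quotientBot _)]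
      exact hcodim
    rw [MvPolynomial.ringKrullDim_of_isNoetherianRing] at h1
    have h2 : (0 : WithBot ℕ∞) ≤ ringKrullDim (𝓞 K) := ringKrullDim_nonneg_of_nontrivial
    have h3 : ((n + 1 : ℕ) : WithBot ℕ∞) ≤ (n : ℕ) := by
      refine le_trans ?_ h1
      have := add_le_add_left h2 ((n + 1 : ℕ) : WithBot ℕ∞)
      simpa using this
    have h4 : n + 1 ≤ n := by exact_mod_cast h3
    omega
  obtain ⟨g0, hg0I, hg0⟩ := Submodule.exists_mem_ne_zero_of_ne_bot hI
  obtain ⟨e, he⟩ : ∃ e, MvPolynomial.homogeneousComponent e g0 ≠ 0 := by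
    by_contra h
    push Not at h
    apply hg0
    rw [← MvPolynomial.sum_homogeneousComponent g0]
    exact Finset.sum_eq_zero fun i _ => h i
  set g := MvPolynomial.homogeneousComponent e g0 with hg
  have hgI : g ∈ I := hIhom _ hg0I e
  have hgh : g.IsHomogeneous e := MvPolynomial.homogeneousComponent_isHomogeneous _ _
  obtain ⟨a, ha⟩ := exists_dehom g he hgh
  set s : Fin (n+1) → MvPolynomial (Fin (n+1)) (𝓞 K) := Fin.cons (MvPolynomial.X 0)
    (fun i => MvPolynomial.X i.succ + MvPolynomial.C (a i) * MvPolynomial.X 0) with hs'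
  set g' := MvPolynomial.aeval s g with hg'
  have hsh : ∀ i, (s i).IsHomogeneous 1 := by
    intro i
    refine Fin.cases ?_ (fun j => ?_) i
    · simpa [hs'] using MvPolynomial.isHomogeneous_X _ _
    · simp only [hs', Fin.cons_succ]
      refine (MvPolynomial.isHomogeneous_X _ _).add ?_
      have := (MvPolynomial.isHomogeneous_C (Fin (n+1)) (a j)).mul (MvPolynomial.isHomogeneous_X (𝓞 K) (0 : Fin (n+1)))
      simpa using this
  have hg'h : g'.IsHomogeneous e := by
    have := hgh.aeval s hsh
    rwa [one_mul] at this
  set G := MvPolynomial.finSuccEquiv (𝓞 K) n g' with hG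
  have hGdeg : G.natDegree ≤ e := by
    rw [hG, MvPolynomial.natDegree_finSuccEquiv]
    exact (MvPolynomial.degreeOf_le_totalDegree _ _).trans hg'h.totalDegree_le
  have hco := MvPolynomial.IsHomogeneous.finSuccEquiv_coeff_isHomogeneous hg'h e 0 (by simp)
  have hco1 : G.coeff e = MvPolynomial.C (MvPolynomial.coeff 0 (G.coeff e)) := by
    rw [← MvPolynomial.totalDegree_eq_zero_iff_eq_C]
    exact Nat.le_zero.1 hco.totalDegree_le
  have hval : MvPolynomial.coeff 0 (G.coeff e) = MvPolynomial.eval (Fin.cons 1 a : Fin (n+1) → 𝓞 K) g := by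
    have e1 : MvPolynomial.eval (Fin.cons 1 0 : Fin (n+1) → 𝓞 K) g' =
        MvPolynomial.eval (Fin.cons 1 a : Fin (n+1) → 𝓞 K) g := by
      have : ∀ p, MvPolynomial.eval (Fin.cons 1 0 : Fin (n+1) → 𝓞 K) (MvPolynomial.aeval s p) =
        MvPolynomial.eval (Fin.cons 1 a : Fin (n+1) → 𝓞 K) p := by
        intro p
        induction p using MvPolynomial.induction_on with
        | C r => simp
        | add p q hp hq => simp only [map_add, hp, hq]
        | mul_X p i hp =>
          rw [map_mul, map_mul, map_mul, hp]
          congr 1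
          refine Fin.cases ?_ (fun j => ?_) i <;> simp [hs']
      exact this g
    rw [← e1, MvPolynomial.eval_eq_eval_mv_eval', Polynomial.eval_map, Polynomial.eval₂_at_one,
      ← hG, Polynomial.eval_eq_sum_range' (Nat.lt_succ_of_le hGdeg), map_sum,
      Finset.sum_range_succ, Finset.sum_eq_zero, zero_add]
    · simp [MvPolynomial.constantCoeff_eq]
    · intro i hi
      rw [Finset.mem_range] at hi
      have hh := MvPolynomial.IsHomogeneous.finSuccEquiv_coeff_isHomogeneous hg'h i (e - i) (by omega)
      rw [one_pow, mul_one]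
      have : MvPolynomial.coeff 0 (G.coeff i) = 0 := by
        apply hh.coeff_eq_zero
        simp; omega
      rw [← MvPolynomial.constantCoeff_eq] at this
      rw [← this, ← MvPolynomial.eval_zero']
      rfl
  set c := MvPolynomial.eval (Fin.cons 1 a : Fin (n+1) → 𝓞 K) g with hc
  rw [hval] at hco1
  have hGI : Polynomial.eval₂ (MvPolynomial.aeval (R := 𝓞 K) (fun i : Fin n =>
        (MvPolynomial.X i.succ - MvPolynomial.C (a i) * MvPolynomial.X 0 :
          MvPolynomial (Fin (n+1)) (𝓞 K)))).toRingHom (MvPolynomial.X 0) G ∈ I := by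
    rw [hG, eval2_finSucc]
    rw [hg', hs', subst_inv]
    exact hgI
  obtain ⟨P, hP, hP0, hcP⟩ := exists_prime_not_mem c ha
  obtain ⟨F, hF, hFI⟩ := elim P hP0 I hcodim a G e hGdeg c hcP hco1 _ rfl hGI
  exact ⟨a, F, G, e, c, hF, hGdeg, ha, hco1, hFI, hGI⟩

end Eke

namespace Eke
open Module
variable {K : Type*} [Field K] [NumberField K]

lemma unit_iff (v : HeightOneSpectrum (𝓞 K)) (x : 𝓞 K) :
    IsUnit (algebraMap (𝓞 K) (v.adicCompletionIntegers K) x) ↔ x ∉ v.asIdeal := by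
  rw [← HeightOneSpectrum.valuation_eq_one_iff_notMem (K := K) v,
    ← HeightOneSpectrum.valuedAdicCompletion_eq_valuation' v (algebraMap (𝓞 K) K x)]
  exact (Valuation.integer.integers (Valued.v (R := v.adicCompletion K))).isUnit_iff_valuation_eq_one

lemma alg_mem (v : HeightOneSpectrum (𝓞 K)) (x : 𝓞 K)
    (h : algebraMap (𝓞 K) (v.adicCompletionIntegers K) x ∈
      Ideal.map (algebraMap (𝓞 K) (v.adicCompletionIntegers K)) v.asIdeal) : x ∈ v.asIdeal := by
  by_contra hx
  have hu := (unit_iff v x).2 hx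
  have hle : Ideal.map (algebraMap (𝓞 K) (v.adicCompletionIntegers K)) v.asIdeal ≤
      IsLocalRing.maximalIdeal (v.adicCompletionIntegers K) := by
    rw [Ideal.map_le_iff_le_comap]
    intro y hy
    rw [Ideal.mem_comap, IsLocalRing.mem_maximalIdeal]
    intro hyu
    exact (unit_iff v y).1 hyu hy
  exact (IsLocalRing.mem_maximalIdeal _).1 (hle h) hu

lemma local_bad {n : ℕ} (I : Ideal (MvPolynomial (Fin (n + 1)) (𝓞 K)))
    (hIhom : ∀ f ∈ I, ∀ m : ℕ, MvPolynomial.homogeneousComponent m f ∈ I)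
    (v : HeightOneSpectrum (𝓞 K)) (x : Fin (n+1) → 𝓞 K) (u : 𝓞 K) (hu : u ≠ 0)
    (w : Fin (n+1) → 𝓞 K) (hxw : ∀ i, x i = u * w i)
    (hx : (fun i => algebraMap (𝓞 K) (v.adicCompletion K) (x i)) ∉
     {y : Fin (n + 1) → v.adicCompletion K |
      ∃ (c : (v.adicCompletion K)ˣ) (z : Fin (n + 1) → v.adicCompletionIntegers K),
        (∃ i, IsUnit (z i)) ∧ (∀ i, y i = (c : v.adicCompletion K) * (z i : v.adicCompletion K)) ∧
        ∃ f ∈ I, (∃ m : ℕ, f.IsHomogeneous m) ∧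
          MvPolynomial.aeval z f ∉
            Ideal.map (algebraMap (𝓞 K) (v.adicCompletionIntegers K)) v.asIdeal}) :
    (∀ i, w i ∈ v.asIdeal) ∨ ∀ f ∈ I, MvPolynomial.eval w f ∈ v.asIdeal := by
  by_contra hno
  push Not at hno
  obtain ⟨⟨i, hi⟩, f, hfI, hf⟩ := hno
  obtain ⟨m, hm⟩ : ∃ m, MvPolynomial.eval w (MvPolynomial.homogeneousComponent m f) ∉ v.asIdeal := by
    by_contra h
    push Not at h
    apply hf
    rw [← MvPolynomial.sum_homogeneousComponent f, map_sum]
    exact Ideal.sum_mem _ fun j _ => h j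
  apply hx
  have hu' : algebraMap (𝓞 K) (v.adicCompletion K) u ≠ 0 := by
    rw [Ne, FaithfulSMul.algebraMap_eq_zero_iff]
    exact hu
  refine ⟨Units.mk0 _ hu', fun i => algebraMap (𝓞 K) (v.adicCompletionIntegers K) (w i),
    ⟨i, (unit_iff v _).2 hi⟩, fun j => ?_, MvPolynomial.homogeneousComponent m f,
    hIhom f hfI m, ⟨m, MvPolynomial.homogeneousComponent_isHomogeneous _ _⟩, ?_⟩
  · simp only [hxw, map_mul, Units.val_mk0]
    rfl
  · intro h
    apply hm
    apply alg_mem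
    convert h using 1
    have : (fun i => algebraMap (𝓞 K) (v.adicCompletionIntegers K) (w i)) =
      (algebraMap (𝓞 K) (v.adicCompletionIntegers K)) ∘ w := rfl
    rw [this, MvPolynomial.aeval_algebraMap_apply]
    rfl

lemma hs_le_norm (ι : 𝓞 K →ₗ[ℤ] (Fin (finrank ℚ K) → ℝ))
    (hspan : Submodule.span ℝ (Set.range ι) = ⊤) :
    ∃ C : ℝ, 0 < C ∧ ∀ x, hs x ≤ C * ‖ι x‖ := by
  obtain ⟨C, hC, h⟩ := hs_le_repr (K := K)
  have hexp : ∀ x, ι x = ∑ j, (((bas K).repr x j : ℤ) : ℝ) • ι (bas K j) := by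
    intro x
    conv_lhs => rw [← (bas K).sum_repr x]
    rw [map_sum]
    refine Finset.sum_congr rfl fun j _ => ?_
    rw [map_smul]
    ext k
    simp
  have htop : ⊤ ≤ Submodule.span ℝ (Set.range fun j => ι (bas K j)) := by
    rw [← hspan, Submodule.span_le]
    rintro _ ⟨x, rfl⟩
    rw [hexp]
    exact Submodule.sum_mem _ fun j _ => Submodule.smul_mem _ _ (Submodule.subset_span ⟨j, rfl⟩)
  let b := basisOfTopLeSpanOfCardEqFinrank (fun j => ι (bas K j)) htop (by simp)
  have hb : ∀ j, b j = ι (bas K j) := fun j => by simp [b]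
  have hrepr : ∀ x j, b.equivFun (ι x) j = (((bas K).repr x j : ℤ) : ℝ) := by
    intro x j
    have : b.equivFun (ι x) = fun j => (((bas K).repr x j : ℤ) : ℝ) := by
      rw [← LinearEquiv.eq_symm_apply, Basis.equivFun_symm_apply, hexp]
      simp only [hb]
    rw [this]
  let L := LinearMap.toContinuousLinearMap (b.equivFun : (Fin (finrank ℚ K) → ℝ) →ₗ[ℝ] (Fin (finrank ℚ K) → ℝ))
  refine ⟨C * (‖L‖ + 1), by positivity, fun x => ?_⟩
  rw [mul_assoc]
  apply h
  intro j
  rw [← hrepr]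
  have h1 : ‖L (ι x)‖ ≤ ‖L‖ * ‖ι x‖ := L.le_opNorm _
  have h2 : |b.equivFun (ι x) j| ≤ ‖L (ι x)‖ := norm_le_pi_norm (L (ι x)) j
  nlinarith [norm_nonneg (ι x)]

lemma count_one {n : ℕ} (a : Fin n → 𝓞 K) (F : MvPolynomial (Fin n) (𝓞 K)) (hF : F ≠ 0)
    (G : Polynomial (MvPolynomial (Fin n) (𝓞 K))) (e : ℕ) (he : G.natDegree ≤ e) (c : 𝓞 K)
    (hc : c ≠ 0) (hGc : G.coeff e = MvPolynomial.C c) (C : ℝ) (hC : 0 < C) (ε : ℝ) (hε : 0 < ε) :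
    ∃ (M : ℕ) (B0 : ℝ), ∀ B, B0 ≤ B →
      {x : Fin (n+1) → 𝓞 K | (∀ i, hs (x i) ≤ C * B) ∧ ∃ v : HeightOneSpectrum (𝓞 K),
        M < Ideal.absNorm v.asIdeal ∧
        MvPolynomial.eval (fun i : Fin n => x i.succ - a i * x 0) F ∈ v.asIdeal ∧
        (G.map (MvPolynomial.eval (fun i : Fin n => x i.succ - a i * x 0))).eval (x 0) ∈ v.asIdeal}.Finite ∧
      ({x : Fin (n+1) → 𝓞 K | (∀ i, hs (x i) ≤ C * B) ∧ ∃ v : HeightOneSpectrum (𝓞 K),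
        M < Ideal.absNorm v.asIdeal ∧
        MvPolynomial.eval (fun i : Fin n => x i.succ - a i * x 0) F ∈ v.asIdeal ∧
        (G.map (MvPolynomial.eval (fun i : Fin n => x i.succ - a i * x 0))).eval (x 0) ∈ v.asIdeal}.ncard
        : ℝ) ≤ ε * B ^ (finrank ℚ K * (n+1)) := by
  obtain ⟨A, hA0, hA⟩ : ∃ A : ℝ, 0 ≤ A ∧ ∀ i, hs (a i) ≤ A :=
    ⟨∑ i, hs (a i), Finset.sum_nonneg fun i _ => hs_nonneg _, fun i =>
      Finset.single_le_sum (f := fun i => hs (a i)) (fun i _ => hs_nonneg _) (Finset.mem_univ i)⟩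
  set C' := (1 + A) * C with hC'
  have hC'0 : 0 < C' := by positivity
  obtain ⟨M, B0, hM⟩ := core F hF G e he c hc hGc (ε / C' ^ (finrank ℚ K * (n+1))) (by positivity)
  refine ⟨M, max 0 (B0 / C'), fun B hB => ?_⟩
  have hB0 : 0 ≤ B := (le_max_left _ _).trans hB
  obtain ⟨hfin, hcard⟩ := hM (C' * B) (by
    have := (le_max_right _ _).trans hB
    rw [div_le_iff₀ hC'0] at this
    linarith)
  rw [mul_pow C' B, ← mul_assoc, div_mul_cancel₀ _ (by positivity)] at hcard
  let τ : (Fin (n+1) → 𝓞 K) → 𝓞 K × (Fin n → 𝓞 K) := fun x => (x 0, fun i => x i.succ - a i * x 0)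
  have hτ : Function.Injective τ := by
    intro x y hxy
    simp only [τ, Prod.mk.injEq] at hxy
    obtain ⟨h0, h1⟩ := hxy
    funext i
    refine Fin.cases h0 (fun j => ?_) i
    have := congrFun h1 j
    simp only [h0] at this
    exact sub_left_injective this
  have hCB : C * B ≤ C' * B := by
    rw [hC']
    have : 0 ≤ A * (C * B) := by positivity
    linarith
  have hmaps : ∀ x ∈ {x : Fin (n+1) → 𝓞 K | (∀ i, hs (x i) ≤ C * B) ∧ ∃ v : HeightOneSpectrum (𝓞 K),
        M < Ideal.absNorm v.asIdeal ∧
        MvPolynomial.eval (fun i : Fin n => x i.succ - a i * x 0) F ∈ v.asIdeal ∧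
        (G.map (MvPolynomial.eval (fun i : Fin n => x i.succ - a i * x 0))).eval (x 0) ∈ v.asIdeal},
      τ x ∈ {y : 𝓞 K × (Fin n → 𝓞 K) | hs y.1 ≤ C' * B ∧ (∀ i, hs (y.2 i) ≤ C' * B) ∧
        ∃ v : HeightOneSpectrum (𝓞 K), M < Ideal.absNorm v.asIdeal ∧
          MvPolynomial.eval y.2 F ∈ v.asIdeal ∧
          (G.map (MvPolynomial.eval y.2)).eval y.1 ∈ v.asIdeal} := by
    intro x hx
    refine ⟨(hx.1 0).trans hCB, fun i => ?_, hx.2⟩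
    calc hs (x i.succ - a i * x 0) ≤ hs (x i.succ) + hs (a i * x 0) := hs_sub _ _
      _ ≤ C * B + A * (C * B) := by
        refine add_le_add (hx.1 _) ((hs_mul _ _).trans ?_)
        exact mul_le_mul (hA i) (hx.1 0) (hs_nonneg _) hA0
      _ = C' * B := by rw [hC']; ring
  refine ⟨Set.Finite.of_finite_image (hfin.subset (Set.image_subset_iff.2 hmaps)) hτ.injOn, ?_⟩
  refine le_trans ?_ hcard
  exact_mod_cast Set.ncard_le_ncard_of_injOn τ hmaps hτ.injOn hfin

lemma eval_step {n : ℕ} (a : Fin n → 𝓞 K) (x : Fin (n+1) → 𝓞 K) (F : MvPolynomial (Fin n) (𝓞 K)) :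
    MvPolynomial.eval x (MvPolynomial.aeval (R := 𝓞 K) (fun i : Fin n =>
        (MvPolynomial.X i.succ - MvPolynomial.C (a i) * MvPolynomial.X 0 :
          MvPolynomial (Fin (n+1)) (𝓞 K))) F)
      = MvPolynomial.eval (fun i : Fin n => x i.succ - a i * x 0) F := by
  induction F using MvPolynomial.induction_on with
  | C r => simp
  | add p q hp hq => simp only [map_add, hp, hq]
  | mul_X p i hp =>
    rw [map_mul, map_mul, map_mul, hp]
    simp

lemma eval_step2 {n : ℕ} (a : Fin n → 𝓞 K) (x : Fin (n+1) → 𝓞 K)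
    (G : Polynomial (MvPolynomial (Fin n) (𝓞 K))) :
    MvPolynomial.eval x (Polynomial.eval₂ (MvPolynomial.aeval (R := 𝓞 K) (fun i : Fin n =>
        (MvPolynomial.X i.succ - MvPolynomial.C (a i) * MvPolynomial.X 0 :
          MvPolynomial (Fin (n+1)) (𝓞 K)))).toRingHom (MvPolynomial.X 0) G)
      = (G.map (MvPolynomial.eval (fun i : Fin n => x i.succ - a i * x 0))).eval (x 0) := by
  rw [Polynomial.hom_eval₂, Polynomial.eval_map, MvPolynomial.eval_X]
  congr 1
  refine RingHom.ext fun p => ?_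
  exact eval_step a x p

theorem count_bad {n : ℕ} (I : Ideal (MvPolynomial (Fin (n + 1)) (𝓞 K)))
    (hIhom : ∀ f ∈ I, ∀ m : ℕ, MvPolynomial.homogeneousComponent m f ∈ I)
    (hcodim : ringKrullDim (MvPolynomial (Fin (n + 1)) (𝓞 K) ⧸ I) ≤ (n : WithBot ℕ∞))
    (Ωp : ∀ v : HeightOneSpectrum (𝓞 K), Set (Fin (n + 1) → v.adicCompletion K))
    (hΩp : ∀ v, Ωp v = {y : Fin (n + 1) → v.adicCompletion K |
      ∃ (c : (v.adicCompletion K)ˣ) (z : Fin (n + 1) → v.adicCompletionIntegers K),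
        (∃ i, IsUnit (z i)) ∧ (∀ i, y i = (c : v.adicCompletion K) * (z i : v.adicCompletion K)) ∧
        ∃ f ∈ I, (∃ m : ℕ, f.IsHomogeneous m) ∧
          MvPolynomial.aeval z f ∉
            Ideal.map (algebraMap (𝓞 K) (v.adicCompletionIntegers K)) v.asIdeal})
    (C : ℝ) (hC : 0 < C) (ε : ℝ) (hε : 0 < ε) :
    ∃ (M : ℕ) (B0 : ℝ), ∀ B, B0 ≤ B →
      ∃ T : Set (Fin (n+1) → 𝓞 K), T.Finite ∧ (T.ncard : ℝ) ≤ ε * B ^ (finrank ℚ K * (n+1)) ∧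
      ∀ x : Fin (n+1) → 𝓞 K, (∀ i, hs (x i) ≤ C * B) → (∃ v : HeightOneSpectrum (𝓞 K),
        M < Ideal.absNorm v.asIdeal ∧
        (fun i => algebraMap (𝓞 K) (v.adicCompletion K) (x i)) ∉ Ωp v) → x ∈ T := by
  obtain ⟨a, F, G, e, c, hF, he, hc, hGc, hFI, hGI⟩ := algebra_step I hIhom hcodim
  rcases Nat.eq_zero_or_pos n with hn | hn
  · subst hn
    haveI : Subsingleton (Fin (0 + 1)) := inferInstanceAs (Subsingleton (Fin 1))
    obtain ⟨r, rfl⟩ := MvPolynomial.C_surjective (Fin 0) F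
    have hr : r ≠ 0 := by rintro rfl; exact hF (by simp)
    obtain ⟨M, hM⟩ := not_mem_large r hr
    have hd : 0 < finrank ℚ K := Module.finrank_pos
    refine ⟨M, max 1 (1 / ε), fun B hB => ⟨{0}, Set.finite_singleton _, ?_, ?_⟩⟩
    · have h1 : 1 ≤ B := (le_max_left _ _).trans hB
      have h2 : 1 / ε ≤ B := (le_max_right _ _).trans hB
      have h3 : B ≤ B ^ (finrank ℚ K * (0+1)) := le_self_pow₀ h1 (by omega)
      rw [div_le_iff₀ hε] at h2
      rw [Set.ncard_singleton]
      push_cast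
      nlinarith
    · rintro x - ⟨v, hv, hx⟩
      by_contra hx0
      have hx00 : x 0 ≠ 0 := by
        intro h
        apply hx0
        rw [Set.mem_singleton_iff]
        funext i
        rw [Subsingleton.elim i 0, h]; rfl
      rw [hΩp] at hx
      rcases local_bad I hIhom v x (x 0) hx00 (fun _ => 1)
        (fun i => by rw [Subsingleton.elim i 0, mul_one]) hx with h | h
      · exact v.isPrime.ne_top ((Ideal.eq_top_iff_one _).2 (h 0))
      · apply hM v hv
        have := h _ hFI
        rw [eval_step, MvPolynomial.eval_C] at this
        exact this
  · obtain ⟨M1, B1, h1⟩ := count_one a F hF G e he c hc hGc C hC (ε/2) (by positivity)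
    obtain ⟨M2, B2, h2⟩ := count_one (0 : Fin n → 𝓞 K) (MvPolynomial.X ⟨0, hn⟩)
      (MvPolynomial.X_ne_zero _) (Polynomial.X) 1 Polynomial.natDegree_X_le 1 one_ne_zero
      (by simp) C hC (ε/2) (by positivity)
    refine ⟨max M1 M2, max B1 B2, fun B hB => ?_⟩
    obtain ⟨f1, c1⟩ := h1 B ((le_max_left _ _).trans hB)
    obtain ⟨f2, c2⟩ := h2 B ((le_max_right _ _).trans hB)
    refine ⟨_ ∪ _, f1.union f2, ?_, ?_⟩
    · refine le_trans (Nat.cast_le.2 (Set.ncard_union_le _ _)) ?_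
      push_cast
      linarith
    · rintro x hxB ⟨v, hv, hx⟩
      rw [hΩp] at hx
      rcases local_bad I hIhom v x 1 one_ne_zero x (fun i => by rw [one_mul]) hx with h | h
      · right
        refine ⟨hxB, v, (le_max_right _ _).trans_lt hv, ?_, ?_⟩
        · simpa using h _
        · simpa using h 0
      · left
        refine ⟨hxB, v, (le_max_left _ _).trans_lt hv, ?_, ?_⟩
        · rw [← eval_step]; exact h _ hFI
        · rw [← eval_step2]; exact h _ hGI

end Eke

/-- Ekedahl's sieve condition for closed subsets of codimension at least two of projective
space over the ring of integers of a number field: let `I ⊂ 𝔬[X₀,…,X_n]` be a homogeneous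
ideal with `dim 𝔬[X]/I ≤ n` (i.e. `V₊(I) ⊂ ℙⁿ_𝔬` has codimension at least two), and for each
prime `𝔭` let `Ω_𝔭^aff ⊂ k_𝔭^{n+1} ∖ {0}` be the set of `y` such that, writing `y = c·z`
with `c ∈ k_𝔭ˣ` and `z ∈ 𝔬_𝔭^{n+1}` having some unit coordinate, some homogeneous `f ∈ I`
has `f(z) ∉ 𝔭𝔬_𝔭`.  Then for every bounded `Ψ ⊂ k_∞^{n+1}` of positive measure with null
boundary, `lim_{M→∞} limsup_{B→∞} B^{-d(n+1)}·#{x ∈ 𝔬^{n+1} ∩ BΨ : ∃ 𝔭, N𝔭 > M,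
x ∉ Ω_𝔭^aff} = 0`.  Here `k_∞ = 𝔬 ⊗ ℝ` is realized as `ℝ^d` with `𝔬` embedded by `ι` as a
full lattice of covolume `|Δ_k|^{1/2}`. -/
theorem ekedahl_codim_two_projective (k : Type*) [Field k] [NumberField k]
    (n : ℕ) (d : ℕ) (hd : d = Module.finrank ℚ k)
    (ι : 𝓞 k →ₗ[ℤ] (Fin d → ℝ)) (hinj : Function.Injective ι)
    (hspan : Submodule.span ℝ (Set.range ι) = ⊤)
    (μinf : Measure (Fin d → ℝ)) [μinf.IsAddHaarMeasure]
    (hcovol : ZLattice.covolume (LinearMap.range ι) μinf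
      = Real.sqrt |(NumberField.discr k : ℝ)|)
    (I : Ideal (MvPolynomial (Fin (n + 1)) (𝓞 k)))
    (hIhom : ∀ f ∈ I, ∀ m : ℕ, MvPolynomial.homogeneousComponent m f ∈ I)
    (hcodim : ringKrullDim (MvPolynomial (Fin (n + 1)) (𝓞 k) ⧸ I) ≤ (n : WithBot ℕ∞))
    (Ωp : ∀ v : HeightOneSpectrum (𝓞 k), Set (Fin (n + 1) → v.adicCompletion k))
    (hΩp : ∀ v, Ωp v = {y : Fin (n + 1) → v.adicCompletion k |
      ∃ (c : (v.adicCompletion k)ˣ) (z : Fin (n + 1) → v.adicCompletionIntegers k),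
        (∃ i, IsUnit (z i)) ∧ (∀ i, y i = (c : v.adicCompletion k) * (z i : v.adicCompletion k)) ∧
        ∃ f ∈ I, (∃ m : ℕ, f.IsHomogeneous m) ∧
          MvPolynomial.aeval z f ∉
            Ideal.map (algebraMap (𝓞 k) (v.adicCompletionIntegers k)) v.asIdeal})
    (Ψ : Set (Fin (n + 1) → Fin d → ℝ)) (hbdd : Bornology.IsBounded Ψ)
    (hpos : 0 < Measure.pi (fun _ : Fin (n + 1) => μinf) Ψ)
    (hfront : Measure.pi (fun _ : Fin (n + 1) => μinf) (frontier Ψ) = 0) :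
    Tendsto (fun M : ℕ => limsup (fun B : ℝ =>
        (Nat.card {x : Fin (n + 1) → 𝓞 k | (fun i => ι (x i)) ∈ B • Ψ ∧
          ∃ v : HeightOneSpectrum (𝓞 k), M < Ideal.absNorm v.asIdeal ∧
            (fun i => algebraMap (𝓞 k) (v.adicCompletion k) (x i)) ∉ Ωp v} : ℝ)
          / B ^ (d * (n + 1))) atTop) atTop (𝓝 0) := by
  subst hd
  obtain ⟨C, hC, hCle⟩ := Eke.hs_le_norm ι hspan
  obtain ⟨R, hR0, hR⟩ : ∃ R : ℝ, 0 < R ∧ ∀ y ∈ Ψ, ‖y‖ ≤ R := by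
    obtain ⟨R, hR0, hR⟩ := hbdd.exists_pos_norm_le
    exact ⟨R, hR0, hR⟩
  have hbox : ∀ B : ℝ, 0 ≤ B → ∀ x : Fin (n+1) → 𝓞 k, (fun i => ι (x i)) ∈ B • Ψ →
      ∀ i, Eke.hs (x i) ≤ C * R * B := by
    intro B hB x hx i
    obtain ⟨y, hy, hyx⟩ := Set.mem_smul_set.1 hx
    have h1 : ‖ι (x i)‖ ≤ R * B := by
      have h2 : ι (x i) = B • y i := (congrFun hyx i).symm
      rw [h2, norm_smul, Real.norm_of_nonneg hB, mul_comm]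
      exact mul_le_mul_of_nonneg_right ((norm_le_pi_norm y i).trans (hR y hy)) hB
    calc Eke.hs (x i) ≤ C * ‖ι (x i)‖ := hCle _
      _ ≤ C * (R * B) := by gcongr
      _ = C * R * B := by ring
  rw [Metric.tendsto_atTop]
  intro ε hε
  obtain ⟨M0, B0, hMB⟩ := Eke.count_bad I hIhom hcodim Ωp hΩp (C * R) (by positivity) (ε / 2)
    (by positivity)
  refine ⟨M0, fun M hM => ?_⟩
  have hle : ∀ᶠ B : ℝ in atTop, (Nat.card {x : Fin (n + 1) → 𝓞 k | (fun i => ι (x i)) ∈ B • Ψ ∧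
          ∃ v : HeightOneSpectrum (𝓞 k), M < Ideal.absNorm v.asIdeal ∧
            (fun i => algebraMap (𝓞 k) (v.adicCompletion k) (x i)) ∉ Ωp v} : ℝ)
          / B ^ (Module.finrank ℚ k * (n + 1)) ≤ ε / 2 := by
    filter_upwards [eventually_ge_atTop B0, eventually_gt_atTop 0] with B hB hBpos
    obtain ⟨T, hTf, hTc, hT⟩ := hMB B hB
    rw [div_le_iff₀ (by positivity)]
    refine le_trans ?_ hTc
    rw [Nat.card_coe_set_eq]
    refine Nat.cast_le.2 (Set.ncard_le_ncard ?_ hTf)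
    rintro x ⟨hx, v, hv, hxv⟩
    exact hT x (hbox B hBpos.le x hx) ⟨v, lt_of_le_of_lt hM hv, hxv⟩
  have hge : ∀ᶠ B : ℝ in atTop, 0 ≤ (Nat.card {x : Fin (n + 1) → 𝓞 k | (fun i => ι (x i)) ∈ B • Ψ ∧
          ∃ v : HeightOneSpectrum (𝓞 k), M < Ideal.absNorm v.asIdeal ∧
            (fun i => algebraMap (𝓞 k) (v.adicCompletion k) (x i)) ∉ Ωp v} : ℝ)
          / B ^ (Module.finrank ℚ k * (n + 1)) := by
    filter_upwards [eventually_gt_atTop 0] with B hBpos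
    positivity
  have hub := limsup_le_of_le (IsCoboundedUnder.of_frequently_ge hge.frequently) hle
  have hlb := le_limsup_of_frequently_le hge.frequently
    (isBoundedUnder_of_eventually_le hle)
  rw [Real.dist_eq, sub_zero, abs_of_nonneg hlb]
  linarith
end
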